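/- Channels for odd-in-time solutions around a multisoliton: for every J ∈ ℕ there exist γ* > 0 and C > 0 such that for every λ = (λ₁,…,λ_J) with 0 < λ_J < … < λ₁ and γ(λ) ≤ γ*, every radial finite-energy solution u of ∂_t²u − Δu + V_λ u = 0 on ℝ × ℝ⁶, for which both limits lim_{t→±∞} ∫_{|x|≥|t|} |∇_{t,x}u|² dx exist, satisfies ‖Π⊥_{L²,λ} ∂_t u(0,·)‖²_{L²(ℝ⁶)} ≤ C ( Σ_± lim_{t→±∞} ∫_{|x|≥|t|} |∇_{t,x}u(t,x)|² dx + γ(λ)² ‖∂_t u(0,·)‖²_{L²(ℝ⁶)} ). -/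

import Mathlib

open MeasureTheory Real Filter Set Topology ENNReal RealInnerProductSpace

noncomputable section

abbrev E6 := EuclideanSpace ℝ (Fin 6)

/-- The ground state `W(x) = (1+|x|²/24)⁻²` on `ℝ⁶`. -/
def W6 (x : E6) : ℝ := ((1 + ‖x‖ ^ 2 / 24) ^ 2)⁻¹

/-- The potential `V = -2W` of the linearized equation. -/
def V6 (x : E6) : ℝ := -2 * W6 x

/-- `ΛW(x) = x·∇W(x) + 2W(x)`. -/
def LW6 (x : E6) : ℝ := fderiv ℝ W6 x x + 2 * W6 x

/-- The Laplacian of `f : ℝ⁶ → ℝ`. -/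
def lap6 (f : E6 → ℝ) (x : E6) : ℝ :=
  ∑ i : Fin 6, fderiv ℝ (fun y => fderiv ℝ f y (EuclideanSpace.single i 1)) x
    (EuclideanSpace.single i 1)

/-- `∂ₜ u`. -/
def dtu (u : ℝ → E6 → ℝ) (t : ℝ) (x : E6) : ℝ := deriv (fun s => u s x) t

/-- `∂ₜ² u`. -/
def dttu (u : ℝ → E6 → ℝ) (t : ℝ) (x : E6) : ℝ := deriv (fun s => dtu u s x) t

/-- `|∇_{t,x} u|² = (∂ₜ u)² + |∇u|²`. -/
def eDensity (u : ℝ → E6 → ℝ) (t : ℝ) (x : E6) : ℝ :=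
  dtu u t x ^ 2 + ‖gradient (u t) x‖ ^ 2

/-- `u` is a radial finite-energy solution of `∂ₜ²u - Δu + P·u = 0` on `ℝ × ℝ⁶`. -/
def IsRadSolOf (P : E6 → ℝ) (u : ℝ → E6 → ℝ) : Prop :=
  ContDiff ℝ 2 (fun p : ℝ × E6 => u p.1 p.2) ∧
  (∀ t x y, ‖x‖ = ‖y‖ → u t x = u t y) ∧
  (∀ t x, dttu u t x - lap6 (u t) x + P x * u t x = 0) ∧
  Integrable (fun x => eDensity u 0 x)

/-- `Ḣ¹`-invariant rescaling `f_{(λ)}(x) = λ⁻² f(x/λ)`. -/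
def rescH (lam : ℝ) (f : E6 → ℝ) (x : E6) : ℝ := (lam ^ 2)⁻¹ * f (lam⁻¹ • x)

/-- `L²`-invariant rescaling `f_{[λ]}(x) = λ⁻³ f(x/λ)`. -/
def rescL (lam : ℝ) (f : E6 → ℝ) (x : E6) : ℝ := (lam ^ 3)⁻¹ * f (lam⁻¹ • x)

/-- The multisoliton potential `V_λ = Σ_j V_{(λ_j)}`. -/
def Vmulti {J : ℕ} (lam : Fin J → ℝ) (x : E6) : ℝ := ∑ j, rescH (lam j) V6 x

/-- The scale separation parameter `γ(λ) = max_{1≤j≤J-1} λ_{j+1}/λ_j`. -/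
def gam {J : ℕ} (lam : Fin J → ℝ) : ℝ :=
  sSup {g | ∃ (j : Fin J) (h : (j : ℕ) + 1 < J), g = lam ⟨(j : ℕ) + 1, h⟩ / lam j}

/-- The `Z_{-3,λ}` norm of a function on `ℝ⁶`:
`sup_{R>0} (inf_j ⟨log(R/λ_j)⟩)⁻¹ (∫_{R<|x|<2R} f²)^{1/2}`. -/
def ZlamE {J : ℕ} (lam : Fin J → ℝ) (f : E6 → ℝ) : ℝ≥0∞ :=
  ⨆ R : {R : ℝ // 0 < R}, ENNReal.ofReal
    ((⨅ j, Real.sqrt (1 + Real.log (R.1 / lam j) ^ 2))⁻¹ *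
      Real.sqrt (∫ x in {x : E6 | R.1 < ‖x‖ ∧ ‖x‖ < 2 * R.1}, f x ^ 2))

/-- `v` belongs to `span((ΛW)_{[λ_j]}, 1 ≤ j ≤ J)`. -/
def InSpanL {J : ℕ} (lam : Fin J → ℝ) (v : E6 → ℝ) : Prop :=
  ∃ c : Fin J → ℝ, v = fun x => ∑ j, c j * rescL (lam j) LW6 x

/-- `w` belongs to `span((ΛW)_{(λ_j)}, 1 ≤ j ≤ J)`. -/
def InSpanH {J : ℕ} (lam : Fin J → ℝ) (w : E6 → ℝ) : Prop :=
  ∃ c : Fin J → ℝ, w = fun x => ∑ j, c j * rescH (lam j) LW6 x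

theorem cs_interval {a b : ℝ} (hab : a ≤ b) {f g : ℝ → ℝ} (hf : ContinuousOn f (Icc a b))
    (hg : ContinuousOn g (Icc a b)) :
    (∫ x in a..b, f x * g x) ^ 2 ≤ (∫ x in a..b, f x ^ 2) * ∫ x in a..b, g x ^ 2 := by
  have h1 : ∀ t : ℝ, 0 ≤ (∫ x in a..b, f x ^ 2) * (t * t) + (2 * ∫ x in a..b, f x * g x) * t +
      ∫ x in a..b, g x ^ 2 := by
    intro t
    have e : (∫ x in a..b, f x ^ 2) * (t * t) + (2 * ∫ x in a..b, f x * g x) * t +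
      ∫ x in a..b, g x ^ 2 = ∫ x in a..b, (f x * t + g x) ^ 2 := by
      rw [← intervalIntegral.integral_mul_const, ← intervalIntegral.integral_const_mul,
        ← intervalIntegral.integral_mul_const, ← intervalIntegral.integral_add,
        ← intervalIntegral.integral_add]
      · congr 1; ext x; ring
      all_goals refine ContinuousOn.intervalIntegrable_of_Icc hab ?_; fun_prop
    rw [e]
    exact intervalIntegral.integral_nonneg hab fun x _ => sq_nonneg _
  have := discrim_le_zero h1
  unfold discrim at this
  nlinarith

theorem integral_sq_add_le {a b : ℝ} (hab : a ≤ b) {f g : ℝ → ℝ} (hf : ContinuousOn f (Icc a b))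
    (hg : ContinuousOn g (Icc a b)) :
    (∫ x in a..b, (f x + g x) ^ 2) ≤ 2 * (∫ x in a..b, f x ^ 2) + 2 * ∫ x in a..b, g x ^ 2 := by
  rw [← intervalIntegral.integral_const_mul, ← intervalIntegral.integral_const_mul,
    ← intervalIntegral.integral_add]
  · refine intervalIntegral.integral_mono_on hab ?_ ?_ fun x _ => ?_
    · refine ContinuousOn.intervalIntegrable_of_Icc hab ?_; fun_prop
    · refine ContinuousOn.intervalIntegrable_of_Icc hab ?_; fun_prop
    · nlinarith [sq_nonneg (f x - g x)]
  all_goals refine ContinuousOn.intervalIntegrable_of_Icc hab ?_; fun_prop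

theorem swap_interval {a b c d : ℝ} (hab : a ≤ b) (hcd : c ≤ d) {f : ℝ × ℝ → ℝ}
    (hf : ContinuousOn f (Icc a b ×ˢ Icc c d)) :
    (∫ x in a..b, ∫ y in c..d, f (x, y)) = ∫ y in c..d, ∫ x in a..b, f (x, y) := by
  refine MeasureTheory.intervalIntegral_intervalIntegral_swap ?_
  rw [Set.uIoc_of_le hab, Set.uIoc_of_le hcd]
  exact (hf.integrableOn_compact (isCompact_Icc.prod isCompact_Icc)).mono_set
    (prod_mono Ioc_subset_Icc_self Ioc_subset_Icc_self)

theorem integral_eq_unit {a b : ℝ} (f : ℝ → ℝ) :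
    (∫ r in a..b, f r) = ∫ σ in (0:ℝ)..1, (b - a) * f (a + σ * (b - a)) := by
  have h := intervalIntegral.smul_integral_comp_add_mul f (b - a) a (a := 0) (b := 1)
  rw [intervalIntegral.integral_const_mul]
  simp only [smul_eq_mul, mul_zero, add_zero, mul_one, add_sub_cancel] at h
  rw [← h]
  simp_rw [mul_comm (b - a)]

theorem continuousOn_param {f : ℝ × ℝ → ℝ} {a b : ℝ → ℝ} {T : ℝ} (hT : 0 ≤ T)
    (ha : Continuous a) (hb : Continuous b) (hab : ∀ t ∈ Icc 0 T, a t ≤ b t)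
    (hf : ContinuousOn f {p | p.1 ∈ Icc 0 T ∧ a p.1 ≤ p.2 ∧ p.2 ≤ b p.1}) :
    ContinuousOn (fun t => ∫ r in a t..b t, f (t, r)) (Icc 0 T) := by
  let cl : ℝ → ℝ := fun t => max 0 (min t T)
  let cs : ℝ → ℝ := fun t => max 0 (min t 1)
  have hcl : Continuous cl := by fun_prop
  have hcs : Continuous cs := by fun_prop
  have hclm : ∀ t, cl t ∈ Icc 0 T := fun t =>
    ⟨le_max_left _ _, max_le hT (min_le_right _ _)⟩
  have hcsm : ∀ t, cs t ∈ Icc (0:ℝ) 1 := fun t =>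
    ⟨le_max_left _ _, max_le zero_le_one (min_le_right _ _)⟩
  have hg : Continuous (fun p : ℝ × ℝ => (b (cl p.1) - a (cl p.1)) *
      f (cl p.1, a (cl p.1) + cs p.2 * (b (cl p.1) - a (cl p.1)))) := by
    refine Continuous.mul (by fun_prop) ?_
    refine hf.comp_continuous (by fun_prop) fun p => ?_
    have h1 := hab _ (hclm p.1)
    have h2 := hcsm p.2
    refine ⟨hclm _, ?_, ?_⟩
    · have := mul_nonneg h2.1 (sub_nonneg.2 h1); simp only; linarith
    · have := mul_le_of_le_one_left (sub_nonneg.2 h1) h2.2; simp only; linarith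
  have hc := intervalIntegral.continuous_parametric_intervalIntegral_of_continuous'
    (μ := volume) (f := fun t σ => (b (cl t) - a (cl t)) *
      f (cl t, a (cl t) + cs σ * (b (cl t) - a (cl t)))) hg 0 1
  refine hc.continuousOn.congr fun t ht => ?_
  have e1 : cl t = t := by simp only [cl]; rw [min_eq_left ht.2, max_eq_right ht.1]
  simp only [e1]
  rw [integral_eq_unit]
  refine intervalIntegral.integral_congr fun σ hσ => ?_
  rw [uIcc_of_le zero_le_one] at hσ
  have e2 : cs σ = σ := by simp only [cs]; rw [min_eq_left hσ.2, max_eq_right hσ.1]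
  simp only [e2]

/-- The characteristic trapezoid `0 ≤ t ≤ T`, `η + t ≤ r ≤ M - t`. -/
def trap (η M T : ℝ) : Set (ℝ × ℝ) := {p | p.1 ∈ Icc 0 T ∧ η + p.1 ≤ p.2 ∧ p.2 ≤ M - p.1}

theorem clm_pair (A : ℝ × ℝ →L[ℝ] ℝ) (a b : ℝ) : A (a, b) = a * A (1, 0) + b * A (0, 1) := by
  rw [← smul_eq_mul, ← smul_eq_mul, ← map_smul, ← map_smul, ← map_add]; simp

theorem green {η M T : ℝ} (hT : 0 ≤ T) (hM : η + 2 * T ≤ M) {J0 J1 Q : ℝ × ℝ → ℝ}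
    (h : ∀ p ∈ trap η M T, ∃ A B : ℝ × ℝ →L[ℝ] ℝ, HasFDerivAt J0 A p ∧ HasFDerivAt J1 B p ∧
      A (1, 0) = B (0, 1) + Q p) (hQ : ContinuousOn Q (trap η M T)) :
    (∫ r in (η + T)..(M - T), J0 (T, r)) - ∫ r in η..M, J0 (0, r) =
      -(∫ t in (0:ℝ)..T, (J0 (t, η + t) + J1 (t, η + t)))
      - (∫ t in (0:ℝ)..T, (J0 (t, M - t) - J1 (t, M - t)))
      + ∫ t in (0:ℝ)..T, ∫ r in (η + t)..(M - t), Q (t, r) := by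
  let L : ℝ → ℝ := fun t => M - t - (η + t)
  let Φ : ℝ × ℝ → ℝ × ℝ := fun p => (p.1, η + p.1 + p.2 * L p.1)
  let F : ℝ × ℝ → ℝ := fun p => L p.1 * J0 (Φ p)
  let G : ℝ × ℝ → ℝ := fun p => -(J1 (Φ p) + (1 - 2 * p.2) * J0 (Φ p))
  have hΦm : ∀ p ∈ Icc 0 T ×ˢ Icc (0:ℝ) 1, Φ p ∈ trap η M T := by
    rintro ⟨t, σ⟩ ⟨⟨h1, h2⟩, h3, h4⟩
    have hL : 0 ≤ L t := by simp only [L] at *; linarith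
    refine ⟨⟨h1, h2⟩, ?_, ?_⟩
    · have := mul_nonneg h3 hL; simp only [Φ]; linarith
    · have := mul_le_of_le_one_left hL h4; simp only [Φ, L] at *; linarith
  have hΦc : Continuous Φ := by fun_prop
  have key : ∀ p ∈ Icc 0 T ×ˢ Icc (0:ℝ) 1, ∃ A B : ℝ × ℝ →L[ℝ] ℝ, HasFDerivAt F A p ∧
      HasFDerivAt G B p ∧ A (1, 0) + B (0, 1) = L p.1 * Q (Φ p) := by
    intro p hp
    obtain ⟨A, B, hA, hB, hAB⟩ := h _ (hΦm p hp)
    have hL : HasFDerivAt (fun p : ℝ × ℝ => L p.1)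
        ((-2 : ℝ) • ContinuousLinearMap.fst ℝ ℝ ℝ) p := by
      have := (((hasFDerivAt_const M p).sub (hasFDerivAt_fst (𝕜 := ℝ) (p := p))).sub
        ((hasFDerivAt_const η p).add (hasFDerivAt_fst (𝕜 := ℝ) (p := p))))
      refine this.congr_fderiv ?_
      ext <;> simp; norm_num
    have hΦ' : HasFDerivAt Φ ((ContinuousLinearMap.fst ℝ ℝ ℝ).prod
        ((1 - 2 * p.2) • ContinuousLinearMap.fst ℝ ℝ ℝ + L p.1 • ContinuousLinearMap.snd ℝ ℝ ℝ))
        p := by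
      refine HasFDerivAt.prodMk hasFDerivAt_fst ?_
      have := ((hasFDerivAt_const η p).add (hasFDerivAt_fst (𝕜 := ℝ) (p := p))).add
        ((hasFDerivAt_snd (𝕜 := ℝ) (p := p)).mul hL)
      refine this.congr_fderiv ?_
      ext <;> simp; ring
    have hA' := hA.comp p hΦ'
    have hB' := hB.comp p hΦ'
    have hs : HasFDerivAt (fun p : ℝ × ℝ => 1 - 2 * p.2)
        ((-2 : ℝ) • ContinuousLinearMap.snd ℝ ℝ ℝ) p := by
      have := (hasFDerivAt_const (1:ℝ) p).sub ((hasFDerivAt_snd (𝕜 := ℝ) (p := p)).const_mul 2)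
      refine this.congr_fderiv ?_
      ext <;> simp
    refine ⟨_, _, hL.mul hA', (hB'.add (hs.mul hA')).neg, ?_⟩
    have a1 := clm_pair A 1 (1 - 2 * p.2)
    have a2 := clm_pair A 0 (L p.1)
    have a3 := clm_pair B 0 (L p.1)
    simp [a1, a2, a3, hAB]
    ring
  have hd := integral2_divergence_prod_of_hasFDerivAt_off_countable F G (fderiv ℝ F) (fderiv ℝ G)
    0 0 T 1 ∅ countable_empty ?_ ?_ ?_ ?_ ?_
  · have e0 : (∫ r in (η + T)..(M - T), J0 (T, r)) = ∫ y in (0:ℝ)..1, F (T, y) := by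
      rw [integral_eq_unit]
    have e1 : (∫ r in η..M, J0 (0, r)) = ∫ y in (0:ℝ)..1, F (0, y) := by
      rw [integral_eq_unit]; simp [F, Φ, L]
    have e2 : (∫ t in (0:ℝ)..T, (J0 (t, η + t) + J1 (t, η + t))) =
        -∫ x in (0:ℝ)..T, G (x, 0) := by
      rw [← intervalIntegral.integral_neg]; simp [G, Φ, add_comm]
    have e3 : (∫ t in (0:ℝ)..T, (J0 (t, M - t) - J1 (t, M - t))) =
        ∫ x in (0:ℝ)..T, G (x, 1) := by
      congr 1; ext x; simp [G, Φ, L]; ring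
    have e4 : (∫ t in (0:ℝ)..T, ∫ r in (η + t)..(M - t), Q (t, r)) =
        ∫ x in (0:ℝ)..T, ∫ y in (0:ℝ)..1,
          ((fderiv ℝ F (x, y)) (1, 0) + (fderiv ℝ G (x, y)) (0, 1)) := by
      refine intervalIntegral.integral_congr fun t ht => ?_
      rw [uIcc_of_le hT] at ht
      rw [integral_eq_unit]
      refine intervalIntegral.integral_congr fun σ hσ => ?_
      rw [uIcc_of_le zero_le_one] at hσ
      obtain ⟨A, B, hA, hB, hAB⟩ := key (t, σ) ⟨ht, hσ⟩
      rw [hA.fderiv, hB.fderiv, hAB]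
    rw [e0, e1, e2, e3, e4, hd]
    ring
  · rw [uIcc_of_le hT, uIcc_of_le zero_le_one]
    intro p hp
    obtain ⟨A, B, hA, hB, hAB⟩ := key p hp
    exact hA.continuousAt.continuousWithinAt
  · rw [uIcc_of_le hT, uIcc_of_le zero_le_one]
    intro p hp
    obtain ⟨A, B, hA, hB, hAB⟩ := key p hp
    exact hB.continuousAt.continuousWithinAt
  · intro p hp
    rw [min_eq_left hT, max_eq_right hT, min_eq_left zero_le_one, max_eq_right zero_le_one] at hp
    obtain ⟨A, B, hA, hB, hAB⟩ := key p ⟨Ioo_subset_Icc_self hp.1.1, Ioo_subset_Icc_self hp.1.2⟩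
    exact hA.differentiableAt.hasFDerivAt
  · intro p hp
    rw [min_eq_left hT, max_eq_right hT, min_eq_left zero_le_one, max_eq_right zero_le_one] at hp
    obtain ⟨A, B, hA, hB, hAB⟩ := key p ⟨Ioo_subset_Icc_self hp.1.1, Ioo_subset_Icc_self hp.1.2⟩
    exact hB.differentiableAt.hasFDerivAt
  · rw [uIcc_of_le hT, uIcc_of_le zero_le_one]
    refine ContinuousOn.integrableOn_compact (isCompact_Icc.prod isCompact_Icc) ?_
    have : ContinuousOn (fun p : ℝ × ℝ => L p.1 * Q (Φ p)) (Icc 0 T ×ˢ Icc (0:ℝ) 1) :=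
      ContinuousOn.mul (by fun_prop) (hQ.comp hΦc.continuousOn hΦm)
    refine this.congr fun p hp => ?_
    obtain ⟨A, B, hA, hB, hAB⟩ := key p hp
    simp only
    rw [hA.fderiv, hB.fderiv, hAB]

theorem gronwall_volterra {T : ℝ} (hT : 0 ≤ T) {e ω θ : ℝ → ℝ} {A : ℝ}
    (he : ContinuousOn e (Icc 0 T)) (hω : Continuous ω) (hθ : Continuous θ)
    (hω0 : ∀ t, 0 ≤ ω t) (hθ0 : ∀ t, 0 ≤ θ t) (he0 : ∀ t ∈ Icc 0 T, 0 ≤ e t)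
    (h : ∀ t ∈ Icc 0 T,
      e t ≤ A + ∫ x in (0:ℝ)..t, (ω x * (x * e x + ∫ y in (0:ℝ)..x, e y) + θ x * e x)) :
    ∀ t ∈ Icc 0 T, A + ∫ x in (0:ℝ)..t, (ω x * (x * e x + ∫ y in (0:ℝ)..x, e y) + θ x * e x)
      ≤ A * exp (∫ x in (0:ℝ)..t, (2 * (x * ω x) + θ x)) := by
  let cl : ℝ → ℝ := fun t => max 0 (min t T)
  have hcl : Continuous cl := by fun_prop
  have hclm : ∀ t, cl t ∈ Icc 0 T := fun t =>
    ⟨le_max_left _ _, max_le hT (min_le_right _ _)⟩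
  have hcle : ∀ t ∈ Icc 0 T, cl t = t := fun t ht => by
    simp only [cl]; rw [min_eq_left ht.2, max_eq_right ht.1]
  let E : ℝ → ℝ := fun t => e (cl t)
  have hE : Continuous E := he.comp_continuous hcl hclm
  let I : ℝ → ℝ := fun x => ∫ y in (0:ℝ)..x, E y
  have hI : Continuous I := intervalIntegral.continuous_primitive (fun a b => hE.intervalIntegrable _ _) 0
  let g : ℝ → ℝ := fun x => ω x * (x * E x + I x) + θ x * E x
  have hg : Continuous g := by fun_prop
  let H : ℝ → ℝ := fun t => A + ∫ x in (0:ℝ)..t, g x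
  have hIe : ∀ t ∈ Icc 0 T, I t = ∫ y in (0:ℝ)..t, e y := by
    intro t ht
    refine intervalIntegral.integral_congr fun y hy => ?_
    rw [uIcc_of_le ht.1] at hy
    simp only [E]; rw [hcle y ⟨hy.1, hy.2.trans ht.2⟩]
  have hHe : ∀ t ∈ Icc 0 T, A + ∫ x in (0:ℝ)..t,
      (ω x * (x * e x + ∫ y in (0:ℝ)..x, e y) + θ x * e x) = H t := by
    intro t ht
    simp only [H]
    congr 1
    refine intervalIntegral.integral_congr fun y hy => ?_
    rw [uIcc_of_le ht.1] at hy
    have hy' : y ∈ Icc 0 T := ⟨hy.1, hy.2.trans ht.2⟩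
    simp only [g, E]; rw [hcle y hy', hIe y hy']
  have hE0 : ∀ t, 0 ≤ E t := fun t => he0 _ (hclm t)
  have hI0 : ∀ t, 0 ≤ t → 0 ≤ I t := fun t ht =>
    intervalIntegral.integral_nonneg ht fun x _ => hE0 x
  have hg0 : ∀ t, 0 ≤ t → 0 ≤ g t := fun t ht => by
    have := hE0 t; have := hI0 t ht; have := hω0 t; have := hθ0 t
    simp only [g]; positivity
  have hHd : ∀ t, HasDerivAt H (g t) t := fun t => by
    exact (intervalIntegral.integral_hasDerivAt_right (hg.intervalIntegrable 0 t)
      hg.stronglyMeasurable.stronglyMeasurableAtFilter hg.continuousAt).const_add A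
  have hHmono : ∀ x y, 0 ≤ x → x ≤ y → H x ≤ H y := by
    intro x y hx hxy
    have : (∫ u in (0:ℝ)..y, g u) - ∫ u in (0:ℝ)..x, g u = ∫ u in x..y, g u :=
      intervalIntegral.integral_interval_sub_left (hg.intervalIntegrable _ _)
        (hg.intervalIntegrable _ _)
    have h2 : 0 ≤ ∫ u in x..y, g u :=
      intervalIntegral.integral_nonneg hxy fun u hu => hg0 u (hx.trans hu.1)
    simp only [H]; linarith
  have hEH : ∀ t ∈ Icc 0 T, E t ≤ H t := by
    intro t ht
    have := h t ht
    rw [hHe t ht] at this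
    simp only [E]; rwa [hcle t ht]
  have hIH : ∀ t ∈ Icc 0 T, I t ≤ t * H t := by
    intro t ht
    have : I t ≤ ∫ y in (0:ℝ)..t, H t := by
      refine intervalIntegral.integral_mono_on ht.1 (hE.intervalIntegrable _ _)
        intervalIntegrable_const fun y hy => ?_
      exact (hEH y ⟨hy.1, hy.2.trans ht.2⟩).trans (hHmono y t hy.1 hy.2)
    simpa using this
  let k : ℝ → ℝ := fun x => 2 * (x * ω x) + θ x
  have hk : Continuous k := by fun_prop
  let P : ℝ → ℝ := fun t => ∫ x in (0:ℝ)..t, k x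
  have hPd : ∀ t, HasDerivAt P (k t) t := fun t => by
    simpa using (intervalIntegral.integral_hasDerivAt_right (hk.intervalIntegrable 0 t)
      hk.stronglyMeasurable.stronglyMeasurableAtFilter hk.continuousAt)
  have hKd : ∀ t, HasDerivAt (fun t => H t * exp (-P t))
      (g t * exp (-P t) + H t * (exp (-P t) * (-k t))) t := fun t =>
    (hHd t).mul ((hPd t).neg.exp)
  have hanti : AntitoneOn (fun t => H t * exp (-P t)) (Icc 0 T) := by
    refine antitoneOn_of_deriv_nonpos (convex_Icc 0 T)
      (fun t _ => (hKd t).continuousAt.continuousWithinAt)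
      (fun t _ => (hKd t).differentiableAt.differentiableWithinAt) fun t ht => ?_
    rw [(hKd t).deriv]
    have ht' : t ∈ Icc 0 T := interior_subset ht
    have h1 := hEH t ht'
    have h2 := hIH t ht'
    have h3 : g t ≤ k t * H t := by
      have a1 : ω t * (t * E t + I t) ≤ ω t * (2 * t * H t) := by
        refine mul_le_mul_of_nonneg_left ?_ (hω0 t)
        have := mul_le_mul_of_nonneg_left h1 ht'.1
        linarith
      have a2 := mul_le_mul_of_nonneg_left h1 (hθ0 t)
      simp only [g, k]; linarith
    have := (exp_pos (-P t)).le
    nlinarith [mul_le_mul_of_nonneg_right h3 this]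
  intro t ht
  rw [hHe t ht]
  have h1 := hanti (left_mem_Icc.2 hT) ht ht.1
  have h0 : H 0 * exp (-P 0) = A := by simp [H, P]
  simp only [h0] at h1
  have h2 : H t = H t * exp (-P t) * exp (P t) := by
    rw [mul_assoc, ← exp_add]; simp
  rw [h2]
  exact mul_le_mul_of_nonneg_right h1 (exp_pos _).le

/-- A first-order radial wave system on `r > 0`. -/
structure Wave (κ : ℝ) (V : ℝ → ℝ) (s v z Y : ℝ × ℝ → ℝ) : Prop where
  hV : ContinuousOn V (Ioi 0)
  hs : ContinuousOn s {p | 0 < p.2}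
  hv : ContinuousOn v {p | 0 < p.2}
  hv0 : ∀ r, 0 < r → v (0, r) = 0
  hvt : ∀ t r, 0 < r → HasDerivAt (fun τ => v (τ, r)) (z (t, r)) t
  hD : ∀ t r, 0 < r → ∃ A B : ℝ × ℝ →L[ℝ] ℝ, HasFDerivAt z A (t, r) ∧ HasFDerivAt Y B (t, r) ∧
    A (1, 0) = B (0, 1) + κ * Y (t, r) / r + (s (t, r) - V r * v (t, r)) ∧
    B (1, 0) = A (0, 1) - κ * z (t, r) / r

namespace Wave

variable {κ : ℝ} {V : ℝ → ℝ} {s v z Y : ℝ × ℝ → ℝ}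

theorem hz (h : Wave κ V s v z Y) : ContinuousOn z {p | 0 < p.2} := fun p hp => by
  obtain ⟨A, B, hA, -⟩ := h.hD p.1 p.2 hp
  exact hA.continuousAt.continuousWithinAt

theorem hY (h : Wave κ V s v z Y) : ContinuousOn Y {p | 0 < p.2} := fun p hp => by
  obtain ⟨A, B, hA, hB, -⟩ := h.hD p.1 p.2 hp
  exact hB.continuousAt.continuousWithinAt

theorem hV2 (h : Wave κ V s v z Y) : ContinuousOn (fun p : ℝ × ℝ => V p.2) {p | 0 < p.2} :=
  h.hV.comp continuousOn_snd fun _ hp => hp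

end Wave

theorem slice_cont {f : ℝ × ℝ → ℝ} (hf : ContinuousOn f {p | 0 < p.2}) (t : ℝ) {a b : ℝ}
    (ha : 0 < a) : ContinuousOn (fun r => f (t, r)) (Icc a b) :=
  hf.comp (by fun_prop) fun _ hr => lt_of_lt_of_le ha hr.1

theorem trap_pos {R M T : ℝ} (hR : 0 < R) : trap R M T ⊆ {p : ℝ × ℝ | 0 < p.2} := by
  rintro p ⟨⟨h1, h2⟩, h3, h4⟩
  show 0 < p.2
  linarith

theorem continuousOn_trap_integral {f : ℝ × ℝ → ℝ} {R M T : ℝ} (hR : 0 < R) (hT : 0 ≤ T)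
    (hM : R + 2 * T ≤ M) (hf : ContinuousOn f {p | 0 < p.2}) :
    ContinuousOn (fun t => ∫ r in (R + t)..(M - t), f (t, r)) (Icc 0 T) := by
  refine continuousOn_param hT (by fun_prop) (by fun_prop) (fun t ht => by
    have := ht.2; linarith) (hf.mono ?_)
  exact trap_pos (R := R) (M := M) (T := T) hR

/-- Square-integral of a time increment. -/
theorem Wave.increment_sq {κ : ℝ} {V : ℝ → ℝ} {s v z Y : ℝ × ℝ → ℝ} (h : Wave κ V s v z Y)
    {a b t₀ t : ℝ} (ha : 0 < a) (hab : a ≤ b) (ht : t₀ ≤ t) :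
    (∫ r in a..b, (v (t, r) - v (t₀, r)) ^ 2) ≤
      (t - t₀) * ∫ τ in t₀..t, ∫ r in a..b, z (τ, r) ^ 2 := by
  have hz := h.hz
  have hzs : ∀ r ∈ Icc a b, ContinuousOn (fun τ => z (τ, r)) (Icc t₀ t) := fun r hr =>
    hz.comp (by fun_prop) fun _ _ => lt_of_lt_of_le ha hr.1
  have hz2 : ContinuousOn (fun p : ℝ × ℝ => z (p.1, p.2) ^ 2) (Icc t₀ t ×ˢ Icc a b) :=
    (hz.mono fun p hp => lt_of_lt_of_le ha hp.2.1).pow 2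
  rw [swap_interval ht hab (f := fun p => z (p.1, p.2) ^ 2) hz2,
    ← intervalIntegral.integral_const_mul]
  refine intervalIntegral.integral_mono_on hab ?_ ?_ fun r hr => ?_
  · refine ContinuousOn.intervalIntegrable_of_Icc hab ?_
    exact ((slice_cont h.hv t ha).sub (slice_cont h.hv t₀ ha)).pow 2
  · refine ContinuousOn.intervalIntegrable_of_Icc hab (ContinuousOn.mul continuousOn_const ?_)
    have : ContinuousOn (fun p : ℝ × ℝ => z (p.2 + t₀, p.1) ^ 2) {p | 0 < p.1} := by
      refine (hz.comp (f := fun p : ℝ × ℝ => (p.2 + t₀, p.1)) (by fun_prop) fun p hp => hp).pow 2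
    have h3 := continuousOn_param (f := fun p : ℝ × ℝ => z (p.2, p.1 + a) ^ 2)
      (a := fun _ => t₀) (b := fun _ => t) (T := b - a) (by linarith) continuous_const
      continuous_const (fun _ _ => ht) ((hz.comp (f := fun p : ℝ × ℝ => (p.2, p.1 + a))
        (by fun_prop) fun p hp => by have := hp.1.1; show 0 < p.1 + a; linarith).pow 2)
    have h4 := h3.comp (f := fun r => r - a) (s := Icc a b) (by fun_prop) fun r hr =>
      ⟨by linarith [hr.1], by linarith [hr.2]⟩
    simpa [Function.comp_def] using h4
  · have hr0 : 0 < r := lt_of_lt_of_le ha hr.1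
    have e1 : v (t, r) - v (t₀, r) = ∫ τ in t₀..t, z (τ, r) :=
      (intervalIntegral.integral_eq_sub_of_hasDerivAt (fun τ _ => h.hvt τ r hr0)
        ((hzs r hr).intervalIntegrable_of_Icc ht)).symm
    have h5 := cs_interval ht (f := fun _ => (1:ℝ)) continuousOn_const (hzs r hr)
    simp only [one_mul, one_pow, intervalIntegral.integral_const, smul_eq_mul, mul_one] at h5
    rw [e1]
    exact h5

theorem integral_mono_interval_sq {f : ℝ → ℝ} {a b c d : ℝ} (hca : c ≤ a) (hab : a ≤ b)
    (hbd : b ≤ d) (hf : ContinuousOn f (Icc c d)) :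
    (∫ x in a..b, f x ^ 2) ≤ ∫ x in c..d, f x ^ 2 := by
  refine intervalIntegral.integral_mono_interval hca hab hbd
    (Eventually.of_forall fun x => sq_nonneg _) ?_
  exact (hf.pow 2).intervalIntegrable_of_Icc (by linarith)

theorem integral_sq_le_add {a b : ℝ} (hab : a ≤ b) {f g : ℝ → ℝ} (hf : ContinuousOn f (Icc a b))
    (hg : ContinuousOn g (Icc a b)) :
    (∫ x in a..b, f x ^ 2) ≤ ∫ x in a..b, (f x ^ 2 + g x ^ 2) := by
  refine intervalIntegral.integral_mono_on hab ?_ ?_ fun x _ => ?_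
  · exact ContinuousOn.intervalIntegrable_of_Icc hab (by fun_prop)
  · exact ContinuousOn.intervalIntegrable_of_Icc hab (by fun_prop)
  · nlinarith [sq_nonneg (g x)]

theorem integral_mul_sq_le {a b : ℝ} (hab : a ≤ b) {V f : ℝ → ℝ} {ω : ℝ}
    (hV : ContinuousOn V (Icc a b)) (hf : ContinuousOn f (Icc a b))
    (hVω : ∀ x ∈ Icc a b, |V x| ≤ ω) :
    (∫ x in a..b, (V x * f x) ^ 2) ≤ ω ^ 2 * ∫ x in a..b, f x ^ 2 := by
  rw [← intervalIntegral.integral_const_mul]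
  refine intervalIntegral.integral_mono_on hab ?_ ?_ fun x hx => ?_
  · exact ContinuousOn.intervalIntegrable_of_Icc hab (by fun_prop)
  · exact ContinuousOn.intervalIntegrable_of_Icc hab (by fun_prop)
  · rw [mul_pow]
    exact mul_le_mul_of_nonneg_right (sq_le_sq' (by linarith [(abs_le.1 (hVω x hx)).1])
      (abs_le.1 (hVω x hx)).2) (sq_nonneg _)

theorem source_pairing {a b : ℝ} (hab : a ≤ b) {V z Y v s : ℝ → ℝ} {ω θ S2 t I : ℝ}
    (hV : ContinuousOn V (Icc a b)) (hz : ContinuousOn z (Icc a b))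
    (hY : ContinuousOn Y (Icc a b)) (hv : ContinuousOn v (Icc a b))
    (hs : ContinuousOn s (Icc a b)) (hVω : ∀ x ∈ Icc a b, |V x| ≤ ω) (hω : 0 ≤ ω) (hθ : 0 ≤ θ)
    (hS2 : 0 ≤ S2) (ht : 0 ≤ t) (hI : 0 ≤ I) (hvI : (∫ x in a..b, v x ^ 2) ≤ t * I)
    (hsθ : (∫ x in a..b, s x ^ 2) ≤ S2 * θ ^ 2) :
    (∫ x in a..b, 2 * (z x * (s x - V x * v x))) ≤
      ω * (t * (∫ x in a..b, (z x ^ 2 + Y x ^ 2)) + I) + θ * (∫ x in a..b, (z x ^ 2 + Y x ^ 2))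
        + S2 * θ := by
  have ez := integral_sq_le_add hab hz hY
  set e := ∫ x in a..b, (z x ^ 2 + Y x ^ 2) with he
  have he0 : 0 ≤ e := intervalIntegral.integral_nonneg hab fun x _ => by positivity
  have eVv := (integral_mul_sq_le hab hV hv hVω).trans
    (mul_le_mul_of_nonneg_left hvI (sq_nonneg ω))
  have c1 := cs_interval hab hz hs
  have c2 := cs_interval hab hz (hV.mul hv)
  have hs0 : 0 ≤ ∫ x in a..b, s x ^ 2 := intervalIntegral.integral_nonneg hab fun x _ => sq_nonneg _
  have hv0 : 0 ≤ ∫ x in a..b, (V x * v x) ^ 2 :=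
    intervalIntegral.integral_nonneg hab fun x _ => sq_nonneg _
  have d1 : |∫ x in a..b, z x * s x| ≤ θ * (e + S2) / 2 := by
    refine abs_le_of_sq_le_sq ?_ (by positivity)
    refine c1.trans ((mul_le_mul ez hsθ hs0 he0).trans ?_)
    linarith [mul_nonneg (sq_nonneg θ) (sq_nonneg (e - S2))]
  have d2 : |∫ x in a..b, z x * (V x * v x)| ≤ ω * (t * e + I) / 2 := by
    refine abs_le_of_sq_le_sq ?_ (by positivity)
    refine c2.trans ((mul_le_mul ez eVv hv0 he0).trans ?_)
    linarith [mul_nonneg (sq_nonneg ω) (sq_nonneg (t * e - I))]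
  have e3 : (∫ x in a..b, 2 * (z x * (s x - V x * v x))) =
      2 * ((∫ x in a..b, z x * s x) - ∫ x in a..b, z x * (V x * v x)) := by
    rw [← intervalIntegral.integral_sub, ← intervalIntegral.integral_const_mul]
    · congr 1; ext x; ring
    · exact ContinuousOn.intervalIntegrable_of_Icc hab (by fun_prop)
    · exact ContinuousOn.intervalIntegrable_of_Icc hab (by fun_prop)
  rw [e3]
  linarith [(abs_le.1 d1).2, (abs_le.1 d2).1]

theorem Wave.energy_bound {κ : ℝ} {V : ℝ → ℝ} {s v z Y : ℝ × ℝ → ℝ} (h : Wave κ V s v z Y)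
    {R M T : ℝ} (hR : 0 < R) (hT : 0 ≤ T) (hM : R + 2 * T ≤ M) {ω θ : ℝ → ℝ} {S2 Ω N : ℝ}
    (hω : Continuous ω) (hθ : Continuous θ) (hω0 : ∀ t, 0 ≤ ω t) (hθ0 : ∀ t, 0 ≤ θ t)
    (hS2 : 0 ≤ S2) (hVω : ∀ t ∈ Icc 0 T, ∀ r, R + t ≤ r → |V r| ≤ ω t)
    (hsθ : ∀ t ∈ Icc 0 T, (∫ r in (R + t)..(M - t), s (t, r) ^ 2) ≤ S2 * θ t ^ 2)
    (hΩ : (∫ t in (0:ℝ)..T, t * ω t) ≤ Ω) (hθ1 : (∫ t in (0:ℝ)..T, θ t) ≤ 1)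
    (hN : (∫ r in R..M, (z (0, r) ^ 2 + Y (0, r) ^ 2)) ≤ N) :
    (∀ t ∈ Icc 0 T, (∫ r in (R + t)..(M - t), (z (t, r) ^ 2 + Y (t, r) ^ 2)) ≤
      (N + S2) * exp (2 * Ω + 1)) ∧
    (∫ t in (0:ℝ)..T, (z (t, M - t) - Y (t, M - t)) ^ 2) ≤ (N + S2) * exp (2 * Ω + 1) := by
  have hz := h.hz
  have hY := h.hY
  have hv := h.hv
  have hs := h.hs
  have hV := h.hV2
  have hQc : ContinuousOn (fun p : ℝ × ℝ => 2 * (z p * (s p - V p.2 * v p))) {p | 0 < p.2} :=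
    continuousOn_const.mul (hz.mul (hs.sub (hV.mul hv)))
  have hN0 : 0 ≤ N := le_trans (intervalIntegral.integral_nonneg (by linarith)
    fun x _ => by positivity) hN
  let e : ℝ → ℝ := fun t => ∫ r in (R + t)..(M - t), (z (t, r) ^ 2 + Y (t, r) ^ 2)
  let q : ℝ → ℝ := fun t => ∫ r in (R + t)..(M - t),
    2 * (z (t, r) * (s (t, r) - V r * v (t, r)))
  have he : ContinuousOn e (Icc 0 T) :=
    continuousOn_trap_integral (f := fun p => z p ^ 2 + Y p ^ 2) hR hT hM (by fun_prop)
  have hq : ContinuousOn q (Icc 0 T) :=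
    continuousOn_trap_integral (f := fun p => 2 * (z p * (s p - V p.2 * v p))) hR hT hM
      hQc
  have hlen : ∀ t ∈ Icc 0 T, R + t ≤ M - t := fun t ht => by linarith [ht.2]
  have hpos : ∀ t ∈ Icc 0 T, 0 < R + t := fun t ht => by linarith [ht.1]
  have he0 : ∀ t ∈ Icc 0 T, 0 ≤ e t := fun t ht =>
    intervalIntegral.integral_nonneg (hlen t ht) fun x _ => by positivity
  let I : ℝ → ℝ := fun t => ∫ y in (0:ℝ)..t, e y
  have hI : ContinuousOn I (Icc 0 T) := by
    have := intervalIntegral.continuousOn_primitive_interval (μ := volume) (f := e) (a := 0)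
      (b := T) (by rw [uIcc_of_le hT]; exact he.integrableOn_Icc)
    rwa [uIcc_of_le hT] at this
  have hI0 : ∀ t ∈ Icc 0 T, 0 ≤ I t := fun t ht =>
    intervalIntegral.integral_nonneg ht.1 fun x hx => he0 x ⟨hx.1, hx.2.trans ht.2⟩
  let g : ℝ → ℝ := fun x => ω x * (x * e x + I x) + θ x * e x
  have hg : ContinuousOn g (Icc 0 T) := by
    have := hω.continuousOn (s := Icc 0 T); have := hθ.continuousOn (s := Icc 0 T)
    fun_prop
  have hqb : ∀ t ∈ Icc 0 T, q t ≤ g t + S2 * θ t := by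
    intro t ht
    have hz' := slice_cont hz t (b := M - t) (hpos t ht)
    have hY' := slice_cont hY t (b := M - t) (hpos t ht)
    have hv' := slice_cont hv t (b := M - t) (hpos t ht)
    have hs' := slice_cont hs t (b := M - t) (hpos t ht)
    have hV' := slice_cont hV t (b := M - t) (hpos t ht)
    simp only at hV'
    have hl := hlen t ht
    have ev : (∫ r in (R + t)..(M - t), v (t, r) ^ 2) ≤ t * I t := by
      have h1 := h.increment_sq (hpos t ht) hl ht.1
      have h2 : (∫ r in (R + t)..(M - t), v (t, r) ^ 2) =
          ∫ r in (R + t)..(M - t), (v (t, r) - v (0, r)) ^ 2 := by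
        refine intervalIntegral.integral_congr fun r hr => ?_
        rw [uIcc_of_le hl] at hr
        rw [h.hv0 r (lt_of_lt_of_le (hpos t ht) hr.1), sub_zero]
      rw [h2]
      refine h1.trans ?_
      rw [sub_zero]
      refine mul_le_mul_of_nonneg_left ?_ ht.1
      refine intervalIntegral.integral_mono_on ht.1 ?_ ?_ fun x hx => ?_
      · refine ContinuousOn.intervalIntegrable_of_Icc ht.1 ?_
        refine continuousOn_param (f := fun p => z (p.1, p.2) ^ 2) (a := fun _ => R + t)
          (b := fun _ => M - t) ht.1 continuous_const continuous_const (fun _ _ => hl) ?_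
        refine (hz.mono fun p hp => ?_).pow 2
        exact lt_of_lt_of_le (hpos t ht) hp.2.1
      · exact (he.mono (Icc_subset_Icc le_rfl ht.2)).intervalIntegrable_of_Icc ht.1
      · have hx' : x ∈ Icc 0 T := ⟨hx.1, hx.2.trans ht.2⟩
        have hz'' := slice_cont hz x (b := M - x) (hpos x hx')
        have hY'' := slice_cont hY x (b := M - x) (hpos x hx')
        refine (integral_mono_interval_sq (c := R + x) (d := M - x) (by linarith [hx.2]) hl
          (by linarith [hx.2]) hz'').trans ?_
        exact integral_sq_le_add (hlen x hx') hz'' hY''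
    exact source_pairing hl hV' hz' hY' hv' hs' (fun x hx => hVω t ht x hx.1) (hω0 t) (hθ0 t) hS2
      ht.1 (hI0 t ht) ev (hsθ t ht)
  have flux : ∀ t ∈ Icc 0 T, e t + (∫ τ in (0:ℝ)..t, (z (τ, M - τ) - Y (τ, M - τ)) ^ 2) ≤
      N + S2 + ∫ x in (0:ℝ)..t, g x := by
    intro t ht
    have hsub : trap R M t ⊆ {p : ℝ × ℝ | 0 < p.2} := trap_pos hR
    have G := green (η := R) (M := M) (T := t) ht.1 (by linarith [ht.2])
      (J0 := fun p => z p ^ 2 + Y p ^ 2) (J1 := fun p => 2 * (z p * Y p))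
      (Q := fun p => 2 * (z p * (s p - V p.2 * v p))) (fun p hp => by
        obtain ⟨A, B, hA, hB, h1, h2⟩ := h.hD p.1 p.2 (hsub hp)
        refine ⟨_, _, (hA.pow 2).add (hB.pow 2), (hA.mul hB).const_mul 2, ?_⟩
        simp [h1, h2]
        ring) (hQc.mono hsub)
    simp only at G
    have p1 : 0 ≤ ∫ τ in (0:ℝ)..t, (z (τ, R + τ) ^ 2 + Y (τ, R + τ) ^ 2 +
        2 * (z (τ, R + τ) * Y (τ, R + τ))) :=
      intervalIntegral.integral_nonneg ht.1 fun x _ => by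
        nlinarith [sq_nonneg (z (x, R + x) + Y (x, R + x))]
    have p2 : (∫ τ in (0:ℝ)..t, (z (τ, M - τ) - Y (τ, M - τ)) ^ 2) =
        ∫ τ in (0:ℝ)..t, (z (τ, M - τ) ^ 2 + Y (τ, M - τ) ^ 2 -
        2 * (z (τ, M - τ) * Y (τ, M - τ))) := by
      congr 1; ext x; ring
    have p3 : (∫ τ in (0:ℝ)..t, q τ) ≤ (∫ τ in (0:ℝ)..t, g τ) + S2 * ∫ τ in (0:ℝ)..t, θ τ := by
      have hgt := (hg.mono (Icc_subset_Icc le_rfl ht.2)).intervalIntegrable_of_Icc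
        (μ := volume) ht.1
      rw [← intervalIntegral.integral_const_mul, ← intervalIntegral.integral_add hgt]
      · refine intervalIntegral.integral_mono_on ht.1 ?_ ?_ fun x hx =>
          hqb x ⟨hx.1, hx.2.trans ht.2⟩
        · exact (hq.mono (Icc_subset_Icc le_rfl ht.2)).intervalIntegrable_of_Icc ht.1
        · exact hgt.add ((hθ.const_mul _).intervalIntegrable _ _)
      · exact (hθ.const_mul _).intervalIntegrable _ _
    have p4 : (∫ τ in (0:ℝ)..t, θ τ) ≤ 1 :=
      (intervalIntegral.integral_mono_interval le_rfl ht.1 ht.2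
        (Eventually.of_forall hθ0) (hθ.intervalIntegrable _ _)).trans hθ1
    have p5 := mul_le_mul_of_nonneg_left p4 hS2
    rw [p2]
    have : e t - (∫ r in R..M, (z (0, r) ^ 2 + Y (0, r) ^ 2)) = _ := G
    linarith
  have hfl0 : ∀ t ∈ Icc 0 T, 0 ≤ ∫ τ in (0:ℝ)..t, (z (τ, M - τ) - Y (τ, M - τ)) ^ 2 :=
    fun t ht => intervalIntegral.integral_nonneg ht.1 fun x _ => sq_nonneg _
  have gw := gronwall_volterra hT he hω hθ hω0 hθ0 he0 (A := N + S2) (fun t ht => by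
    have := flux t ht; have := hfl0 t ht
    show e t ≤ N + S2 + ∫ x in (0:ℝ)..t, g x
    linarith)
  have ex : ∀ t ∈ Icc 0 T, (∫ x in (0:ℝ)..t, (2 * (x * ω x) + θ x)) ≤ 2 * Ω + 1 := by
    intro t ht
    have i1 : Continuous fun x => 2 * (x * ω x) + θ x := by fun_prop
    have i2 : Continuous fun x => 2 * (x * ω x) := by fun_prop
    have h1 : (∫ x in (0:ℝ)..t, (2 * (x * ω x) + θ x)) ≤
        ∫ x in (0:ℝ)..T, (2 * (x * ω x) + θ x) := by
      refine intervalIntegral.integral_mono_interval le_rfl ht.1 ht.2 ?_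
        (i1.intervalIntegrable _ _)
      refine ae_restrict_of_forall_mem measurableSet_Ioc fun x hx => ?_
      have := hω0 x; have := hθ0 x; have := hx.1.le
      show 0 ≤ 2 * (x * ω x) + θ x
      positivity
    refine h1.trans ?_
    rw [intervalIntegral.integral_add (i2.intervalIntegrable _ _) (hθ.intervalIntegrable _ _),
      intervalIntegral.integral_const_mul]
    linarith
  have fin : ∀ t ∈ Icc 0 T, N + S2 + (∫ x in (0:ℝ)..t, g x) ≤ (N + S2) * exp (2 * Ω + 1) :=
    fun t ht => (gw t ht).trans (mul_le_mul_of_nonneg_left (exp_le_exp.2 (ex t ht))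
      (by linarith))
  refine ⟨fun t ht => ?_, ?_⟩
  · have := fin t ht; have := flux t ht; have := hfl0 t ht
    show e t ≤ _
    linarith
  · have hTm := right_mem_Icc.2 hT
    have := fin T hTm; have := flux T hTm; have := he0 T hTm
    linarith

theorem summable_pseries {a : ℕ → ℝ} {K : ℝ} (ha : ∀ n, |a n| ≤ K * (n + 1)) {y : ℝ}
    (hy : |y| < 1) : Summable fun n => a n * y ^ n := by
  have h1 := (summable_pow_mul_geometric_of_norm_lt_one 1 (by simpa using hy : ‖|y|‖ < 1)).add
    (summable_geometric_of_lt_one (abs_nonneg y) hy)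
  refine Summable.of_norm_bounded (h1.mul_left K) fun n => ?_
  rw [norm_mul, norm_pow, Real.norm_eq_abs, Real.norm_eq_abs]
  calc |a n| * |y| ^ n ≤ K * (n + 1) * |y| ^ n := by gcongr; exact ha n
    _ = _ := by simp; ring

theorem hasDerivAt_pseries {a : ℕ → ℝ} {K : ℝ} (ha : ∀ n, |a n| ≤ K) {y : ℝ} (hy : |y| < 1) :
    HasDerivAt (fun y => ∑' n, a n * y ^ n) (∑' n : ℕ, ((n + 1) * a (n + 1)) * y ^ n) y := by
  obtain ⟨r, hr1, hr2⟩ := exists_between hy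
  have hr0 : 0 < r := (abs_nonneg y).trans_lt hr1
  have hK : 0 ≤ K := (abs_nonneg _).trans (ha 0)
  have hu : Summable fun n : ℕ => K * (n * r ^ (n - 1)) := by
    refine Summable.mul_left K ?_
    rw [← summable_nat_add_iff 1]
    have h1 := (summable_pow_mul_geometric_of_norm_lt_one 1
      (by rw [Real.norm_of_nonneg hr0.le]; exact hr2 : ‖r‖ < 1)).add
      (summable_geometric_of_lt_one hr0.le hr2)
    refine h1.congr fun n => ?_
    simp; ring
  have key := hasDerivAt_tsum_of_isPreconnected (t := Ioo (-r) r) (u := fun n : ℕ => K * (n * r ^ (n - 1)))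
    (g := fun n y => a n * y ^ n) (g' := fun n y => a n * (n * y ^ (n - 1))) (y₀ := 0) (y := y)
    hu isOpen_Ioo isPreconnected_Ioo (fun n y _ => (hasDerivAt_pow n y).const_mul _)
    (fun n y hy => by
      rw [norm_mul, norm_mul, norm_pow, Real.norm_eq_abs, Real.norm_eq_abs, Real.norm_eq_abs,
        Nat.abs_cast]
      gcongr
      · exact ha n
      · exact (abs_lt.2 hy).le) ⟨by linarith, hr0⟩
    (by
      refine summable_of_ne_finset_zero (s := {0}) fun n hn => ?_
      simp at hn
      simp [hn]) (abs_lt.1 hr1)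
  refine key.congr_deriv ?_
  have hs : Summable fun n : ℕ => a n * (n * y ^ (n - 1)) := by
    refine Summable.of_norm_bounded hu fun n => ?_
    rw [norm_mul, norm_mul, norm_pow, Real.norm_eq_abs, Real.norm_eq_abs, Real.norm_eq_abs,
        Nat.abs_cast]
    gcongr
    exact ha n
  rw [hs.tsum_eq_zero_add]
  simp
  refine tsum_congr fun n => ?_
  ring

/-- Coefficients of the Legendre function `P_{1/2}` in powers of `(1 - x) / 2`. -/
def legCoef : ℕ → ℝ
  | 0 => 1
  | n + 1 => legCoef n * ((n - 1 / 2) * (n + 3 / 2)) / (n + 1) ^ 2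

theorem legCoef_succ (n : ℕ) : (n + 1 : ℝ) ^ 2 * legCoef (n + 1) =
    (n - 1 / 2) * (n + 3 / 2) * legCoef n := by
  rw [legCoef]
  have : (n + 1 : ℝ) ≠ 0 := by positivity
  field_simp

theorem legCoef_bound (n : ℕ) : legCoef (n + 1) ≤ 0 ∧ -(3 / 4) ≤ (n + 1 : ℝ) * legCoef (n + 1) := by
  induction n with
  | zero => have := legCoef_succ 0; rw [legCoef] at this; norm_num at this ⊢; constructor <;> linarith
  | succ n ih =>
    have h := legCoef_succ (n + 1)
    obtain ⟨h1, h2⟩ := ih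
    push_cast at h ⊢
    have hp : (0:ℝ) < (n + 1 + 1) := by positivity
    have hn : (0:ℝ) ≤ n := Nat.cast_nonneg n
    have hx : (n + 1 : ℝ) * legCoef (n + 1) ≤ 0 := mul_nonpos_of_nonneg_of_nonpos (by positivity) h1
    have e1 : ((n:ℝ) + 1) * ((n + 1 + 1) * ((n + 1 + 1) * legCoef (n + 1 + 1))) =
        (n + 1 - 1 / 2) * (n + 1 + 3 / 2) * ((n + 1) * legCoef (n + 1)) := by
      linarith [congrArg (fun x => ((n:ℝ) + 1) * x) h]
    have hA : ((n:ℝ) + 1 + 1) * legCoef (n + 1 + 1) ≤ 0 := by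
      by_contra hc
      push Not at hc
      have : 0 < ((n:ℝ) + 1) * ((n + 1 + 1) * ((n + 1 + 1) * legCoef (n + 1 + 1))) := by positivity
      have : (n + 1 - 1 / 2) * (n + 1 + 3 / 2) * ((n + 1) * legCoef (n + 1)) ≤ 0 :=
        mul_nonpos_of_nonneg_of_nonpos (mul_nonneg (by linarith) (by linarith)) hx
      linarith
    refine ⟨?_, ?_⟩
    · by_contra hc
      push Not at hc
      have := mul_pos hp hc
      linarith
    · set A := ((n:ℝ) + 1 + 1) * legCoef (n + 1 + 1)
      set B := ((n:ℝ) + 1) * legCoef (n + 1)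
      by_contra hc
      push Not at hc
      have h3 : ((n:ℝ) + 1) * ((n + 1 + 1) * A) < (n + 1) * ((n + 1 + 1) * (-(3/4))) := by gcongr
      have h4 : (n + 1 - 1 / 2) * (n + 1 + 3 / 2) * (-(3/4)) ≤
          ((n:ℝ) + 1 - 1 / 2) * (n + 1 + 3 / 2) * B :=
        mul_le_mul_of_nonneg_left h2 (mul_nonneg (by linarith) (by linarith))
      nlinarith

theorem exists_legendre : ∃ P P1 P2 : ℝ → ℝ, P 1 = 1 ∧ ∀ x, 0 < x → x ≤ 1 →
    HasDerivAt P (P1 x) x ∧ HasDerivAt P1 (P2 x) x ∧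
    (1 - x ^ 2) * P2 x - 2 * x * P1 x + 3 / 4 * P x = 0 ∧ 0 ≤ P1 x ∧ P1 x ≤ 3 / 4 ∧ |P x| ≤ 1 := by
  let a := legCoef
  let b : ℕ → ℝ := fun n => (n + 1) * a (n + 1)
  let c : ℕ → ℝ := fun n => (n + 1) * b (n + 1)
  have hb : ∀ n, |b n| ≤ 3 / 4 := fun n => by
    have h := legCoef_bound n
    rw [abs_le]
    refine ⟨h.2, le_trans (mul_nonpos_of_nonneg_of_nonpos (by positivity) h.1) (by norm_num)⟩
  have hb0 : ∀ n, b n ≤ 0 := fun n =>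
    mul_nonpos_of_nonneg_of_nonpos (by positivity) (legCoef_bound n).1
  have ha : ∀ n, |a n| ≤ 1 := fun n => by
    cases n with
    | zero => simp [a, legCoef]
    | succ n =>
      have h := hb n
      simp only [b, abs_mul] at h
      have : (1:ℝ) ≤ |(n:ℝ) + 1| := by rw [abs_of_nonneg (by positivity)]; linarith [Nat.cast_nonneg (α := ℝ) n]
      nlinarith [abs_nonneg (a (n+1))]
  have hc : ∀ n, |c n| ≤ 3 / 4 * (n + 1) := fun n => by
    simp only [c, abs_mul]
    rw [abs_of_nonneg (by positivity : (0:ℝ) ≤ n + 1), mul_comm]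
    exact mul_le_mul_of_nonneg_right (hb _) (by positivity)
  have wk : ∀ {f : ℕ → ℝ} {K : ℝ}, (∀ n, |f n| ≤ K) → ∀ n, |f n| ≤ K * (n + 1) := fun hf n => by
    have := hf n
    have h0 := (abs_nonneg _).trans this
    have hn := Nat.cast_nonneg (α := ℝ) n
    nlinarith
  let F : ℝ → ℝ := fun y => ∑' n, a n * y ^ n
  let F1 : ℝ → ℝ := fun y => ∑' n, b n * y ^ n
  let F2 : ℝ → ℝ := fun y => ∑' n, c n * y ^ n
  have hF : ∀ y, |y| < 1 → HasDerivAt F (F1 y) y := fun y hy => hasDerivAt_pseries ha hy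
  have hF1 : ∀ y, |y| < 1 → HasDerivAt F1 (F2 y) y := fun y hy => hasDerivAt_pseries hb hy
  have ode : ∀ y, |y| < 1 → y * (1 - y) * F2 y + (1 - 2 * y) * F1 y + 3 / 4 * F y = 0 := by
    intro y hy
    have sa := (summable_pseries (wk ha) hy).hasSum
    have sb := (summable_pseries (wk hb) hy).hasSum
    have sc := (summable_pseries hc hy).hasSum
    have t1 : HasSum (fun n : ℕ => n * b n * y ^ n) (y * F2 y) := by
      rw [← hasSum_nat_add_iff' 1]
      simp only [Finset.sum_range_one, Nat.cast_zero, zero_mul, sub_zero]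
      refine (sc.mul_left y).congr_fun ?_
      intro n; simp only [c]; push_cast; ring
    have t2 : HasSum (fun n : ℕ => n * a n * y ^ n) (y * F1 y) := by
      rw [← hasSum_nat_add_iff' 1]
      simp only [Finset.sum_range_one, Nat.cast_zero, zero_mul, sub_zero]
      refine (sb.mul_left y).congr_fun ?_
      intro n; simp only [b]; push_cast; ring
    have t3 : HasSum (fun n : ℕ => n * (n - 1) * a n * y ^ n) (y ^ 2 * F2 y) := by
      rw [← hasSum_nat_add_iff' 2]
      simp only [Finset.sum_range_succ, Finset.sum_range_zero, Nat.cast_zero, zero_mul, sub_zero,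
        Nat.cast_one, sub_self, mul_zero, add_zero]
      refine (sc.mul_left (y ^ 2)).congr_fun ?_
      intro n; simp only [b, c]; push_cast; ring
    have tot := (((t1.sub t3).add sb).sub (t2.mul_left 2)).add (sa.mul_left (3 / 4))
    have z : (fun n : ℕ => n * b n * y ^ n - n * (n - 1) * a n * y ^ n + b n * y ^ n -
        2 * (n * a n * y ^ n) + 3 / 4 * (a n * y ^ n)) = fun _ => 0 := by
      ext n
      have := legCoef_succ n
      simp only [b]
      linear_combination y ^ n * this
    rw [z] at tot
    have := tot.unique hasSum_zero
    simp only [F, F1, F2] at *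
    linarith
  let P : ℝ → ℝ := fun x => F ((1 - x) / 2)
  let P1 : ℝ → ℝ := fun x => -(1 / 2) * F1 ((1 - x) / 2)
  let P2 : ℝ → ℝ := fun x => 1 / 4 * F2 ((1 - x) / 2)
  have hin : ∀ x, HasDerivAt (fun x : ℝ => (1 - x) / 2) (-(1 / 2)) x := fun x => by
    have := ((hasDerivAt_id x).const_sub 1).div_const 2
    simpa [neg_div] using this
  have hP1 : P 1 = 1 := by
    simp only [P, F, sub_self, zero_div]
    rw [tsum_eq_single 0 (fun n hn => by simp [hn])]
    simp [a, legCoef]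
  have hP1b : ∀ x, 0 ≤ x → x ≤ 1 → 0 ≤ P1 x ∧ P1 x ≤ 3 / 4 := by
    intro x hx hx1
    set y := (1 - x) / 2 with hy
    have y0 : 0 ≤ y := by rw [hy]; linarith
    have y1 : y ≤ 1 / 2 := by rw [hy]; linarith
    have sb := summable_pseries (wk hb) (y := y) (by rw [abs_of_nonneg y0]; linarith)
    have i1 : F1 y ≤ 0 := tsum_nonpos fun n => mul_nonpos_of_nonpos_of_nonneg (hb0 n) (by positivity)
    have g2 := summable_geometric_of_lt_one (r := y) y0 (by linarith)
    have i2 : -(3 / 2) ≤ F1 y := by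
      have h1 : ∑' n : ℕ, (-(3 / 4)) * y ^ n ≤ F1 y :=
        Summable.tsum_le_tsum (fun n => mul_le_mul_of_nonneg_right (abs_le.1 (hb n)).1
          (by positivity)) (g2.mul_left _) sb
      rw [tsum_mul_left, tsum_geometric_of_lt_one y0 (by linarith)] at h1
      have : (1 - y)⁻¹ ≤ 2 := by
        rw [inv_le_comm₀ (by linarith) (by norm_num)]; linarith
      linarith
    have e : P1 x = -(1 / 2) * F1 y := rfl
    rw [e]
    constructor <;> linarith
  have hd : ∀ x, 0 ≤ x → x ≤ 1 → HasDerivAt P (P1 x) x := by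
    intro x hx hx1
    have := (hF ((1 - x) / 2) (by rw [abs_lt]; constructor <;> linarith)).comp x (hin x)
    refine this.congr_deriv ?_
    simp only [P1]; ring
  refine ⟨P, P1, P2, hP1, fun x hx hx1 => ?_⟩
  have hy : |(1 - x) / 2| < 1 := by rw [abs_lt]; constructor <;> linarith
  refine ⟨hd x hx.le hx1, ?_, ?_, (hP1b x hx.le hx1).1, (hP1b x hx.le hx1).2, ?_⟩
  · have := ((hF1 ((1 - x) / 2) hy).comp x (hin x)).const_mul (-(1 / 2))
    refine this.congr_deriv ?_
    simp only [P2]; ring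
  · have := ode _ hy
    simp only [P, P1, P2]
    linear_combination this
  · have hcont : ContinuousOn P (Icc x 1) := fun u hu =>
      (hd u (hx.le.trans hu.1) hu.2).continuousAt.continuousWithinAt
    have hP1int : IntervalIntegrable P1 volume x 1 :=
      ContinuousOn.intervalIntegrable_of_Icc hx1 fun u hu => by
        have := ((hF1 ((1 - u) / 2) (by rw [abs_lt]; constructor <;> linarith [hu.1, hu.2])).comp u
          (hin u)).const_mul (-(1 / 2))
        exact this.continuousAt.continuousWithinAt
    have e := intervalIntegral.integral_eq_sub_of_hasDerivAt (f := P) (f' := P1) (a := x) (b := 1)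
      (fun u hu => by rw [uIcc_of_le hx1] at hu; exact hd u (hx.le.trans hu.1) hu.2) hP1int
    have l1 : 0 ≤ ∫ u in x..1, P1 u :=
      intervalIntegral.integral_nonneg hx1 fun u hu => (hP1b u (hx.le.trans hu.1) hu.2).1
    have l2 : (∫ u in x..1, P1 u) ≤ ∫ u in x..1, (3 / 4 : ℝ) :=
      intervalIntegral.integral_mono_on hx1 hP1int intervalIntegrable_const
        fun u hu => (hP1b u (hx.le.trans hu.1) hu.2).2
    simp at l2
    rw [hP1] at e
    rw [abs_le]
    constructor <;> linarith

theorem icc_cont {f : ℝ → ℝ} (hf : ContinuousOn f (Ioi 0)) {a b : ℝ} (ha : 0 < a) :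
    ContinuousOn f (Icc a b) := hf.mono fun _ hx => lt_of_lt_of_le ha hx.1

theorem icc_int {f : ℝ → ℝ} (hf : ContinuousOn f (Ioi 0)) {a b : ℝ} (ha : 0 < a) (hb : 0 < b) :
    IntervalIntegrable f volume a b := by
  refine ContinuousOn.intervalIntegrable (hf.mono fun x hx => ?_)
  exact lt_of_lt_of_le (lt_min ha hb) hx.1

theorem hasDerivAt_prim {f : ℝ → ℝ} (hf : ContinuousOn f (Ioi 0)) {a x : ℝ} (ha : 0 < a)
    (hx : 0 < x) : HasDerivAt (fun y => ∫ r in a..y, f r) (f x) x := by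
  refine intervalIntegral.integral_hasDerivAt_right (icc_int hf ha hx) ?_
    (hf.continuousAt (Ioi_mem_nhds hx))
  exact hf.stronglyMeasurableAtFilter isOpen_Ioi x hx

theorem hasDerivAt_prim_left {f : ℝ → ℝ} (hf : ContinuousOn f (Ioi 0)) {b x : ℝ} (hb : 0 < b)
    (hx : 0 < x) : HasDerivAt (fun y => ∫ r in y..b, f r) (-f x) x := by
  have := (hasDerivAt_prim hf hb hx).neg
  refine this.congr_of_eventuallyEq (Eventually.of_forall fun y => ?_)
  exact intervalIntegral.integral_symm _ _

theorem hardy_identity {F D g : ℝ → ℝ} {R M α β : ℝ} (hR : 0 < R) (hRM : R ≤ M)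
    (hF : ∀ x, 0 < x → HasDerivAt F (D x) x) (hD : ∀ x, 0 < x → x * D x = α * F x + β * g x)
    (hg : ContinuousOn g (Ioi 0)) :
    (1 + 2 * α) * (∫ x in R..M, F x ^ 2) + 2 * β * (∫ x in R..M, F x * g x) =
      M * F M ^ 2 - R * F R ^ 2 := by
  have hFc : ContinuousOn F (Ioi 0) := fun x hx => (hF x hx).continuousAt.continuousWithinAt
  have hM : 0 < M := hR.trans_le hRM
  rw [← intervalIntegral.integral_const_mul, ← intervalIntegral.integral_const_mul,
    ← intervalIntegral.integral_add]
  · refine intervalIntegral.integral_eq_sub_of_hasDerivAt (f := fun x => x * F x ^ 2)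
      (fun x hx => ?_) ?_
    · rw [uIcc_of_le hRM] at hx
      have hx0 : 0 < x := hR.trans_le hx.1
      refine ((hasDerivAt_id x).mul ((hF x hx0).pow 2)).congr_deriv ?_
      simp
      linear_combination 2 * F x * hD x hx0
    · exact icc_int (by fun_prop) hR hM
  · exact icc_int (by fun_prop) hR hM
  · exact icc_int (by fun_prop) hR hM

theorem sq_bound_of_pairing {F g : ℝ → ℝ} {R M c : ℝ} (hRM : R ≤ M) (hc : 0 < c)
    (hF : ContinuousOn F (Icc R M)) (hg : ContinuousOn g (Icc R M))
    (h : c * (∫ x in R..M, F x ^ 2) ≤ 2 * ∫ x in R..M, F x * g x) :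
    c ^ 2 * (∫ x in R..M, F x ^ 2) ≤ 4 * ∫ x in R..M, g x ^ 2 := by
  have cs := cs_interval hRM hF hg
  have hF0 : 0 ≤ ∫ x in R..M, F x ^ 2 := intervalIntegral.integral_nonneg hRM fun x _ => sq_nonneg _
  have hg0 : 0 ≤ ∫ x in R..M, g x ^ 2 := intervalIntegral.integral_nonneg hRM fun x _ => sq_nonneg _
  set X := ∫ x in R..M, F x ^ 2
  set Y := ∫ x in R..M, g x ^ 2
  set Z := ∫ x in R..M, F x * g x
  rcases hF0.eq_or_lt with h0 | h0
  · rw [← h0]; simpa using hg0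
  · have h1 : (c * X) ^ 2 ≤ 4 * Z ^ 2 := by
      have : (c * X) ^ 2 ≤ (2 * Z) ^ 2 := pow_le_pow_left₀ (by positivity) h 2
      linarith
    have h2 : X * (c ^ 2 * X) ≤ X * (4 * Y) := by nlinarith
    exact le_of_mul_le_mul_left h2 h0

theorem hardy_upper {f : ℝ → ℝ} {R M : ℝ} (hR : 0 < R) (hRM : R ≤ M)
    (hf : ContinuousOn f (Ioi 0)) :
    (∫ x in R..M, (∫ r in x..M, f r / r) ^ 2) ≤ 4 * ∫ x in R..M, f x ^ 2 := by
  have hM : 0 < M := hR.trans_le hRM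
  have hfr : ContinuousOn (fun r => f r / r) (Ioi 0) :=
    hf.div continuousOn_id fun x hx => ne_of_gt hx
  have hF : ∀ x, 0 < x → HasDerivAt (fun x => ∫ r in x..M, f r / r) (-(f x / x)) x :=
    fun x hx => hasDerivAt_prim_left hfr hM hx
  have hFc : ContinuousOn (fun x => ∫ r in x..M, f r / r) (Ioi 0) :=
    fun x hx => (hF x hx).continuousAt.continuousWithinAt
  have id := hardy_identity (α := 0) (β := -1) (g := f) hR hRM hF (fun x hx => by field_simp; ring) hf
  have := sq_bound_of_pairing hRM one_pos (icc_cont hFc hR) (icc_cont hf hR) (by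
    simp at id ⊢
    have : 0 ≤ R * (∫ r in R..M, f r / r) ^ 2 := by positivity
    linarith)
  simpa using this

theorem hardy_upper_weighted {g : ℝ → ℝ} {R M : ℝ} (hR : 0 < R) (hRM : R ≤ M)
    (hg : ContinuousOn g (Ioi 0)) :
    (∫ x in R..M, (x * ∫ r in x..M, g r / r ^ 2) ^ 2) ≤ 4 / 9 * ∫ x in R..M, g x ^ 2 := by
  have hM : 0 < M := hR.trans_le hRM
  have hgr : ContinuousOn (fun r => g r / r ^ 2) (Ioi 0) :=
    hg.div (by fun_prop) fun x hx => pow_ne_zero _ (ne_of_gt hx)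
  have hF : ∀ x, 0 < x → HasDerivAt (fun x => x * ∫ r in x..M, g r / r ^ 2)
      ((∫ r in x..M, g r / r ^ 2) - g x / x) x :=
    fun x hx => ((hasDerivAt_id x).mul (hasDerivAt_prim_left hgr hM hx)).congr_deriv (by
      simp; field_simp; ring)
  have hFc : ContinuousOn (fun x => x * ∫ r in x..M, g r / r ^ 2) (Ioi 0) :=
    fun x hx => (hF x hx).continuousAt.continuousWithinAt
  have id := hardy_identity (α := 1) (β := -1) (g := g) hR hRM hF (fun x hx => by field_simp; ring) hg
  have := sq_bound_of_pairing (c := 3) hRM (by norm_num) (icc_cont hFc hR) (icc_cont hg hR) (by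
    have : 0 ≤ R * (R * ∫ r in R..M, g r / r ^ 2) ^ 2 := by positivity
    simp only [intervalIntegral.integral_same] at id
    linarith)
  linarith

theorem hardy_lower {g : ℝ → ℝ} {R M : ℝ} (hR : 0 < R) (hRM : R ≤ M)
    (hg : ContinuousOn g (Ioi 0)) :
    (∫ x in R..M, ((x * √x)⁻¹ * ∫ r in R..x, √r * g r) ^ 2) ≤ ∫ x in R..M, g x ^ 2 := by
  have hM : 0 < M := hR.trans_le hRM
  have hgr : ContinuousOn (fun r => √r * g r) (Ioi 0) := by fun_prop
  have hF : ∀ x, 0 < x → HasDerivAt (fun x => (x * √x)⁻¹ * ∫ r in R..x, √r * g r)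
      (-(3 / 2) * ((x * √x)⁻¹ * ∫ r in R..x, √r * g r) / x + g x / x) x := fun x hx => by
    have h1 := ((hasDerivAt_id x).mul (Real.hasDerivAt_sqrt hx.ne')).inv
      (mul_pos hx (Real.sqrt_pos.2 hx)).ne'
    refine (h1.mul (hasDerivAt_prim hgr hR hx)).congr_deriv ?_
    have hs : √x ≠ 0 := by positivity
    have hs2 : √x ^ 2 = x := Real.sq_sqrt hx.le
    simp
    field_simp
    have hs3 : √x ^ 3 = x * √x := by rw [pow_succ, hs2]
    simp only [hs2, hs3]
    ring_nf
  have hFc : ContinuousOn (fun x => (x * √x)⁻¹ * ∫ r in R..x, √r * g r) (Ioi 0) :=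
    fun x hx => (hF x hx).continuousAt.continuousWithinAt
  have id := hardy_identity (α := -(3 / 2)) (β := 1) (g := g) hR hRM hF
    (fun x hx => by field_simp) hg
  have := sq_bound_of_pairing (c := 2) hRM (by norm_num) (icc_cont hFc hR) (icc_cont hg hR) (by
    have : 0 ≤ M * ((M * √M)⁻¹ * ∫ r in R..M, √r * g r) ^ 2 := by positivity
    simp only [intervalIntegral.integral_same] at id
    linarith)
  linarith

theorem minkowski_interval {T a b : ℝ} (hT : 0 ≤ T) (hab : a ≤ b) {F : ℝ × ℝ → ℝ}
    (hF : ContinuousOn F (Icc 0 T ×ˢ Icc a b)) {B : ℝ → ℝ} (hB : Continuous B)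
    (hB0 : ∀ t, 0 ≤ B t)
    (h : ∀ t ∈ Icc 0 T, (∫ x in a..b, F (t, x) ^ 2) ≤ B t ^ 2) :
    (∫ x in a..b, (∫ t in (0:ℝ)..T, F (t, x)) ^ 2) ≤ (∫ t in (0:ℝ)..T, B t) ^ 2 := by
  have main : ∀ ε, 0 < ε → (∫ x in a..b, (∫ t in (0:ℝ)..T, F (t, x)) ^ 2) ≤
      ((∫ t in (0:ℝ)..T, B t) + ε * T) ^ 2 := by
    intro ε hε
    let β : ℝ → ℝ := fun t => √(B t + ε)
    have hβ0 : ∀ t, 0 < β t := fun t => Real.sqrt_pos.2 (by have := hB0 t; linarith)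
    have hβ2 : ∀ t, β t ^ 2 = B t + ε := fun t => Real.sq_sqrt (by have := hB0 t; linarith)
    have hβc : Continuous β := by fun_prop
    have e0 : (∫ t in (0:ℝ)..T, β t ^ 2) = (∫ t in (0:ℝ)..T, B t) + ε * T := by
      simp_rw [hβ2]
      rw [intervalIntegral.integral_add (hB.intervalIntegrable _ _) intervalIntegrable_const]
      simp; ring
    have hG : ContinuousOn (fun p : ℝ × ℝ => (F (p.1, p.2) / β p.1) ^ 2)
        (Icc 0 T ×ˢ Icc a b) :=
      (hF.div (by fun_prop) fun p _ => (hβ0 p.1).ne').pow 2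
    have sw := swap_interval hT hab hG
    have hFx : ∀ x ∈ Icc a b, ContinuousOn (fun t => F (t, x)) (Icc 0 T) := fun x hx =>
      hF.comp (by fun_prop) fun t ht => ⟨ht, hx⟩
    have hFt : ∀ t ∈ Icc 0 T, ContinuousOn (fun x => F (t, x)) (Icc a b) := fun t ht =>
      hF.comp (by fun_prop) fun x hx => ⟨ht, hx⟩
    have hGint : ContinuousOn (fun x => ∫ t in (0:ℝ)..T, (F (t, x) / β t) ^ 2) (Icc a b) := by
      have h3 := continuousOn_param (f := fun p : ℝ × ℝ => (F (p.2, p.1 + a) / β p.2) ^ 2)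
        (a := fun _ => 0) (b := fun _ => T) (T := b - a) (by linarith) continuous_const
        continuous_const (fun _ _ => hT) (hG.comp (f := fun p : ℝ × ℝ => (p.2, p.1 + a))
        (by fun_prop) fun p hp => ⟨hp.2, ⟨by simpa using hp.1.1, by linarith [hp.1.2]⟩⟩)
      have h4 := h3.comp (f := fun r => r - a) (s := Icc a b) (by fun_prop) fun r hr =>
        ⟨by linarith [hr.1], by linarith [hr.2]⟩
      simpa [Function.comp_def] using h4
    have hFint : ContinuousOn (fun x => ∫ t in (0:ℝ)..T, F (t, x)) (Icc a b) := by
      have h3 := continuousOn_param (f := fun p : ℝ × ℝ => F (p.2, p.1 + a))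
        (a := fun _ => 0) (b := fun _ => T) (T := b - a) (by linarith) continuous_const
        continuous_const (fun _ _ => hT) (hF.comp (f := fun p : ℝ × ℝ => (p.2, p.1 + a))
        (by fun_prop) fun p hp => ⟨hp.2, ⟨by simpa using hp.1.1, by linarith [hp.1.2]⟩⟩)
      have h4 := h3.comp (f := fun r => r - a) (s := Icc a b) (by fun_prop) fun r hr =>
        ⟨by linarith [hr.1], by linarith [hr.2]⟩
      simpa [Function.comp_def] using h4
    have h1 : (∫ x in a..b, (∫ t in (0:ℝ)..T, F (t, x)) ^ 2) ≤
        ∫ x in a..b, (∫ t in (0:ℝ)..T, β t ^ 2) * ∫ t in (0:ℝ)..T, (F (t, x) / β t) ^ 2 := by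
      refine intervalIntegral.integral_mono_on hab ?_ ?_ fun x hx => ?_
      · exact (hFint.pow 2).intervalIntegrable_of_Icc hab
      · exact (continuousOn_const.mul hGint).intervalIntegrable_of_Icc hab
      · have := cs_interval hT (f := β) (g := fun t => F (t, x) / β t) hβc.continuousOn
          ((hFx x hx).div hβc.continuousOn fun t _ => (hβ0 t).ne')
        refine le_trans (le_of_eq ?_) this
        congr 1
        refine intervalIntegral.integral_congr fun t _ => ?_
        have := (hβ0 t).ne'
        field_simp
    rw [intervalIntegral.integral_const_mul, ← sw] at h1
    have h2 : (∫ t in (0:ℝ)..T, ∫ x in a..b, (F (t, x) / β t) ^ 2) ≤ ∫ t in (0:ℝ)..T, β t ^ 2 := by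
      refine intervalIntegral.integral_mono_on hT ?_ ?_ fun t ht => ?_
      · refine ContinuousOn.intervalIntegrable_of_Icc hT ?_
        refine continuousOn_param (f := fun p : ℝ × ℝ => (F (p.1, p.2) / β p.1) ^ 2)
          (a := fun _ => a) (b := fun _ => b) hT continuous_const continuous_const
          (fun _ _ => hab) (hG.mono fun p hp => ⟨hp.1, hp.2⟩)
      · exact (hβc.pow 2).intervalIntegrable _ _
      · simp_rw [div_pow]
        rw [intervalIntegral.integral_div, div_le_iff₀ (by have := hβ0 t; positivity), hβ2]
        have := h t ht
        have := hB0 t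
        nlinarith
    have h3 : 0 ≤ ∫ t in (0:ℝ)..T, β t ^ 2 :=
      intervalIntegral.integral_nonneg hT fun t _ => sq_nonneg _
    rw [← e0]
    nlinarith
  have lim : Tendsto (fun ε : ℝ => ((∫ t in (0:ℝ)..T, B t) + ε * T) ^ 2) (𝓝[>] 0)
      (𝓝 (((∫ t in (0:ℝ)..T, B t) + 0 * T) ^ 2)) := by
    refine Tendsto.mono_left ?_ nhdsWithin_le_nhds
    exact Continuous.tendsto (by fun_prop) 0
  rw [zero_mul, add_zero] at lim
  exact ge_of_tendsto lim (eventually_nhdsWithin_of_forall fun ε hε => main ε hε)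

/-- Properties of the Legendre function `P_{1/2}` with first two derivatives on `(0, 1]`. -/
structure IsLeg (P P1 P2 : ℝ → ℝ) : Prop where
  one : P 1 = 1
  d : ∀ x, 0 < x → x ≤ 1 → HasDerivAt P (P1 x) x
  d1 : ∀ x, 0 < x → x ≤ 1 → HasDerivAt P1 (P2 x) x
  ode : ∀ x, 0 < x → x ≤ 1 → (1 - x ^ 2) * P2 x - 2 * x * P1 x + 3 / 4 * P x = 0
  nonneg : ∀ x, 0 < x → x ≤ 1 → 0 ≤ P1 x
  le : ∀ x, 0 < x → x ≤ 1 → P1 x ≤ 3 / 4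
  abs_le : ∀ x, 0 < x → x ≤ 1 → |P x| ≤ 1

theorem exists_isLeg : ∃ P P1 P2, IsLeg P P1 P2 := by
  obtain ⟨P, P1, P2, h1, h⟩ := exists_legendre
  exact ⟨P, P1, P2, h1, fun x a b => (h x a b).1, fun x a b => (h x a b).2.1,
    fun x a b => (h x a b).2.2.1, fun x a b => (h x a b).2.2.2.1,
    fun x a b => (h x a b).2.2.2.2.1, fun x a b => (h x a b).2.2.2.2.2⟩

/-- The companion multiplier `-(x P1 + (3/2) P)`. -/
def legA (P P1 : ℝ → ℝ) (x : ℝ) : ℝ := -(x * P1 x + 3 / 2 * P x)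

namespace IsLeg

variable {P P1 P2 : ℝ → ℝ}

theorem legA_abs (h : IsLeg P P1 P2) {x : ℝ} (hx : 0 < x) (hx1 : x ≤ 1) :
    |legA P P1 x| ≤ 9 / 4 := by
  have a := h.nonneg x hx hx1
  have b := h.le x hx hx1
  have c := _root_.abs_le.1 (h.abs_le x hx hx1)
  have d : 0 ≤ x * P1 x := by positivity
  have e : x * P1 x ≤ 3 / 4 := by nlinarith
  rw [legA, _root_.abs_le]
  constructor <;> linarith

theorem legA_deriv (h : IsLeg P P1 P2) {x : ℝ} (hx : 0 < x) (hx1 : x ≤ 1) :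
    HasDerivAt (legA P P1) (-(5 / 2 * P1 x + x * P2 x)) x := by
  have := (((hasDerivAt_id x).mul (h.d1 x hx hx1)).add ((h.d x hx hx1).const_mul (3 / 2))).neg
  refine this.congr_deriv ?_
  simp; ring

theorem cont_P (h : IsLeg P P1 P2) : ContinuousOn P (Ioc 0 1) := fun x hx =>
  (h.d x hx.1 hx.2).continuousAt.continuousWithinAt

theorem cont_P1 (h : IsLeg P P1 P2) : ContinuousOn P1 (Ioc 0 1) := fun x hx =>
  (h.d1 x hx.1 hx.2).continuousAt.continuousWithinAt

theorem cont_legA (h : IsLeg P P1 P2) : ContinuousOn (legA P P1) (Ioc 0 1) := fun _ hx =>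
  (h.legA_deriv hx.1 hx.2).continuousAt.continuousWithinAt

end IsLeg

theorem kernel_hasFDerivAt {g : ℝ → ℝ} {g' η t r : ℝ} (hr : 0 < r)
    (hg : HasDerivAt g g' ((t + η) / r)) :
    ∃ A : ℝ × ℝ →L[ℝ] ℝ, HasFDerivAt (fun p : ℝ × ℝ => g ((p.1 + η) / p.2) / p.2) A (t, r) ∧
      A (1, 0) = g' / r ^ 2 ∧ A (0, 1) = -(g' * ((t + η) / r) + g ((t + η) / r)) / r ^ 2 := by
  have h1 : HasFDerivAt (fun p : ℝ × ℝ => p.2⁻¹)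
      ((-(r ^ 2)⁻¹) • ContinuousLinearMap.snd ℝ ℝ ℝ) (t, r) :=
    (hasDerivAt_inv (x := r) hr.ne').comp_hasFDerivAt (t, r) (hasFDerivAt_snd (𝕜 := ℝ))
  have h2 := ((hasFDerivAt_fst (𝕜 := ℝ) (p := (t, r))).add_const η).mul h1
  have h3 : HasDerivAt g g' ((fun p : ℝ × ℝ => (p.1 + η) * p.2⁻¹) (t, r)) := by
    simpa [div_eq_mul_inv] using hg
  have h4 := (h3.comp_hasFDerivAt (t, r) h2).mul h1
  refine ⟨_, h4.congr_of_eventuallyEq (Eventually.of_forall fun p => ?_), ?_, ?_⟩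
  · simp [div_eq_mul_inv]
  · simp; field_simp
  · simp; field_simp

theorem Wave.representation {V : ℝ → ℝ} {s v z U : ℝ × ℝ → ℝ} (h : Wave (-(3 / 2)) V s v z U)
    (hU0 : ∀ r, 0 < r → U (0, r) = 0) {P P1 P2 : ℝ → ℝ} (hP : IsLeg P P1 P2) {η M T : ℝ}
    (hη : 0 < η) (hT : 0 ≤ T) (hM : η + 2 * T ≤ M) :
    z (0, η) + (∫ r in η..M, legA P P1 (η / r) / r * z (0, r)) =
      (z (T, η + T) - U (T, η + T)) -
      (∫ t in (0:ℝ)..T, (s (t, η + t) - V (η + t) * v (t, η + t))) +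
      (∫ r in (η + T)..(M - T), (legA P P1 ((T + η) / r) / r * z (T, r) +
        P1 ((T + η) / r) / r * U (T, r))) +
      (∫ t in (0:ℝ)..T, (legA P P1 ((t + η) / (M - t)) / (M - t) - P1 ((t + η) / (M - t)) / (M - t))
        * (z (t, M - t) - U (t, M - t))) -
      (∫ t in (0:ℝ)..T, ∫ r in (η + t)..(M - t), legA P P1 ((t + η) / r) / r *
        (s (t, r) - V r * v (t, r))) := by
  have hz := h.hz
  have hU := h.hY
  have hfc : ContinuousOn (fun p : ℝ × ℝ => s p - V p.2 * v p) {p | 0 < p.2} :=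
    h.hs.sub (h.hV2.mul h.hv)
  have hsub : trap η M T ⊆ {p : ℝ × ℝ | 0 < p.2} := trap_pos hη
  have hs1 : ∀ p ∈ trap η M T, (p.1 + η) / p.2 ∈ Ioc (0:ℝ) 1 := fun p hp => by
    have := hsub hp
    have h1 := hp.1.1
    have h2 := hp.2.1
    refine ⟨div_pos (by linarith) this, (div_le_one this).2 (by linarith)⟩
  have kc : ContinuousOn (fun p : ℝ × ℝ => legA P P1 ((p.1 + η) / p.2) / p.2) (trap η M T) := by
    refine ContinuousOn.div ?_ continuousOn_snd fun p hp => (hsub hp).ne'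
    exact hP.cont_legA.comp (ContinuousOn.div (by fun_prop) continuousOn_snd
      fun p hp => (hsub hp).ne') hs1
  have G := green (η := η) (M := M) (T := T) hT hM
    (J0 := fun p => legA P P1 ((p.1 + η) / p.2) / p.2 * z p + P1 ((p.1 + η) / p.2) / p.2 * U p)
    (J1 := fun p => legA P P1 ((p.1 + η) / p.2) / p.2 * U p + P1 ((p.1 + η) / p.2) / p.2 * z p)
    (Q := fun p => legA P P1 ((p.1 + η) / p.2) / p.2 * (s p - V p.2 * v p)) (fun p hp => by
      have hp0 : 0 < p.2 := hsub hp
      have hp1 := hs1 p hp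
      obtain ⟨A, B, hA, hB, h1, h2⟩ := h.hD p.1 p.2 hp0
      obtain ⟨a, ha, ha0, ha1⟩ := kernel_hasFDerivAt hp0 (hP.legA_deriv hp1.1 hp1.2)
      obtain ⟨b, hb, hb0, hb1⟩ := kernel_hasFDerivAt hp0 (hP.d1 _ hp1.1 hp1.2)
      refine ⟨_, _, (ha.mul hA).add (hb.mul hB), (ha.mul hB).add (hb.mul hA), ?_⟩
      have ode := hP.ode _ hp1.1 hp1.2
      simp only [add_apply, smul_apply, smul_eq_mul,
        ha0, ha1, hb0, hb1, h1, h2, legA, Prod.mk.eta] at ode ⊢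
      have hne := hp0.ne'
      generalize (p.1 + η) / p.2 = x at *
      generalize P2 x = c2 at *
      generalize P1 x = c1 at *
      generalize P x = c0 at *
      field_simp
      linear_combination 4 * U p * ode) (kc.mul (hfc.mono hsub))
  have tr : (z (T, η + T) - U (T, η + T)) - z (0, η) = ∫ t in (0:ℝ)..T,
      (-(3 / 2) * (z (t, η + t) + U (t, η + t)) / (η + t) +
        (s (t, η + t) - V (η + t) * v (t, η + t))) := by
    have hcurve : ContinuousOn (fun t : ℝ => (t, η + t)) (Icc 0 T) := by fun_prop
    have hcm : MapsTo (fun t : ℝ => (t, η + t)) (Icc 0 T) {p : ℝ × ℝ | 0 < p.2} := fun t ht => by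
      show 0 < η + t
      linarith [ht.1]
    have := intervalIntegral.integral_eq_sub_of_hasDerivAt (a := 0) (b := T)
      (f := fun t => z (t, η + t) - U (t, η + t)) (f' := fun t =>
        -(3 / 2) * (z (t, η + t) + U (t, η + t)) / (η + t) +
        (s (t, η + t) - V (η + t) * v (t, η + t))) (fun t ht => by
        rw [uIcc_of_le hT] at ht
        have hp0 : 0 < η + t := by linarith [ht.1]
        obtain ⟨A, B, hA, hB, h1, h2⟩ := h.hD t (η + t) hp0
        have hc : HasDerivAt (fun t : ℝ => (t, η + t)) ((1:ℝ), (1:ℝ)) t :=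
          (hasDerivAt_id t).prodMk ((hasDerivAt_id t).const_add η)
        refine ((hA.comp_hasDerivAt t hc).sub (hB.comp_hasDerivAt t hc)).congr_deriv ?_
        rw [clm_pair A 1 1, clm_pair B 1 1, h1, h2]
        ring) (by
        refine ContinuousOn.intervalIntegrable_of_Icc hT ?_
        refine ContinuousOn.add (ContinuousOn.div (continuousOn_const.mul
          ((hz.comp hcurve hcm).add (hU.comp hcurve hcm))) (by fun_prop) fun t ht => ?_)
          (hfc.comp hcurve hcm)
        have := ht.1
        show η + t ≠ 0
        linarith)
    rw [this]
    have e0 := hU0 η hη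
    simp [e0]
  have spl : (∫ t in (0:ℝ)..T, (-(3 / 2) * (z (t, η + t) + U (t, η + t)) / (η + t) +
        (s (t, η + t) - V (η + t) * v (t, η + t)))) =
      (∫ t in (0:ℝ)..T, (-(3 / 2) * (z (t, η + t) + U (t, η + t)) / (η + t))) +
        ∫ t in (0:ℝ)..T, (s (t, η + t) - V (η + t) * v (t, η + t)) := by
    have hcurve : ContinuousOn (fun t : ℝ => (t, η + t)) (Icc 0 T) := by fun_prop
    have hcm : MapsTo (fun t : ℝ => (t, η + t)) (Icc 0 T) {p : ℝ × ℝ | 0 < p.2} := fun t ht => by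
      show 0 < η + t
      linarith [ht.1]
    refine intervalIntegral.integral_add ?_ ?_
    · refine ContinuousOn.intervalIntegrable_of_Icc hT ?_
      refine (ContinuousOn.div (continuousOn_const.mul
          ((hz.comp hcurve hcm).add (hU.comp hcurve hcm))) (by fun_prop) fun t ht => ?_)
      have := ht.1
      show η + t ≠ 0
      linarith
    · exact ContinuousOn.intervalIntegrable_of_Icc hT (hfc.comp hcurve hcm)
  have g1 : (∫ t in (0:ℝ)..T, (legA P P1 ((t + η) / (η + t)) / (η + t) * z (t, η + t) +
        P1 ((t + η) / (η + t)) / (η + t) * U (t, η + t) +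
        (legA P P1 ((t + η) / (η + t)) / (η + t) * U (t, η + t) +
          P1 ((t + η) / (η + t)) / (η + t) * z (t, η + t)))) =
      ∫ t in (0:ℝ)..T, (-(3 / 2) * (z (t, η + t) + U (t, η + t)) / (η + t)) := by
    refine intervalIntegral.integral_congr fun t ht => ?_
    rw [uIcc_of_le hT] at ht
    have hp0 : 0 < η + t := by linarith [ht.1]
    have e : (t + η) / (η + t) = 1 := by rw [add_comm t η]; exact div_self hp0.ne'
    simp only [e, legA, hP.one]
    field_simp
    ring
  have g2 : (∫ t in (0:ℝ)..T, (legA P P1 ((t + η) / (M - t)) / (M - t) * z (t, M - t) +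
        P1 ((t + η) / (M - t)) / (M - t) * U (t, M - t) -
        (legA P P1 ((t + η) / (M - t)) / (M - t) * U (t, M - t) +
          P1 ((t + η) / (M - t)) / (M - t) * z (t, M - t)))) =
      ∫ t in (0:ℝ)..T, (legA P P1 ((t + η) / (M - t)) / (M - t) - P1 ((t + η) / (M - t)) / (M - t))
        * (z (t, M - t) - U (t, M - t)) := by
    congr 1; ext t; ring
  have g3 : (∫ r in η..M, (legA P P1 ((0 + η) / r) / r * z (0, r) +
      P1 ((0 + η) / r) / r * U (0, r))) = ∫ r in η..M, legA P P1 (η / r) / r * z (0, r) := by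
    refine intervalIntegral.integral_congr fun r hr => ?_
    rw [uIcc_of_le (by linarith)] at hr
    simp [hU0 r (hη.trans_le hr.1)]
  simp only at G
  rw [g1, g2, g3] at G
  rw [spl] at tr
  linarith

/-- The profile `r^{-3/2}`. -/
def rho (r : ℝ) : ℝ := (r * √r)⁻¹

theorem rho_cont : ContinuousOn rho (Ioi 0) := by
  refine ContinuousOn.inv₀ (by fun_prop) fun r hr => ?_
  exact (mul_pos hr (Real.sqrt_pos.2 hr)).ne'

theorem rho_sq {r : ℝ} (hr : 0 < r) : rho r ^ 2 = (r ^ 3)⁻¹ := by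
  have := Real.sq_sqrt hr.le
  rw [rho, inv_pow, mul_pow, this]
  ring

theorem rho_sq_integral {R : ℝ} (hR : 0 < R) :
    IntegrableOn (fun r => rho r ^ 2) (Ioi R) ∧ (∫ r in Ioi R, rho r ^ 2) = 1 / (2 * R ^ 2) := by
  have e : EqOn (fun r => rho r ^ 2) (fun r => r ^ (-3 : ℝ)) (Ioi R) := fun r hr => by
    have hr0 : 0 < r := hR.trans hr
    show rho r ^ 2 = r ^ (-3 : ℝ)
    rw [rho_sq hr0, Real.rpow_neg hr0.le]
    norm_cast
  constructor
  · exact (integrableOn_Ioi_rpow_of_lt (by norm_num) hR).congr_fun e.symm measurableSet_Ioi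
  · rw [setIntegral_congr_fun measurableSet_Ioi e, integral_Ioi_rpow_of_lt (by norm_num) hR]
    rw [show (-3 : ℝ) + 1 = -((2:ℕ):ℝ) by norm_num, Real.rpow_neg hR.le, Real.rpow_natCast]
    push_cast
    field_simp

theorem integral_quad {μ : Measure ℝ} {f g h : ℝ → ℝ} (hf : Integrable f μ) (hg : Integrable g μ)
    (hh : Integrable h μ) (a b : ℝ) : (∫ r, (f r - a * g r + b * h r) ∂μ) =
      (∫ r, f r ∂μ) - a * (∫ r, g r ∂μ) + b * ∫ r, h r ∂μ := by
  rw [← integral_const_mul, ← integral_const_mul, ← integral_sub hf (hg.const_mul a)]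
  exact integral_add (hf.sub (hg.const_mul a)) (hh.const_mul b)

theorem interval_quad {s t : ℝ} {f g h : ℝ → ℝ} (hf : IntervalIntegrable f volume s t)
    (hg : IntervalIntegrable g volume s t) (hh : IntervalIntegrable h volume s t) (a b : ℝ) :
    (∫ r in s..t, (f r - a * g r + b * h r)) =
      (∫ r in s..t, f r) - a * (∫ r in s..t, g r) + b * ∫ r in s..t, h r := by
  rw [← intervalIntegral.integral_const_mul, ← intervalIntegral.integral_const_mul,
    ← intervalIntegral.integral_sub hf (hg.const_mul a)]
  exact intervalIntegral.integral_add (hf.sub (hg.const_mul a)) (hh.const_mul b)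

/-- The Volterra transform of `w` with Legendre kernel. -/
def legT (P P1 w : ℝ → ℝ) (M η : ℝ) : ℝ := w η + ∫ r in η..M, legA P P1 (η / r) / r * w r

theorem ker_cont {w : ℝ → ℝ} (hw : ContinuousOn w (Ioi 0)) {R M : ℝ} (hR : 0 < R)
    {k : ℝ → ℝ} (hk : ContinuousOn k (Ioc 0 1)) :
    ContinuousOn (fun r => k (R / r) / r * w r) (Icc R M) := by
  have h0 : ∀ r ∈ Icc R M, 0 < r := fun r hr => hR.trans_le hr.1
  refine ContinuousOn.mul (ContinuousOn.div ?_ continuousOn_id fun r hr => (h0 r hr).ne')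
    (icc_cont hw hR)
  exact hk.comp (ContinuousOn.div continuousOn_const continuousOn_id fun r hr => (h0 r hr).ne')
    fun r hr => ⟨div_pos hR (h0 r hr), (div_le_one (h0 r hr)).2 hr.1⟩

theorem ker_param {w : ℝ → ℝ} (hw : ContinuousOn w (Ioi 0)) {R M : ℝ} (hR : 0 < R) (hRM : R ≤ M)
    {k : ℝ → ℝ} (hk : ContinuousOn k (Ioc 0 1)) :
    ContinuousOn (fun η => ∫ r in η..M, k (η / r) / r * w r) (Icc R M) := by
  have := continuousOn_param (f := fun p => k ((R + p.1) / p.2) / p.2 * w p.2)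
    (a := fun t => R + t) (b := fun _ => M) (T := M - R) (by linarith) (by fun_prop) (by fun_prop)
    (fun t ht => by linarith [ht.2]) (by
      have h0 : ∀ p ∈ {p : ℝ × ℝ | p.1 ∈ Icc 0 (M - R) ∧ R + p.1 ≤ p.2 ∧ p.2 ≤ M}, 0 < p.2 :=
        fun p hp => by linarith [hp.1.1, hp.2.1]
      refine ContinuousOn.mul (ContinuousOn.div ?_ continuousOn_snd fun r hr => (h0 r hr).ne')
        (hw.comp continuousOn_snd h0)
      exact hk.comp (ContinuousOn.div (by fun_prop) continuousOn_snd fun r hr => (h0 r hr).ne')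
        fun r hr => ⟨div_pos (by linarith [hr.1.1]) (h0 r hr), (div_le_one (h0 r hr)).2 hr.2.1⟩)
  have h2 := this.comp (f := fun η => η - R) (s := Icc R M) (by fun_prop) fun η hη =>
    ⟨by linarith [hη.1], by linarith [hη.2]⟩
  refine h2.congr fun η _ => ?_
  simp

theorem ker_abs {w : ℝ → ℝ} (hw : ContinuousOn w (Ioi 0)) {R M : ℝ} (hR : 0 < R) (hRM : R ≤ M)
    {k : ℝ → ℝ} (hk : ContinuousOn k (Ioc 0 1)) {C : ℝ}
    (hC : ∀ s, 0 < s → s ≤ 1 → |k s| ≤ C) :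
    |∫ r in R..M, k (R / r) / r * w r| ≤ C * ∫ r in R..M, |w r| / r := by
  have h0 : ∀ r ∈ Icc R M, 0 < r := fun r hr => hR.trans_le hr.1
  rw [← intervalIntegral.integral_const_mul]
  refine (intervalIntegral.abs_integral_le_integral_abs hRM).trans ?_
  refine intervalIntegral.integral_mono_on hRM ?_ ?_ fun r hr => ?_
  · exact ContinuousOn.intervalIntegrable_of_Icc hRM (ker_cont hw hR hk).abs
  · refine ContinuousOn.intervalIntegrable_of_Icc hRM (continuousOn_const.mul ?_)
    exact (icc_cont hw hR).abs.div continuousOn_id fun r hr => (h0 r hr).ne'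
  · have hr0 := h0 r hr
    have := hC (R / r) (div_pos hR hr0) ((div_le_one hr0).2 hr.1)
    rw [abs_mul, abs_div, abs_of_pos hr0, div_mul_eq_mul_div, mul_div_assoc]
    exact mul_le_mul_of_nonneg_right this (by positivity)

theorem legT_eq {P P1 P2 : ℝ → ℝ} (hP : IsLeg P P1 P2) {w : ℝ → ℝ} (hw : ContinuousOn w (Ioi 0))
    {R M : ℝ} (hR : 0 < R) (hRM : R ≤ M) :
    legT P P1 w M R = (w R - 3 / 2 * ∫ r in R..M, w r / r) -
    ∫ r in R..M, (R / r * P1 (R / r)) / r * (w r - 3 / 2 * ∫ x in r..M, w x / x) := by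
  have h0 : ∀ r ∈ Icc R M, 0 < r := fun r hr => hR.trans_le hr.1
  have hM := hR.trans_le hRM
  have hwr : ContinuousOn (fun r => w r / r) (Ioi 0) :=
    hw.div continuousOn_id fun x hx => ne_of_gt hx
  have hZ := fun x (hx : 0 < x) => hasDerivAt_prim_left hwr hM hx
  set Z : ℝ → ℝ := fun y => ∫ x in y..M, w x / x with hZd
  have hZc : ContinuousOn Z (Ioi 0) := fun x hx => (hZ x hx).continuousAt.continuousWithinAt
  have hs : ∀ r ∈ Icc R M, R / r ∈ Ioc (0:ℝ) 1 := fun r hr =>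
    ⟨div_pos hR (h0 r hr), (div_le_one (h0 r hr)).2 hr.1⟩
  have hk1 : ContinuousOn (fun s => s * P1 s) (Ioc 0 1) := continuousOn_id.mul hP.cont_P1
  have c1 := ker_cont (M := M) hw hR hk1
  have c2 := ker_cont (M := M) hZc hR hk1
  have c3 := ker_cont (M := M) hw hR hP.cont_P
  have key : (∫ r in R..M, (-(R / r * P1 (R / r) / r * Z r) - P (R / r) / r * w r)) = -Z R := by
    have := intervalIntegral.integral_eq_sub_of_hasDerivAt (a := R) (b := M)
      (f := fun r => P (R / r) * Z r)
      (f' := fun r => (-(R / r * P1 (R / r) / r * Z r) - P (R / r) / r * w r)) (fun r hr => by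
        rw [uIcc_of_le hRM] at hr
        have hr0 := h0 r hr
        have hd : HasDerivAt (fun r : ℝ => R / r) (R * -(r ^ 2)⁻¹) r :=
          (hasDerivAt_inv hr0.ne').const_mul R
        refine (((hP.d _ (hs r hr).1 (hs r hr).2).comp r hd).mul (hZ r hr0)).congr_deriv ?_
        simp only [Function.comp]
        field_simp
        ring) (ContinuousOn.intervalIntegrable_of_Icc hRM (c2.neg.sub c3))
    rw [this]
    simp [hZd, div_self hR.ne', hP.one]
  have i1 := c1.intervalIntegrable_of_Icc (μ := volume) hRM
  have i2 := c2.intervalIntegrable_of_Icc (μ := volume) hRM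
  have i3 := c3.intervalIntegrable_of_Icc (μ := volume) hRM
  replace key : -(∫ r in R..M, R / r * P1 (R / r) / r * Z r) - (∫ r in R..M, P (R / r) / r * w r)
      = -Z R := by
    rw [← key, ← intervalIntegral.integral_neg]
    exact (intervalIntegral.integral_sub i2.neg i3).symm
  have e1 : (∫ r in R..M, legA P P1 (R / r) / r * w r) =
      -(∫ r in R..M, R / r * P1 (R / r) / r * w r) - 3 / 2 * ∫ r in R..M, P (R / r) / r * w r := by
    rw [← intervalIntegral.integral_neg, ← intervalIntegral.integral_const_mul]
    refine Eq.trans ?_ (intervalIntegral.integral_sub i1.neg (i3.const_mul (3 / 2)))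
    refine intervalIntegral.integral_congr fun r _ => ?_
    simp only [legA]; ring
  have e2 : (∫ r in R..M, (R / r * P1 (R / r)) / r * (w r - 3 / 2 * Z r)) =
      (∫ r in R..M, R / r * P1 (R / r) / r * w r) - 3 / 2 * ∫ r in R..M, R / r * P1 (R / r) / r * Z r := by
    rw [← intervalIntegral.integral_const_mul,
      ← intervalIntegral.integral_sub i1 (i2.const_mul _)]
    exact intervalIntegral.integral_congr fun r _ => by ring
  rw [legT, e1, e2]
  show w R + _ = w R - 3 / 2 * Z R - _
  linarith

theorem legT_cont {P P1 P2 : ℝ → ℝ} (hP : IsLeg P P1 P2) {w : ℝ → ℝ} (hw : ContinuousOn w (Ioi 0))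
    {R M : ℝ} (hR : 0 < R) (hRM : R ≤ M) :
    ContinuousOn (legT P P1 w M) (Icc R M) :=
  (icc_cont hw hR).add (ker_param hw hR hRM hP.cont_legA)

theorem leg_inversion {P P1 P2 : ℝ → ℝ} (hP : IsLeg P P1 P2) {w : ℝ → ℝ} (hw : ContinuousOn w (Ioi 0))
    {R M : ℝ} (hR : 0 < R) (hRM : R ≤ M) :
    ∃ c, (∫ r in R..M, (w r - c * rho r) ^ 2) ≤
    26 * ∫ r in R..M, legT P P1 w M r ^ 2 := by
  have h0 : ∀ r ∈ Icc R M, 0 < r := fun r hr => hR.trans_le hr.1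
  have hM := hR.trans_le hRM
  have hwr : ContinuousOn (fun r => w r / r) (Ioi 0) :=
    hw.div continuousOn_id fun x hx => ne_of_gt hx
  have hZ := fun x (hx : 0 < x) => hasDerivAt_prim_left hwr hM hx
  set Z : ℝ → ℝ := fun y => ∫ x in y..M, w x / x with hZd
  have hZc : ContinuousOn Z (Ioi 0) := fun x hx => (hZ x hx).continuousAt.continuousWithinAt
  set g : ℝ → ℝ := fun r => w r - 3 / 2 * Z r with hg
  have hgc : ContinuousOn g (Ioi 0) := hw.sub (continuousOn_const.mul hZc)
  have hk1 : ContinuousOn (fun s => s * P1 s) (Ioc 0 1) := continuousOn_id.mul hP.cont_P1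
  set κ : ℝ → ℝ := fun η => ∫ r in η..M, (η / r * P1 (η / r)) / r * g r with hκ
  have hκc : ContinuousOn κ (Icc R M) := ker_param hgc hR hRM hk1
  have hT : ∀ η ∈ Icc R M, legT P P1 w M η = g η - κ η := fun η hη =>
    legT_eq hP hw (h0 η hη) hη.2
  have hTc := legT_cont hP hw hR hRM
  have hgabs : ContinuousOn (fun r => |g r|) (Ioi 0) := hgc.abs
  have hga2 : ContinuousOn (fun r => |g r| / r ^ 2) (Ioi 0) :=
    hgabs.div (by fun_prop) fun x hx => pow_ne_zero _ (ne_of_gt hx)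
  have hκb : ∀ η ∈ Icc R M, κ η ^ 2 ≤ 9 / 16 * (η * ∫ r in η..M, |g r| / r ^ 2) ^ 2 := by
    intro η hη
    have hη0 := h0 η hη
    have : |κ η| ≤ 3 / 4 * (η * ∫ r in η..M, |g r| / r ^ 2) := by
      rw [← intervalIntegral.integral_const_mul, ← intervalIntegral.integral_const_mul]
      refine (intervalIntegral.abs_integral_le_integral_abs hη.2).trans ?_
      refine intervalIntegral.integral_mono_on hη.2 ?_ ?_ fun r hr => ?_
      · exact ContinuousOn.intervalIntegrable_of_Icc hη.2 (ker_cont hgc hη0 hk1).abs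
      · refine ContinuousOn.intervalIntegrable_of_Icc hη.2 ?_
        exact continuousOn_const.mul (continuousOn_const.mul (icc_cont hga2 hη0))
      · have hr0 := hη0.trans_le hr.1
        have a := hP.nonneg (η / r) (div_pos hη0 hr0) ((div_le_one hr0).2 hr.1)
        have b := hP.le (η / r) (div_pos hη0 hr0) ((div_le_one hr0).2 hr.1)
        rw [abs_mul, abs_div, abs_mul, abs_of_pos hr0, abs_of_nonneg a,
          abs_of_pos (div_pos hη0 hr0)]
        calc η / r * P1 (η / r) / r * |g r| = P1 (η / r) * (η * (|g r| / r ^ 2)) := by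
              field_simp
          _ ≤ _ := mul_le_mul_of_nonneg_right b (by positivity)
    calc κ η ^ 2 = |κ η| ^ 2 := (sq_abs _).symm
      _ ≤ (3 / 4 * (η * ∫ r in η..M, |g r| / r ^ 2)) ^ 2 := by gcongr
      _ = _ := by ring
  have hκI : (∫ r in R..M, κ r ^ 2) ≤ 1 / 4 * ∫ r in R..M, g r ^ 2 := by
    have hh := hardy_upper_weighted hR hRM hgabs
    simp only [sq_abs] at hh
    have hc : ContinuousOn (fun η => η * ∫ r in η..M, |g r| / r ^ 2) (Icc R M) :=
      continuousOn_id.mul fun x hx =>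
        (hasDerivAt_prim_left hga2 hM (h0 x hx)).continuousAt.continuousWithinAt
    calc (∫ r in R..M, κ r ^ 2) ≤ ∫ η in R..M, 9 / 16 * (η * ∫ r in η..M, |g r| / r ^ 2) ^ 2 :=
          intervalIntegral.integral_mono_on hRM
            (ContinuousOn.intervalIntegrable_of_Icc hRM (hκc.pow 2))
            (ContinuousOn.intervalIntegrable_of_Icc hRM (continuousOn_const.mul (hc.pow 2))) hκb
      _ ≤ _ := by rw [intervalIntegral.integral_const_mul]; linarith
  have hgI : (∫ r in R..M, g r ^ 2) ≤ 4 * ∫ r in R..M, legT P P1 w M r ^ 2 := by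
    have := integral_sq_add_le hRM hTc hκc
    have e : (∫ r in R..M, (legT P P1 w M r + κ r) ^ 2) = ∫ r in R..M, g r ^ 2 :=
      intervalIntegral.integral_congr fun r hr => by
        rw [uIcc_of_le hRM] at hr
        simp only [hT r hr]; ring
    rw [e] at this
    linarith
  refine ⟨3 / 2 * (R * √R * Z R), ?_⟩
  have hl := hardy_lower hR hRM hgc
  have hsg : ContinuousOn (fun r => √r * g r) (Ioi 0) := by fun_prop
  have hprim : ∀ r ∈ Icc R M, (∫ x in R..r, √x * g x) = R * √R * Z R - r * √r * Z r := by
    intro r hr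
    have hr0 := h0 r hr
    have := intervalIntegral.integral_eq_sub_of_hasDerivAt (a := R) (b := r)
      (f := fun r => -(r * √r * Z r)) (f' := fun x => √x * g x) (fun x hx => by
        rw [uIcc_of_le hr.1] at hx
        have hx0 := hR.trans_le hx.1
        have hsx := Real.sqrt_pos.2 hx0
        have hq := Real.sq_sqrt hx0.le
        refine ((((hasDerivAt_id x).mul (Real.hasDerivAt_sqrt hx0.ne')).mul
          (hZ x hx0)).neg).congr_deriv ?_
        simp only [hg, id, Pi.mul_apply]
        set q := √x
        rw [← hq]
        field_simp
        ring) (icc_int hsg hR hr0)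
    rw [this]; ring
  have hF : ContinuousOn (fun x => -(3 / 2) * ((x * √x)⁻¹ * ∫ r in R..x, √r * g r)) (Icc R M) := by
    refine continuousOn_const.mul ((icc_cont rho_cont hR).mul fun x hx => ?_)
    exact (hasDerivAt_prim hsg hR (h0 x hx)).continuousAt.continuousWithinAt
  have := integral_sq_add_le hRM (icc_cont hgc hR) hF
  have e : (∫ r in R..M, (w r - 3 / 2 * (R * √R * Z R) * rho r) ^ 2) =
      ∫ x in R..M, (g x + -(3 / 2) * ((x * √x)⁻¹ * ∫ r in R..x, √r * g r)) ^ 2 :=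
    intervalIntegral.integral_congr fun r hr => by
      rw [uIcc_of_le hRM] at hr
      have hr0 := h0 r hr
      have hsx := Real.sqrt_pos.2 hr0
      simp only [hprim r hr]
      simp only [hg, rho]
      congr 1
      field_simp
      ring
  rw [e]
  have e2 : (∫ x in R..M, (-(3 / 2) * ((x * √x)⁻¹ * ∫ r in R..x, √r * g r)) ^ 2) =
      9 / 4 * ∫ x in R..M, ((x * √x)⁻¹ * ∫ r in R..x, √r * g r) ^ 2 := by
    rw [← intervalIntegral.integral_const_mul]
    exact intervalIntegral.integral_congr fun r _ => by ring
  rw [e2] at this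
  linarith

/-- Removing the `rho` component in the limit. -/
theorem exists_rho_limit {w : ℝ → ℝ} (hw : ContinuousOn w (Ioi 0)) {R : ℝ} (hR : 0 < R)
    (hw2 : IntegrableOn (fun r => w r ^ 2) (Ioi R)) {D : ℝ} {ε : ℝ → ℝ}
    (hε : Tendsto ε atTop (𝓝 0))
    (h : ∀ᶠ M in atTop, ∃ c, (∫ r in R..M, (w r - c * rho r) ^ 2) ≤ D + ε M) :
    ∃ c, IntegrableOn (fun r => (w r - c * rho r) ^ 2) (Ioi R) ∧
      (∫ r in Ioi R, (w r - c * rho r) ^ 2) ≤ D := by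
  obtain ⟨hρ, hρI⟩ := rho_sq_integral hR
  have hsub : Ioi R ⊆ Ioi (0:ℝ) := Ioi_subset_Ioi hR.le
  have hwm : AEStronglyMeasurable w (volume.restrict (Ioi R)) :=
    (hw.mono hsub).aestronglyMeasurable measurableSet_Ioi
  have hrm : AEStronglyMeasurable rho (volume.restrict (Ioi R)) :=
    (rho_cont.mono hsub).aestronglyMeasurable measurableSet_Ioi
  have hwρ : IntegrableOn (fun r => w r * rho r) (Ioi R) := by
    refine Integrable.mono' (hw2.add hρ) (hwm.mul hrm) (Eventually.of_forall fun r => ?_)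
    rw [Real.norm_eq_abs, abs_le]
    simp only [Pi.add_apply]
    constructor <;> nlinarith [sq_nonneg (w r + rho r), sq_nonneg (w r - rho r), sq_nonneg (w r), sq_nonneg (rho r)]
  set A := ∫ r in Ioi R, w r ^ 2
  set B := ∫ r in Ioi R, w r * rho r
  set C := ∫ r in Ioi R, rho r ^ 2 with hC
  have hC0 : 0 < C := by rw [hρI]; positivity
  have expand : ∀ c r, (w r - c * rho r) ^ 2 =
      w r ^ 2 - 2 * c * (w r * rho r) + c ^ 2 * rho r ^ 2 := fun c r => by ring
  have lim : A * C - B ^ 2 ≤ D * C := by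
    have tA := intervalIntegral_tendsto_integral_Ioi R hw2 tendsto_id
    have tB := intervalIntegral_tendsto_integral_Ioi R hwρ tendsto_id
    have tC := intervalIntegral_tendsto_integral_Ioi R hρ tendsto_id
    have t2 : Tendsto (fun M => (D + ε M) * ∫ r in R..M, rho r ^ 2) atTop (𝓝 ((D + 0) * C)) :=
      (hε.const_add D).mul tC
    rw [add_zero] at t2
    refine le_of_tendsto_of_tendsto ((tA.mul tC).sub (tB.pow 2)) t2 ?_
    filter_upwards [h, eventually_ge_atTop R] with M ⟨c, hc⟩ hM
    have i1 := (icc_cont hw hR (b := M)).pow 2 |>.intervalIntegrable_of_Icc (μ := volume) hM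
    have i2 := ((icc_cont hw hR (b := M)).mul (icc_cont rho_cont hR)).intervalIntegrable_of_Icc (μ := volume) hM
    have i3 := (icc_cont rho_cont hR (b := M)).pow 2 |>.intervalIntegrable_of_Icc (μ := volume) hM
    simp only [expand] at hc
    replace hc := (interval_quad i1 i2 i3 (2 * c) (c ^ 2)).symm.trans_le hc
    simp only [Pi.pow_apply, Pi.mul_apply] at hc
    have hc0 : 0 ≤ ∫ r in R..M, rho r ^ 2 :=
      intervalIntegral.integral_nonneg hM fun r _ => sq_nonneg _
    simp only [id]
    set a := ∫ r in R..M, w r ^ 2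
    set b := ∫ r in R..M, w r * rho r
    set d := ∫ r in R..M, rho r ^ 2
    have := mul_le_mul_of_nonneg_right hc hc0
    nlinarith [sq_nonneg (c * d - b)]
  refine ⟨B / C, ?_, ?_⟩
  · simp only [expand]
    exact (hw2.sub (hwρ.const_mul _)).add (hρ.const_mul _)
  · simp only [expand]
    rw [integral_quad hw2 hwρ hρ]
    show A - 2 * (B / C) * B + (B / C) ^ 2 * C ≤ D
    have : A - 2 * (B / C) * B + (B / C) ^ 2 * C = (A * C - B ^ 2) / C := by field_simp; ring
    rw [this, div_le_iff₀ hC0]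
    exact lim

/-- Integral of `|f|` along the outgoing characteristic from `(0, x)`. -/
def charInt (f : ℝ × ℝ → ℝ) (T x : ℝ) : ℝ := ∫ t in (0:ℝ)..T, |f (t, x + t)|

theorem charInt_cont {f : ℝ × ℝ → ℝ} (hf : ContinuousOn f {p | 0 < p.2}) {T : ℝ} (hT : 0 ≤ T) :
    ContinuousOn (charInt f T) (Ioi 0) := by
  intro x hx
  have hx0 : (0:ℝ) < x := hx
  have hc : Continuous (fun p : ℝ × ℝ => |f (|p.2|, max p.1 (x / 2) + |p.2|)|) := by
    refine Continuous.abs ?_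
    refine hf.comp_continuous (f := fun p : ℝ × ℝ => (|p.2|, max p.1 (x / 2) + |p.2|))
      (by fun_prop) fun p => ?_
    have := le_max_right p.1 (x / 2)
    have := abs_nonneg p.2
    show 0 < max p.1 (x / 2) + |p.2|
    linarith
  have h1 : Continuous fun y => ∫ t in (0:ℝ)..T, |f (|t|, max y (x / 2) + |t|)| :=
    intervalIntegral.continuous_parametric_intervalIntegral_of_continuous'
      (f := fun y t => |f (|t|, max y (x / 2) + |t|)|) hc 0 T
  refine (h1.continuousAt.congr ?_).continuousWithinAt
  filter_upwards [Ioi_mem_nhds (show x / 2 < x by linarith)] with y hy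
  refine intervalIntegral.integral_congr fun t ht => ?_
  rw [uIcc_of_le hT] at ht
  simp only [abs_of_nonneg ht.1, max_eq_left (le_of_lt (mem_Ioi.1 hy))]

theorem char_rect {f : ℝ × ℝ → ℝ} (hf : ContinuousOn f {p | 0 < p.2}) {T : ℝ}
    {R M : ℝ} (hR : 0 < R) :
    ContinuousOn (fun p : ℝ × ℝ => |f (p.1, p.2 + p.1)|) (Icc 0 T ×ˢ Icc R M) := by
  refine ContinuousOn.abs (hf.comp (by fun_prop) fun p hp => ?_)
  show 0 < p.2 + p.1
  linarith [hp.1.1, hp.2.1]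

theorem charInt_sq {f : ℝ × ℝ → ℝ} (hf : ContinuousOn f {p | 0 < p.2}) {T : ℝ} (hT : 0 ≤ T)
    {R M : ℝ} (hR : 0 < R) (hRM : R ≤ M) {B : ℝ → ℝ} (hB : Continuous B)
    (hB0 : ∀ t, 0 ≤ B t)
    (hfB : ∀ t ∈ Icc 0 T, ∀ b, R + t ≤ b → (∫ r in (R + t)..b, f (t, r) ^ 2) ≤ B t ^ 2) :
    (∫ x in R..M, charInt f T x ^ 2) ≤ (∫ t in (0:ℝ)..T, B t) ^ 2 := by
  refine minkowski_interval hT hRM (F := fun p => |f (p.1, p.2 + p.1)|) (char_rect hf hR) hB hB0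
    fun t ht => ?_
  simp only [sq_abs]
  rw [intervalIntegral.integral_comp_add_right (fun r => f (t, r) ^ 2)]
  exact hfB t ht _ (by linarith)

theorem double_int_abs {f : ℝ × ℝ → ℝ} (hf : ContinuousOn f {p | 0 < p.2}) {T : ℝ} (hT : 0 ≤ T)
    {R M : ℝ} (hR : 0 < R) (hRM : R + 2 * T ≤ M) {k : ℝ → ℝ}
    (hk : ContinuousOn k (Ioc 0 1)) {C : ℝ} (hC0 : 0 ≤ C)
    (hC : ∀ s, 0 < s → s ≤ 1 → |k s| ≤ C) :
    |∫ t in (0:ℝ)..T, ∫ r in (R + t)..(M - t), k ((t + R) / r) / r * f (t, r)| ≤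
      C * ∫ x in R..M, charInt f T x / x := by
  have hRM' : R ≤ M := by linarith
  have hpos : ∀ p ∈ trap R M T, 0 < p.2 := trap_pos hR
  have hs1 : ∀ p ∈ trap R M T, (p.1 + R) / p.2 ∈ Ioc (0:ℝ) 1 := fun p hp => by
    have h1 := hp.1.1
    have h2 := hp.2.1
    exact ⟨div_pos (by linarith) (hpos p hp), (div_le_one (hpos p hp)).2 (by linarith)⟩
  have kc : ContinuousOn (fun p : ℝ × ℝ => k ((p.1 + R) / p.2) / p.2 * f p) (trap R M T) := by
    refine ContinuousOn.mul (ContinuousOn.div ?_ continuousOn_snd fun p hp => (hpos p hp).ne')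
      (hf.mono hpos)
    exact hk.comp (ContinuousOn.div (by fun_prop) continuousOn_snd
      fun p hp => (hpos p hp).ne') hs1
  have hinn : ContinuousOn (fun t => ∫ r in (R + t)..(M - t), k ((t + R) / r) / r * f (t, r))
      (Icc 0 T) := continuousOn_param hT (by fun_prop) (by fun_prop)
        (fun t ht => by linarith [ht.2]) kc
  have hrc : ContinuousOn (fun p : ℝ × ℝ => |f (p.1, p.2 + p.1)| / p.2) (Icc 0 T ×ˢ Icc R M) :=
    (char_rect hf hR).div continuousOn_snd fun p hp => (hR.trans_le hp.2.1).ne'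
  have hrect := continuousOn_param hT (a := fun _ => R) (b := fun _ => M)
    (f := fun p : ℝ × ℝ => |f (p.1, p.2 + p.1)| / p.2) (by fun_prop)
    (by fun_prop) (fun _ _ => hRM') (hrc.mono fun p hp => ⟨hp.1, hp.2.1, hp.2.2⟩)
  calc _ ≤ ∫ t in (0:ℝ)..T, |∫ r in (R + t)..(M - t), k ((t + R) / r) / r * f (t, r)| :=
        intervalIntegral.abs_integral_le_integral_abs hT
    _ ≤ ∫ t in (0:ℝ)..T, C * ∫ x in R..M, |f (t, x + t)| / x := by
        refine intervalIntegral.integral_mono_on hT ?_ ?_ fun t ht => ?_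
        · exact hinn.abs.intervalIntegrable_of_Icc hT
        · exact (continuousOn_const.mul hrect).intervalIntegrable_of_Icc hT
        have hle : R + t ≤ M - t := by linarith [ht.2]
        have p0 : ∀ r ∈ Icc (R + t) (M - t), 0 < r := fun r hr => by linarith [ht.1, hr.1]
        have c1 : ContinuousOn (fun r => |k ((t + R) / r) / r * f (t, r)|) (Icc (R + t) (M - t)) :=
          (kc.comp (f := fun r => (t, r)) (by fun_prop) fun r hr => ⟨ht, hr.1, hr.2⟩).abs
        have c2 : ContinuousOn (fun r => C * (|f (t, r)| / (r - t))) (Icc (R + t) (M - t)) := by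
          refine continuousOn_const.mul (ContinuousOn.div ?_ (by fun_prop) fun r hr => ?_)
          · exact (hf.comp (f := fun r => (t, r)) (by fun_prop) fun r hr => p0 r hr).abs
          · have := hr.1
            have : 0 < r - t := by linarith
            exact this.ne'
        refine (intervalIntegral.abs_integral_le_integral_abs hle).trans ?_
        calc _ ≤ ∫ r in (R + t)..(M - t), C * (|f (t, r)| / (r - t)) := by
              refine intervalIntegral.integral_mono_on hle (c1.intervalIntegrable_of_Icc hle)
                (c2.intervalIntegrable_of_Icc hle) fun r hr => ?_
              have hr0 := p0 r hr
              have h1 := hs1 (t, r) ⟨ht, hr.1, hr.2⟩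
              have h2 := hC _ h1.1 h1.2
              have hrt : 0 < r - t := by linarith [hr.1]
              rw [abs_mul, abs_div, abs_of_pos hr0]
              calc |k ((t + R) / r)| / r * |f (t, r)| ≤ C / r * |f (t, r)| := by gcongr
                _ = C * (|f (t, r)| / r) := by ring
                _ ≤ C * (|f (t, r)| / (r - t)) := by
                  gcongr
                  linarith [ht.1]
          _ = ∫ x in R..(M - 2 * t), C * (|f (t, x + t)| / x) := by
              have := intervalIntegral.integral_comp_add_right (a := R) (b := M - 2 * t)
                (fun r => C * (|f (t, r)| / (r - t))) t
              simp only [add_sub_cancel_right] at this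
              rw [this]
              congr 1; ring
          _ ≤ C * ∫ x in R..M, |f (t, x + t)| / x := by
              rw [intervalIntegral.integral_const_mul]
              refine mul_le_mul_of_nonneg_left ?_ hC0
              refine intervalIntegral.integral_mono_interval le_rfl (by linarith)
                (by linarith [ht.1]) ?_ ?_
              · refine (ae_restrict_mem measurableSet_Ioc).mono fun x hx => ?_
                exact div_nonneg (abs_nonneg _) (hR.trans hx.1).le
              · refine ContinuousOn.intervalIntegrable_of_Icc hRM' ?_
                exact hrc.comp (f := fun x => (t, x)) (by fun_prop) fun x hx => ⟨ht, hx⟩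
    _ = C * ∫ x in R..M, charInt f T x / x := by
        rw [intervalIntegral.integral_const_mul,
          swap_interval hT hRM' (f := fun p => |f (p.1, p.2 + p.1)| / p.2) hrc]
        congr 1
        refine intervalIntegral.integral_congr fun x _ => ?_
        simp only [charInt, intervalIntegral.integral_div]

theorem sq_five {a b c d e : ℝ} :
    (a - b + c + d - e) ^ 2 ≤ 5 * (a ^ 2 + b ^ 2 + c ^ 2 + d ^ 2 + e ^ 2) := by
  nlinarith [sq_nonneg (a + b), sq_nonneg (a - c), sq_nonneg (a - d), sq_nonneg (a + e),
    sq_nonneg (b + c), sq_nonneg (b + d), sq_nonneg (b - e), sq_nonneg (c - d), sq_nonneg (c + e),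
    sq_nonneg (d + e)]

theorem legT_tail {P P1 P2 w : ℝ → ℝ} (hP : IsLeg P P1 P2) (hw : ContinuousOn w (Ioi 0))
    {R M : ℝ} (hR : 0 < R) (hRM : R ≤ M) :
    (∫ η in R..M, legT P P1 w M η ^ 2) ≤ 43 * ∫ r in R..M, w r ^ 2 := by
  have hM := hR.trans_le hRM
  have hwa : ContinuousOn (fun r => |w r|) (Ioi 0) := hw.abs
  have hwr : ContinuousOn (fun r => |w r| / r) (Ioi 0) :=
    hwa.div continuousOn_id fun x hx => ne_of_gt hx
  have hu := hardy_upper hR hRM hwa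
  simp only [sq_abs] at hu
  have hFc : ContinuousOn (fun x => ∫ r in x..M, |w r| / r) (Icc R M) := fun x hx =>
    (hasDerivAt_prim_left hwr hM (hR.trans_le hx.1)).continuousAt.continuousWithinAt
  have hwc := icc_cont hw hR (b := M)
  have i1 : IntervalIntegrable (fun r => 2 * w r ^ 2) volume R M :=
    (continuousOn_const.mul (hwc.pow 2)).intervalIntegrable_of_Icc hRM
  have i2 : IntervalIntegrable (fun x => 81 / 8 * (∫ r in x..M, |w r| / r) ^ 2) volume R M :=
    (continuousOn_const.mul (hFc.pow 2)).intervalIntegrable_of_Icc hRM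
  have := intervalIntegral.integral_mono_on hRM
    (((legT_cont hP hw hR hRM).pow 2).intervalIntegrable_of_Icc hRM) (i1.add i2) fun η hη => by
      have h1 := ker_abs hw (hR.trans_le hη.1) hη.2 hP.cont_legA
        (fun s hs hs1 => hP.legA_abs hs hs1)
      rw [← abs_of_nonneg (show 0 ≤ 9 / 4 * ∫ r in η..M, |w r| / r from ?_), ← sq_le_sq] at h1
      · have e : legT P P1 w M η ^ 2 ≤ 2 * w η ^ 2 +
            2 * (∫ r in η..M, legA P P1 (η / r) / r * w r) ^ 2 := by
          rw [legT]
          nlinarith [sq_nonneg (w η - ∫ r in η..M, legA P P1 (η / r) / r * w r)]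
        show legT P P1 w M η ^ 2 ≤ 2 * w η ^ 2 + 81 / 8 * (∫ r in η..M, |w r| / r) ^ 2
        nlinarith
      · refine mul_nonneg (by norm_num) (intervalIntegral.integral_nonneg hη.2 fun r hr => ?_)
        exact div_nonneg (abs_nonneg _) ((hR.trans_le hη.1).le.trans hr.1)
  rw [intervalIntegral.integral_add i1 i2, intervalIntegral.integral_const_mul,
    intervalIntegral.integral_const_mul] at this
  have h0 : 0 ≤ ∫ r in R..M, w r ^ 2 := intervalIntegral.integral_nonneg hRM fun r _ => sq_nonneg _
  simp only [Pi.pow_apply] at this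
  linarith

section

variable {V : ℝ → ℝ} {s v z U : ℝ × ℝ → ℝ}

theorem legT_main (h : Wave (-(3 / 2)) V s v z U)
    (hU0 : ∀ r, 0 < r → U (0, r) = 0) {P P1 P2 : ℝ → ℝ} (hP : IsLeg P P1 P2) {R M T E Fl : ℝ}
    (hR : 0 < R) (hT : 0 ≤ T) (hM : R + 2 * T ≤ M) {B : ℝ → ℝ} (hB : Continuous B)
    (hB0 : ∀ t, 0 ≤ B t)
    (hE : ∀ b, R + T ≤ b → (∫ r in (R + T)..b, (z (T, r) ^ 2 + U (T, r) ^ 2)) ≤ E)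
    (hfB : ∀ t ∈ Icc 0 T, ∀ b, R + t ≤ b →
      (∫ r in (R + t)..b, (s (t, r) - V r * v (t, r)) ^ 2) ≤ B t ^ 2)
    (hFl : (∫ t in (0:ℝ)..T, (z (t, M - t) - U (t, M - t)) ^ 2) ≤ Fl) :
    (∫ η in R..(M - 2 * T), legT P P1 (fun r => z (0, r)) M η ^ 2) ≤
      5 * (49 / 2 * E + 85 / 4 * (∫ t in (0:ℝ)..T, B t) ^ 2 +
        9 * T * Fl / (M - T) ^ 2 * (M - 2 * T - R)) := by
  have hRM : R ≤ M := by linarith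
  have hRM' : R ≤ M - 2 * T := by linarith
  have hM0 : 0 < M := by linarith
  have hMT : 0 < M - T := by linarith
  have hz := h.hz
  have hU := h.hY
  have hfc : ContinuousOn (fun p : ℝ × ℝ => s p - V p.2 * v p) {p | 0 < p.2} :=
    h.hs.sub (h.hV2.mul h.hv)
  set f : ℝ × ℝ → ℝ := fun p => s p - V p.2 * v p with hfdef
  have hw : ContinuousOn (fun r => z (0, r)) (Ioi 0) := hz.comp (by fun_prop) fun r hr => hr
  have hzT : ContinuousOn (fun r => z (T, r)) (Ioi 0) := hz.comp (by fun_prop) fun r hr => hr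
  have hUT : ContinuousOn (fun r => U (T, r)) (Ioi 0) := hU.comp (by fun_prop) fun r hr => hr
  have hKc := charInt_cont hfc hT
  have hKr : ContinuousOn (fun x => charInt f T x / x) (Ioi 0) :=
    hKc.div continuousOn_id fun x hx => ne_of_gt hx
  set F3 : ℝ → ℝ := fun r => 9 / 4 * |z (T, r)| + 3 / 4 * |U (T, r)| with hF3
  have hF3c : ContinuousOn F3 (Ioi 0) :=
    (continuousOn_const.mul hzT.abs).add (continuousOn_const.mul hUT.abs)
  have hF3r : ContinuousOn (fun x => F3 x / x) (Ioi 0) :=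
    hF3c.div continuousOn_id fun x hx => ne_of_gt hx
  set b1 : ℝ → ℝ := fun η => 2 * (z (T, η + T) ^ 2 + U (T, η + T) ^ 2)
  set b2 : ℝ → ℝ := fun η => charInt f T η ^ 2
  set b3 : ℝ → ℝ := fun η => (∫ r in (η + T)..(M - T), F3 r / r) ^ 2
  set b4 : ℝ → ℝ := fun _ => 9 * T * Fl / (M - T) ^ 2
  set b5 : ℝ → ℝ := fun η => 81 / 16 * (∫ r in η..M, charInt f T r / r) ^ 2
  have hsh : MapsTo (fun η : ℝ => η + T) (Icc R (M - 2 * T)) (Ioi 0) := fun η hη =>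
    show 0 < η + T by linarith [hη.1]
  have c1 : ContinuousOn b1 (Icc R (M - 2 * T)) :=
    continuousOn_const.mul (((hzT.comp (by fun_prop) hsh).pow 2).add
      ((hUT.comp (by fun_prop) hsh).pow 2))
  have c2 : ContinuousOn b2 (Icc R (M - 2 * T)) := (icc_cont hKc hR).pow 2
  have c3 : ContinuousOn b3 (Icc R (M - 2 * T)) := by
    have : ContinuousOn (fun x => ∫ r in x..(M - T), F3 r / r) (Ioi 0) := fun x hx =>
      (hasDerivAt_prim_left hF3r hMT hx).continuousAt.continuousWithinAt
    exact (this.comp (by fun_prop) hsh).pow 2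
  have c4 : ContinuousOn b4 (Icc R (M - 2 * T)) := continuousOn_const
  have c5 : ContinuousOn b5 (Icc R (M - 2 * T)) := by
    have : ContinuousOn (fun x => ∫ r in x..M, charInt f T r / r) (Ioi 0) := fun x hx =>
      (hasDerivAt_prim_left hKr hM0 hx).continuousAt.continuousWithinAt
    exact continuousOn_const.mul ((icc_cont this hR).pow 2)
  have i1 := c1.intervalIntegrable_of_Icc (μ := volume) hRM'
  have i2 := c2.intervalIntegrable_of_Icc (μ := volume) hRM'
  have i3 := c3.intervalIntegrable_of_Icc (μ := volume) hRM'
  have i4 := c4.intervalIntegrable_of_Icc (μ := volume) hRM'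
  have i5 := c5.intervalIntegrable_of_Icc (μ := volume) hRM'
  have hE2 : (∫ r in (R + T)..(M - T), (z (T, r) ^ 2 + U (T, r) ^ 2)) ≤ E := hE _ (by linarith)
  have j1 : (∫ η in R..(M - 2 * T), b1 η) ≤ 2 * E := by
    show (∫ η in R..(M - 2 * T), 2 * (z (T, η + T) ^ 2 + U (T, η + T) ^ 2)) ≤ 2 * E
    rw [intervalIntegral.integral_const_mul, intervalIntegral.integral_comp_add_right
      (fun r => z (T, r) ^ 2 + U (T, r) ^ 2), show M - 2 * T + T = M - T by ring]
    linarith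
  have hKI : (∫ x in R..M, charInt f T x ^ 2) ≤ (∫ t in (0:ℝ)..T, B t) ^ 2 :=
    charInt_sq hfc hT hR hRM hB hB0 hfB
  have j2 : (∫ η in R..(M - 2 * T), b2 η) ≤ (∫ t in (0:ℝ)..T, B t) ^ 2 :=
    (integral_mono_interval_sq le_rfl hRM' (by linarith) (icc_cont hKc hR)).trans hKI
  have j3 : (∫ η in R..(M - 2 * T), b3 η) ≤ 45 / 2 * E := by
    show (∫ η in R..(M - 2 * T), (∫ r in (η + T)..(M - T), F3 r / r) ^ 2) ≤ _
    rw [intervalIntegral.integral_comp_add_right (fun x => (∫ r in x..(M - T), F3 r / r) ^ 2),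
      show M - 2 * T + T = M - T by ring]
    have hle : R + T ≤ M - T := by linarith
    have hRT : 0 < R + T := by linarith
    refine (hardy_upper hRT hle hF3c).trans ?_
    have : (∫ x in (R + T)..(M - T), F3 x ^ 2) ≤
        ∫ x in (R + T)..(M - T), 45 / 8 * (z (T, x) ^ 2 + U (T, x) ^ 2) := by
      refine intervalIntegral.integral_mono_on hle ?_ ?_ fun x _ => ?_
      · exact ((icc_cont hF3c hRT).pow 2).intervalIntegrable_of_Icc hle
      · exact (continuousOn_const.mul (((icc_cont hzT hRT).pow 2).add
          ((icc_cont hUT hRT).pow 2))).intervalIntegrable_of_Icc hle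
      · rw [hF3, ← sq_abs (z (T, x)), ← sq_abs (U (T, x))]
        nlinarith [sq_nonneg (3 / 4 * |z (T, x)| - 9 / 4 * |U (T, x)|)]
    rw [intervalIntegral.integral_const_mul] at this
    linarith
  have j4 : (∫ η in R..(M - 2 * T), b4 η) = 9 * T * Fl / (M - T) ^ 2 * (M - 2 * T - R) := by
    simp only [b4, intervalIntegral.integral_const, smul_eq_mul]
    ring
  have j5 : (∫ η in R..(M - 2 * T), b5 η) ≤ 81 / 4 * (∫ t in (0:ℝ)..T, B t) ^ 2 := by
    show (∫ η in R..(M - 2 * T), 81 / 16 * (∫ r in η..M, charInt f T r / r) ^ 2) ≤ _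
    rw [intervalIntegral.integral_const_mul]
    have hu := hardy_upper hR hRM hKc
    have hm : (∫ η in R..(M - 2 * T), (∫ r in η..M, charInt f T r / r) ^ 2) ≤
        ∫ η in R..M, (∫ r in η..M, charInt f T r / r) ^ 2 :=
      integral_mono_interval_sq le_rfl hRM' (by linarith) fun x hx =>
        (hasDerivAt_prim_left hKr hM0 (hR.trans_le hx.1)).continuousAt.continuousWithinAt
    linarith
  have hpt : ∀ η ∈ Icc R (M - 2 * T), legT P P1 (fun r => z (0, r)) M η ^ 2 ≤
      5 * (b1 η + b2 η + b3 η + b4 η + b5 η) := by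
    intro η hη
    have hη0 := hR.trans_le hη.1
    have hηM : η + 2 * T ≤ M := by linarith [hη.2]
    rw [legT, h.representation hU0 hP hη0 hT hηM]
    refine sq_five.trans (mul_le_mul_of_nonneg_left ?_ (by norm_num))
    refine add_le_add (add_le_add (add_le_add (add_le_add ?_ ?_) ?_) ?_) ?_
    · show _ ≤ 2 * (z (T, η + T) ^ 2 + U (T, η + T) ^ 2)
      nlinarith [sq_nonneg (z (T, η + T) + U (T, η + T))]
    · have : |∫ t in (0:ℝ)..T, (s (t, η + t) - V (η + t) * v (t, η + t))| ≤ charInt f T η :=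
        intervalIntegral.abs_integral_le_integral_abs hT
      rw [← sq_abs]
      exact pow_le_pow_left₀ (abs_nonneg _) this 2
    · have hle : η + T ≤ M - T := by linarith
      have hηT : 0 < η + T := by linarith
      have hs : ∀ r ∈ Icc (η + T) (M - T), (T + η) / r ∈ Ioc (0:ℝ) 1 := fun r hr => by
        have : 0 < r := hηT.trans_le hr.1
        exact ⟨div_pos (by linarith) this, (div_le_one this).2 (by linarith [hr.1])⟩
      have k1 := ker_cont (M := M - T) hzT hηT hP.cont_legA
      have k2 := ker_cont (M := M - T) hUT hηT hP.cont_P1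
      rw [add_comm η T] at k1 k2
      have : |∫ r in (η + T)..(M - T), (legA P P1 ((T + η) / r) / r * z (T, r) +
          P1 ((T + η) / r) / r * U (T, r))| ≤ ∫ r in (η + T)..(M - T), F3 r / r := by
        refine (intervalIntegral.abs_integral_le_integral_abs hle).trans ?_
        refine intervalIntegral.integral_mono_on hle ?_ ?_ fun r hr => ?_
        · rw [add_comm η T] at hle ⊢
          exact ((k1.add k2).abs).intervalIntegrable_of_Icc hle
        · exact (icc_cont hF3r hηT).intervalIntegrable_of_Icc hle
        · have hr0 : 0 < r := hηT.trans_le hr.1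
          have a := hP.legA_abs (hs r hr).1 (hs r hr).2
          have b := hP.nonneg _ (hs r hr).1 (hs r hr).2
          have c := hP.le _ (hs r hr).1 (hs r hr).2
          refine (abs_add_le _ _).trans ?_
          rw [abs_mul, abs_mul, abs_div, abs_div, abs_of_pos hr0, abs_of_nonneg b, hF3]
          calc _ ≤ 9 / 4 / r * |z (T, r)| + 3 / 4 / r * |U (T, r)| := by gcongr
            _ = _ := by ring
      rw [← sq_abs]
      exact pow_le_pow_left₀ (abs_nonneg _) this 2
    · have hc : ContinuousOn (fun t => z (t, M - t) - U (t, M - t)) (Icc 0 T) := by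
        have hm : MapsTo (fun t : ℝ => (t, M - t)) (Icc 0 T) {p : ℝ × ℝ | 0 < p.2} := fun t ht =>
          show 0 < M - t by linarith [ht.2]
        exact (hz.comp (by fun_prop) hm).sub (hU.comp (by fun_prop) hm)
      have hs : ∀ t ∈ Icc 0 T, (t + η) / (M - t) ∈ Ioc (0:ℝ) 1 := fun t ht => by
        have : 0 < M - t := by linarith [ht.2]
        exact ⟨div_pos (by linarith [ht.1]) this, (div_le_one this).2 (by linarith [ht.2])⟩
      have hd : ContinuousOn (fun t : ℝ => (t + η) / (M - t)) (Icc 0 T) :=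
        ContinuousOn.div (by fun_prop) (by fun_prop) fun t ht => by
          have : 0 < M - t := by linarith [ht.2]
          exact this.ne'
      have hkc : ContinuousOn (fun t => legA P P1 ((t + η) / (M - t)) / (M - t) -
          P1 ((t + η) / (M - t)) / (M - t)) (Icc 0 T) := by
        have hne : ∀ t ∈ Icc 0 T, M - t ≠ 0 := fun t ht => by
          have : 0 < M - t := by linarith [ht.2]
          exact this.ne'
        exact ((hP.cont_legA.comp hd hs).div (by fun_prop) hne).sub
          ((hP.cont_P1.comp hd hs).div (by fun_prop) hne)
      have cs := cs_interval hT hkc hc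
      have hk2 : (∫ t in (0:ℝ)..T, (legA P P1 ((t + η) / (M - t)) / (M - t) -
          P1 ((t + η) / (M - t)) / (M - t)) ^ 2) ≤ 9 * T / (M - T) ^ 2 := by
        have : (∫ t in (0:ℝ)..T, (legA P P1 ((t + η) / (M - t)) / (M - t) -
          P1 ((t + η) / (M - t)) / (M - t)) ^ 2) ≤ ∫ t in (0:ℝ)..T, 9 / (M - T) ^ 2 := by
          refine intervalIntegral.integral_mono_on hT ?_ ?_ fun t ht => ?_
          · exact (hkc.pow 2).intervalIntegrable_of_Icc hT
          · exact continuousOn_const.intervalIntegrable_of_Icc hT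
          · have a := abs_le.1 (hP.legA_abs (hs t ht).1 (hs t ht).2)
            have b := hP.nonneg _ (hs t ht).1 (hs t ht).2
            have c := hP.le _ (hs t ht).1 (hs t ht).2
            rw [← sub_div, div_pow]
            refine div_le_div₀ (by norm_num) ?_ (by positivity) ?_
            · nlinarith
            · exact pow_le_pow_left₀ hMT.le (by linarith [ht.2]) 2
        refine this.trans (le_of_eq ?_)
        rw [intervalIntegral.integral_const, smul_eq_mul]
        ring
      refine cs.trans ((mul_le_mul hk2 hFl (intervalIntegral.integral_nonneg hT
        fun t _ => sq_nonneg _) (by positivity)).trans (le_of_eq ?_))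
      show _ = 9 * T * Fl / (M - T) ^ 2
      ring
    · have := double_int_abs hfc hT hη0 hηM hP.cont_legA (C := 9 / 4) (by norm_num)
        fun s a b => hP.legA_abs a b
      have h2 := pow_le_pow_left₀ (abs_nonneg _) this 2
      rw [sq_abs] at h2
      refine h2.trans (le_of_eq ?_)
      show _ = 81 / 16 * (∫ r in η..M, charInt f T r / r) ^ 2
      ring
  have hc := (legT_cont hP hw hR hRM).mono (Icc_subset_Icc le_rfl (by linarith : M - 2 * T ≤ M))
  have := intervalIntegral.integral_mono_on hRM' ((hc.pow 2).intervalIntegrable_of_Icc hRM')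
    (((((i1.add i2).add i3).add i4).add i5).const_mul 5) hpt
  refine this.trans ?_
  rw [intervalIntegral.integral_const_mul]
  have e : (∫ x in R..(M - 2 * T), (b1 x + b2 x + b3 x + b4 x + b5 x)) =
      (∫ x in R..(M - 2 * T), b1 x) + (∫ x in R..(M - 2 * T), b2 x) +
      (∫ x in R..(M - 2 * T), b3 x) + (∫ x in R..(M - 2 * T), b4 x) +
      (∫ x in R..(M - 2 * T), b5 x) := by
    rw [← intervalIntegral.integral_add i1 i2, ← intervalIntegral.integral_add (i1.add i2) i3,
      ← intervalIntegral.integral_add ((i1.add i2).add i3) i4]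
    exact intervalIntegral.integral_add (((i1.add i2).add i3).add i4) i5
  rw [e]
  linarith

/-- Exterior channel estimate with source for data with vanishing `U`. -/
theorem channel_with_source (h : Wave (-(3 / 2)) V s v z U)
    (hU0 : ∀ r, 0 < r → U (0, r) = 0) {R T E Fl : ℝ}
    (hR : 0 < R) (hT : 0 ≤ T) {B : ℝ → ℝ} (hB : Continuous B)
    (hB0 : ∀ t, 0 ≤ B t)
    (hE : ∀ b, R + T ≤ b → (∫ r in (R + T)..b, (z (T, r) ^ 2 + U (T, r) ^ 2)) ≤ E)
    (hfB : ∀ t ∈ Icc 0 T, ∀ b, R + t ≤ b →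
      (∫ r in (R + t)..b, (s (t, r) - V r * v (t, r)) ^ 2) ≤ B t ^ 2)
    (hFl : ∀ M, R + 2 * T ≤ M → (∫ t in (0:ℝ)..T, (z (t, M - t) - U (t, M - t)) ^ 2) ≤ Fl)
    (hw2 : IntegrableOn (fun r => z (0, r) ^ 2) (Ioi R)) :
    ∃ c, IntegrableOn (fun r => (z (0, r) - c * rho r) ^ 2) (Ioi R) ∧
      (∫ r in Ioi R, (z (0, r) - c * rho r) ^ 2) ≤ 3200 * (E + (∫ t in (0:ℝ)..T, B t) ^ 2) := by
  obtain ⟨P, P1, P2, hP⟩ := exists_isLeg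
  have hw : ContinuousOn (fun r => z (0, r)) (Ioi 0) := h.hz.comp (by fun_prop) fun r hr => hr
  have hE0 : 0 ≤ E := by simpa using hE (R + T) le_rfl
  refine exists_rho_limit hw hR hw2 (ε := fun M => 26 * (5 * (9 * T * Fl * ((M - 2 * T - R) /
    (M - T) ^ 2)) + 43 * ((∫ r in R..M, z (0, r) ^ 2) - ∫ r in R..(M - 2 * T), z (0, r) ^ 2))) ?_ ?_
  · have t1 := intervalIntegral_tendsto_integral_Ioi R hw2 tendsto_id
    have t2 := intervalIntegral_tendsto_integral_Ioi R hw2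
      (tendsto_atTop_add_const_right atTop (-(2 * T)) tendsto_id)
    have t3 := t1.sub t2
    have hin : Tendsto (fun M : ℝ => (M - T)⁻¹) atTop (𝓝 0) :=
      tendsto_inv_atTop_zero.comp (tendsto_atTop_add_const_right atTop (-T) tendsto_id)
    have t4 : Tendsto (fun M : ℝ => (M - 2 * T - R) / (M - T) ^ 2) atTop (𝓝 0) := by
      have := hin.sub ((hin.pow 2).const_mul (T + R))
      simp only [ne_eq, OfNat.ofNat_ne_zero, not_false_eq_true, zero_pow, mul_zero, sub_zero]
        at this
      refine this.congr' ?_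
      filter_upwards [eventually_gt_atTop T] with M hM
      have : M - T ≠ 0 := (sub_pos.2 hM).ne'
      field_simp
      ring
    have t5 := (((t4.const_mul (9 * T * Fl)).const_mul 5).add (t3.const_mul 43)).const_mul 26
    simpa [sub_eq_add_neg] using t5
  · filter_upwards [eventually_ge_atTop (R + 2 * T)] with M hM
    have hRM : R ≤ M := by linarith
    have hRM' : R ≤ M - 2 * T := by linarith
    obtain ⟨c, hc⟩ := leg_inversion hP hw hR hRM
    refine ⟨c, hc.trans ?_⟩
    have m1 := legT_main h hU0 hP hR hT hM hB hB0 hE hfB (hFl M hM)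
    have m2 := legT_tail hP hw (R := M - 2 * T) (M := M) (by linarith) (by linarith)
    have hlc := (legT_cont hP hw hR hRM).pow 2
    have a1 := intervalIntegral.integral_add_adjacent_intervals (a := R) (b := M - 2 * T) (c := M)
      (μ := volume) (f := fun η => legT P P1 (fun r => z (0, r)) M η ^ 2)
      ((hlc.mono (Icc_subset_Icc le_rfl (by linarith))).intervalIntegrable_of_Icc hRM')
      ((hlc.mono (Icc_subset_Icc hRM' le_rfl)).intervalIntegrable_of_Icc (by linarith))
    have hwc := (icc_cont hw hR (b := M)).pow 2
    have a2 := intervalIntegral.integral_add_adjacent_intervals (a := R) (b := M - 2 * T) (c := M)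
      (μ := volume) (f := fun η => z (0, η) ^ 2)
      ((hwc.mono (Icc_subset_Icc le_rfl (by linarith))).intervalIntegrable_of_Icc hRM')
      ((hwc.mono (Icc_subset_Icc hRM' le_rfl)).intervalIntegrable_of_Icc (by linarith))
    rw [← a1, ← a2, add_sub_cancel_left]
    have e : 9 * T * Fl / (M - T) ^ 2 * (M - 2 * T - R) =
      9 * T * Fl * ((M - 2 * T - R) / (M - T) ^ 2) := by ring
    rw [e] at m1
    have := sq_nonneg (∫ t in (0:ℝ)..T, B t)
    linarith

end

/-- Continuous functions on the half line that are square integrable beyond `R`. -/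
structure L2 (f : ℝ → ℝ) (R : ℝ) : Prop where
  c : ContinuousOn f (Ioi 0)
  i : IntegrableOn (fun r => f r ^ 2) (Ioi R)

/-- The `L²(R, ∞)` inner product. -/
def ip (f g : ℝ → ℝ) (R : ℝ) : ℝ := ∫ r in Ioi R, f r * g r

/-- The `L²(R, ∞)` norm. -/
def nr (f : ℝ → ℝ) (R : ℝ) : ℝ := √(ip f f R)

theorem nr_nonneg (f : ℝ → ℝ) (R : ℝ) : 0 ≤ nr f R := Real.sqrt_nonneg _

theorem ip_self (f : ℝ → ℝ) (R : ℝ) : ip f f R = ∫ r in Ioi R, f r ^ 2 := by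
  simp only [ip, pow_two]

theorem nr_sq (f : ℝ → ℝ) (R : ℝ) : nr f R ^ 2 = ∫ r in Ioi R, f r ^ 2 := by
  rw [nr, Real.sq_sqrt, ip_self]
  rw [ip_self]
  exact integral_nonneg fun r => sq_nonneg _

theorem ip_comm (f g : ℝ → ℝ) (R : ℝ) : ip f g R = ip g f R := by
  simp only [ip, mul_comm]

namespace L2

variable {f g : ℝ → ℝ} {R R' : ℝ}

theorem meas (hf : L2 f R) (hR : 0 ≤ R) : AEStronglyMeasurable f (volume.restrict (Ioi R)) :=
  (hf.c.mono (Ioi_subset_Ioi hR)).aestronglyMeasurable measurableSet_Ioi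

theorem mul_int (hf : L2 f R) (hg : L2 g R) (hR : 0 ≤ R) :
    IntegrableOn (fun r => f r * g r) (Ioi R) := by
  refine Integrable.mono' (hf.i.add hg.i) ((hf.meas hR).mul (hg.meas hR))
    (Eventually.of_forall fun r => ?_)
  rw [Real.norm_eq_abs, abs_le]
  simp only [Pi.add_apply]
  constructor <;> nlinarith [sq_nonneg (f r + g r), sq_nonneg (f r - g r), sq_nonneg (f r),
    sq_nonneg (g r)]

theorem comb (hf : L2 f R) (hg : L2 g R) (hR : 0 ≤ R) (a : ℝ) : L2 (fun r => f r + a * g r) R := by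
  refine ⟨hf.c.add (continuousOn_const.mul hg.c), ?_⟩
  have := (hf.i.add ((hf.mul_int hg hR).const_mul (2 * a))).add (hg.i.const_mul (a ^ 2))
  refine this.congr (Eventually.of_forall fun r => ?_)
  simp only [Pi.add_apply]
  ring

theorem sub (hf : L2 f R) (hg : L2 g R) (hR : 0 ≤ R) : L2 (fun r => f r - g r) R := by
  simpa [sub_eq_add_neg] using hf.comb hg hR (-1)

theorem mono (hf : L2 f R) (h : R ≤ R') : L2 f R' :=
  ⟨hf.c, hf.i.mono_set (Ioi_subset_Ioi h)⟩

theorem nr_mono (hf : L2 f R) (h : R ≤ R') : nr f R' ≤ nr f R := by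
  refine Real.sqrt_le_sqrt ?_
  rw [ip_self, ip_self]
  exact setIntegral_mono_set hf.i (Eventually.of_forall fun r => sq_nonneg _)
    (Ioi_subset_Ioi h).eventuallyLE

theorem ip_comb (hf : L2 f R) (hg : L2 g R) {k : ℝ → ℝ} (hk : L2 k R) (hR : 0 ≤ R) (a : ℝ) :
    ip (fun r => f r + a * g r) k R = ip f k R + a * ip g k R := by
  unfold ip
  rw [← integral_const_mul, ← integral_add (hf.mul_int hk hR) ((hg.mul_int hk hR).const_mul a)]
  congr 1; ext r; ring

theorem nr_comb_sq (hf : L2 f R) (hg : L2 g R) (hR : 0 ≤ R) (a : ℝ) :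
    nr (fun r => f r + a * g r) R ^ 2 = nr f R ^ 2 + 2 * a * ip f g R + a ^ 2 * nr g R ^ 2 := by
  have := hf.comb hg hR a
  rw [nr_sq, nr_sq, nr_sq, ← ip_self, ip_comb hf hg this hR, ip_comm f, ip_comm g,
    ip_comb hf hg hf hR, ip_comb hf hg hg hR, ip_self, ip_self, ip_comm g f]
  ring

theorem ip_le (hf : L2 f R) (hg : L2 g R) (hR : 0 ≤ R) : |ip f g R| ≤ nr f R * nr g R := by
  rw [← abs_of_nonneg (mul_nonneg (nr_nonneg f R) (nr_nonneg g R)), ← sq_le_sq]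
  have key : ∀ t : ℝ, 0 ≤ nr f R ^ 2 * (t * t) + (2 * ip f g R) * t + nr g R ^ 2 := by
    intro t
    have h1 := hg.nr_comb_sq hf hR t
    have h2 := sq_nonneg (nr (fun r => g r + t * f r) R)
    rw [ip_comm] at h1
    nlinarith
  have := discrim_le_zero key
  rw [discrim] at this
  nlinarith

theorem nr_comb_le (hf : L2 f R) (hg : L2 g R) (hR : 0 ≤ R) (a : ℝ) :
    nr (fun r => f r + a * g r) R ≤ nr f R + |a| * nr g R := by
  have h1 := hf.nr_comb_sq hg hR a
  have h2 := hf.ip_le hg hR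
  have n1 := nr_nonneg f R
  have n2 := nr_nonneg g R
  refine abs_le_of_sq_le_sq' ?_ (by positivity) |>.2
  rw [h1]
  have h3 : a * ip f g R ≤ |a| * (nr f R * nr g R) :=
    (le_abs_self _).trans (by rw [abs_mul]; gcongr)
  nlinarith [sq_abs a]

theorem nr_sub_le (hf : L2 f R) (hg : L2 g R) (hR : 0 ≤ R) :
    nr (fun r => f r - g r) R ≤ nr f R + nr g R := by
  simpa [sub_eq_add_neg] using hf.nr_comb_le hg hR (-1)

theorem interval_le (hf : L2 f R) {b : ℝ} (hb : R ≤ b) :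
    (∫ r in R..b, f r ^ 2) ≤ nr f R ^ 2 := by
  rw [nr_sq, intervalIntegral.integral_of_le hb]
  exact setIntegral_mono_set hf.i (Eventually.of_forall fun r => sq_nonneg _)
    Ioc_subset_Ioi_self.eventuallyLE

end L2

theorem nr_smul (f : ℝ → ℝ) (R a : ℝ) : nr (fun r => a * f r) R = |a| * nr f R := by
  have : nr (fun r => a * f r) R ^ 2 = (|a| * nr f R) ^ 2 := by
    rw [nr_sq, mul_pow, nr_sq, sq_abs, ← integral_const_mul]
    congr 1; ext r; ring
  exact (pow_left_inj₀ (nr_nonneg _ _) (mul_nonneg (abs_nonneg _) (nr_nonneg _ _)) two_ne_zero).1 this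

theorem rho_L2 {R : ℝ} (hR : 0 < R) : L2 rho R := ⟨rho_cont, (rho_sq_integral hR).1⟩

theorem rho_nr_sq {R : ℝ} (hR : 0 < R) : nr rho R ^ 2 = 1 / (2 * R ^ 2) := by
  rw [nr_sq, (rho_sq_integral hR).2]

section

variable {V : ℝ → ℝ} {s v z U : ℝ × ℝ → ℝ}

theorem Wave.energy_all {κ : ℝ} (h : Wave κ V s v z U)
    (hU0 : ∀ r, 0 < r → U (0, r) = 0) {R T : ℝ} (hR : 0 < R) (hT : 0 ≤ T) {ω θ : ℝ → ℝ}
    {Sg Ω : ℝ} (hω : Continuous ω) (hθ : Continuous θ) (hω0 : ∀ t, 0 ≤ ω t)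
    (hθ0 : ∀ t, 0 ≤ θ t) (hVω : ∀ t ∈ Icc 0 T, ∀ r, R + t ≤ r → |V r| ≤ ω t)
    (hsθ : ∀ t ∈ Icc 0 T, ∀ b, R + t ≤ b → (∫ r in (R + t)..b, s (t, r) ^ 2) ≤ (Sg * θ t) ^ 2)
    (hΩ : (∫ t in (0:ℝ)..T, t * ω t) ≤ Ω) (hθ1 : (∫ t in (0:ℝ)..T, θ t) ≤ 1)
    (hw : L2 (fun r => z (0, r)) R) :
    (∀ t ∈ Icc 0 T, ∀ b, R + t ≤ b → (∫ r in (R + t)..b, z (t, r) ^ 2) ≤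
      (nr (fun r => z (0, r)) R ^ 2 + Sg ^ 2) * exp (2 * Ω + 1)) ∧
    (∀ M, R + 2 * T ≤ M → (∫ t in (0:ℝ)..T, (z (t, M - t) - U (t, M - t)) ^ 2) ≤
      (nr (fun r => z (0, r)) R ^ 2 + Sg ^ 2) * exp (2 * Ω + 1)) := by
  have key : ∀ M, R + 2 * T ≤ M → _ := fun M hM =>
    h.energy_bound hR hT hM hω hθ hω0 hθ0 (S2 := Sg ^ 2) (sq_nonneg _) hVω
    (fun t ht => (hsθ t ht _ (by linarith [ht.2])).trans_eq (mul_pow _ _ _)) hΩ hθ1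
    (N := nr (fun r => z (0, r)) R ^ 2) (by
      have hRM : R ≤ M := by linarith
      refine le_trans (le_of_eq ?_) (hw.interval_le hRM)
      refine intervalIntegral.integral_congr fun r hr => ?_
      rw [uIcc_of_le hRM] at hr
      simp only [hU0 r (hR.trans_le hr.1)]
      ring)
  refine ⟨fun t ht b hb => ?_, fun M hM => (key M hM).2⟩
  have hRt : 0 < R + t := by linarith [ht.1]
  have hM : R + 2 * T ≤ max (R + 2 * T) (b + t) := le_max_left _ _
  have hb2 : b ≤ max (R + 2 * T) (b + t) - t := by linarith [le_max_right (R + 2 * T) (b + t)]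
  have h1 := (key _ hM).1 t ht
  have h2 := integral_mono_interval_sq (f := fun r => z (t, r)) le_rfl hb hb2
    (slice_cont h.hz t hRt)
  exact h2.trans ((integral_sq_le_add (hb.trans hb2) (slice_cont h.hz t hRt)
    (slice_cont h.hY t hRt)).trans h1)

theorem sq_sum_three {a b c : ℝ} (ha : 0 ≤ a) (hb : 0 ≤ b) (hc : 0 ≤ c) :
    a ^ 2 + b ^ 2 + c ^ 2 ≤ (a + b + c) ^ 2 := by
  nlinarith [mul_nonneg ha hb, mul_nonneg ha hc, mul_nonneg hb hc]

theorem channel_step (h : Wave (-(3 / 2)) V s v z U)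
    (hU0 : ∀ r, 0 < r → U (0, r) = 0) {R d T : ℝ} (hR : 0 < R) (hd : 0 ≤ d) (hT : 0 ≤ T)
    {ω θ : ℝ → ℝ} {Sg Ω S Δ : ℝ} (hω : Continuous ω) (hθ : Continuous θ) (hω0 : ∀ t, 0 ≤ ω t)
    (hθ0 : ∀ t, 0 ≤ θ t) (hSg : 0 ≤ Sg) (hΔ : 0 ≤ Δ)
    (hVω : ∀ t ∈ Icc 0 T, ∀ r, R + t ≤ r → |V r| ≤ ω t)
    (hsθ : ∀ t ∈ Icc 0 T, ∀ b, R + t ≤ b → (∫ r in (R + t)..b, s (t, r) ^ 2) ≤ (Sg * θ t) ^ 2)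
    (hΩ : (∫ t in (0:ℝ)..T, t * ω t) ≤ Ω) (hθ1 : (∫ t in (0:ℝ)..T, θ t) ≤ 1)
    (hS : (∫ t in (0:ℝ)..T, min t d * ω t) ≤ S)
    (hw : L2 (fun r => z (0, r)) R)
    (hE : ∀ b, R + T ≤ b → (∫ r in (R + T)..b, (z (T, r) ^ 2 + U (T, r) ^ 2)) ≤ Δ ^ 2) :
    ∃ c, nr (fun r => z (0, r) + c * rho r) R ≤ 114 * (1 + Ω) * exp (Ω + 1) *
      (Δ + Sg + nr (fun r => z (0, r)) (R + d) + S * (nr (fun r => z (0, r)) R + Sg)) := by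
  set w : ℝ → ℝ := fun r => z (0, r) with hwd
  obtain ⟨en1, fl⟩ := h.energy_all hU0 hR hT hω hθ hω0 hθ0 hVω hsθ hΩ hθ1 hw
  obtain ⟨en2, -⟩ := h.energy_all hU0 (R := R + d) (by linarith) hT hω hθ hω0 hθ0
    (fun t ht r hr => hVω t ht r (by linarith))
    (fun t ht b hb => (integral_mono_interval_sq (f := fun r => s (t, r)) (by linarith) hb le_rfl
      (slice_cont h.hs t (by linarith [ht.1]))).trans (hsθ t ht b (by linarith)))
    hΩ hθ1 (hw.mono (by linarith))
  set N' := nr w R with hN'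
  set N := nr w (R + d) with hN
  have hN0 : 0 ≤ N := nr_nonneg _ _
  have hN'0 : 0 ≤ N' := nr_nonneg _ _
  set K := exp (Ω + 1) with hK
  have hK0 : 0 < K := Real.exp_pos _
  have hKK : exp (2 * Ω + 1) ≤ K ^ 2 := by
    rw [hK, ← Real.exp_nat_mul]
    exact Real.exp_le_exp.2 (by push_cast; linarith)
  set A := K * (N + Sg)
  set A' := K * (N' + Sg)
  have hA0 : 0 ≤ A := by positivity
  have hA'0 : 0 ≤ A' := by positivity
  have bd : ∀ n, 0 ≤ n → (n ^ 2 + Sg ^ 2) * exp (2 * Ω + 1) ≤ (K * (n + Sg)) ^ 2 := fun n hn =>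
    calc _ ≤ (n ^ 2 + Sg ^ 2) * K ^ 2 := by gcongr
      _ ≤ (n + Sg) ^ 2 * K ^ 2 := by gcongr; nlinarith [mul_nonneg hn hSg]
      _ = _ := by ring
  set B : ℝ → ℝ := fun t => 2 * Sg * θ t + 2 * A * (|t| * ω t) + 2 * A' * (min |t| d * ω t) with hBd
  have hB : Continuous B := by fun_prop
  have hm0 : ∀ t : ℝ, 0 ≤ min |t| d := fun t => le_min (abs_nonneg _) hd
  have hB0 : ∀ t, 0 ≤ B t := fun t => by
    have := hω0 t
    have := hθ0 t
    have := hm0 t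
    positivity
  have inc : ∀ a b t₀ t C : ℝ, 0 < a → a ≤ b → 0 ≤ t₀ → t₀ ≤ t → 0 ≤ C →
      (∀ τ ∈ Icc t₀ t, (∫ r in a..b, z (τ, r) ^ 2) ≤ C ^ 2) →
      (∫ r in a..b, (v (t, r) - v (t₀, r)) ^ 2) ≤ ((t - t₀) * C) ^ 2 := by
    intro a b t₀ t C ha hab ht0 ht hC hz
    refine (h.increment_sq ha hab ht).trans ?_
    have hc : ContinuousOn (fun τ => ∫ r in a..b, z (τ, r) ^ 2) (Icc 0 t) :=
      continuousOn_param (f := fun p => z p ^ 2) (ht0.trans ht) (a := fun _ => a) (b := fun _ => b)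
        (by fun_prop) (by fun_prop)
        (fun _ _ => hab) ((h.hz.mono fun p hp => ha.trans_le hp.2.1).pow 2)
    have : (∫ τ in t₀..t, ∫ r in a..b, z (τ, r) ^ 2) ≤ ∫ τ in t₀..t, C ^ 2 :=
      intervalIntegral.integral_mono_on ht
        ((hc.mono (Icc_subset_Icc ht0 le_rfl)).intervalIntegrable_of_Icc ht)
        (continuousOn_const.intervalIntegrable_of_Icc ht) hz
    rw [intervalIntegral.integral_const, smul_eq_mul] at this
    calc _ ≤ (t - t₀) * ((t - t₀) * C ^ 2) := mul_le_mul_of_nonneg_left this (sub_nonneg.2 ht)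
      _ = _ := by ring
  have hvb : ∀ t ∈ Icc 0 T, ∀ b, R + t ≤ b → (∫ r in (R + t)..b, v (t, r) ^ 2) ≤
      2 * (t * A) ^ 2 + 2 * (min t d * A') ^ 2 := by
    intro t ht b hb
    have hRt : 0 < R + t := by linarith [ht.1]
    have htau0 : 0 ≤ min t d := le_min ht.1 hd
    have htau1 : min t d ≤ t := min_le_left _ _
    have c1 := slice_cont h.hv t hRt (b := b)
    have c2 := slice_cont h.hv (t - min t d) hRt (b := b)
    have s1 := integral_sq_add_le hb (f := fun r => v (t, r) - v (t - min t d, r)) (c1.sub c2) c2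
    simp only [sub_add_cancel] at s1
    have s2 := inc (R + t) b (t - min t d) t A' hRt hb (by linarith) (by linarith) hA'0
      (fun τ hτ => by
        have hτ' : τ ∈ Icc 0 T := ⟨by linarith [hτ.1], hτ.2.trans ht.2⟩
        exact ((integral_mono_interval_sq (f := fun r => z (τ, r)) (by linarith [hτ.2]) hb le_rfl
          (slice_cont h.hz τ (by linarith [hτ'.1]))).trans
          (en1 τ hτ' b (by linarith [hτ.2]))).trans (bd N' hN'0))
    rw [show t - (t - min t d) = min t d by ring] at s2
    have s3 : (∫ r in (R + t)..b, v (t - min t d, r) ^ 2) ≤ (t * A) ^ 2 := by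
      rcases le_total t d with htd | htd
      · rw [min_eq_left htd, sub_self]
        have : (∫ r in (R + t)..b, v (0, r) ^ 2) = 0 := by
          rw [intervalIntegral.integral_congr (g := fun _ => 0) fun r hr => ?_]
          · simp
          · rw [uIcc_of_le hb] at hr
            simp only [h.hv0 r (hRt.trans_le hr.1)]
            norm_num
        rw [this]
        positivity
      · rw [min_eq_right htd]
        have s4 := inc (R + t) b 0 (t - d) A hRt hb le_rfl (by linarith) hA0 (fun τ hτ => by
          have hτ' : τ ∈ Icc 0 T := ⟨hτ.1, by linarith [hτ.2, ht.2]⟩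
          exact ((integral_mono_interval_sq (f := fun r => z (τ, r)) (by linarith [hτ.2]) hb le_rfl
            (slice_cont h.hz τ (by linarith [hτ'.1]))).trans
            (en2 τ hτ' b (by linarith [hτ.2]))).trans (bd N hN0))
        have e : (∫ r in (R + t)..b, (v (t - d, r) - v (0, r)) ^ 2) =
            ∫ r in (R + t)..b, v (t - d, r) ^ 2 :=
          intervalIntegral.integral_congr fun r hr => by
            rw [uIcc_of_le hb] at hr
            simp only [h.hv0 r (hRt.trans_le hr.1), sub_zero]
        rw [e] at s4
        refine s4.trans ?_
        have : (t - d - 0) * A ≤ t * A := by gcongr; linarith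
        exact pow_le_pow_left₀ (mul_nonneg (by linarith) hA0) this 2
    linarith
  have hfB : ∀ t ∈ Icc 0 T, ∀ b, R + t ≤ b →
      (∫ r in (R + t)..b, (s (t, r) - V r * v (t, r)) ^ 2) ≤ B t ^ 2 := by
    intro t ht b hb
    have hRt : 0 < R + t := by linarith [ht.1]
    have cV : ContinuousOn V (Icc (R + t) b) := h.hV.mono fun x hx => hRt.trans_le hx.1
    have cv := slice_cont h.hv t hRt (b := b)
    have s1 := integral_sq_add_le hb (g := fun r => -(V r * v (t, r)))
      (slice_cont h.hs t hRt (b := b)) (cV.mul cv).neg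
    have s2 := integral_mul_sq_le hb cV cv fun x hx => hVω t ht x hx.1
    have s3 := mul_le_mul_of_nonneg_left (hvb t ht b hb) (sq_nonneg (ω t))
    have s4 := hsθ t ht b hb
    simp only [← sub_eq_add_neg, neg_sq] at s1
    have o0 := hω0 t
    have m0 : 0 ≤ min t d := le_min ht.1 hd
    have t0 := ht.1
    have th0 := hθ0 t
    have := sq_sum_three (a := 2 * Sg * θ t) (b := 2 * A * (t * ω t)) (c := 2 * A' * (min t d * ω t))
      (by positivity) (by positivity) (by positivity)
    rw [hBd]
    simp only [abs_of_nonneg ht.1]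
    refine le_trans ?_ this
    refine s1.trans ?_
    have s5 := sq_nonneg (Sg * θ t)
    nlinarith
  obtain ⟨c, -, hc⟩ := channel_with_source h hU0 hR hT hB hB0 hE hfB fl hw.i
  refine ⟨-c, ?_⟩
  have hΩ0 : 0 ≤ Ω := le_trans (intervalIntegral.integral_nonneg hT fun t ht =>
    mul_nonneg ht.1 (hω0 t)) hΩ
  have hS0 : 0 ≤ S := le_trans (intervalIntegral.integral_nonneg hT fun t ht =>
    mul_nonneg (le_min ht.1 hd) (hω0 t)) hS
  have hBI : (∫ t in (0:ℝ)..T, B t) ≤ 2 * Sg + 2 * A * Ω + 2 * A' * S := by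
    have e : (∫ t in (0:ℝ)..T, B t) = 2 * Sg * (∫ t in (0:ℝ)..T, θ t) +
        2 * A * (∫ t in (0:ℝ)..T, t * ω t) + 2 * A' * ∫ t in (0:ℝ)..T, min t d * ω t := by
      have i1 : IntervalIntegrable θ volume 0 T := hθ.intervalIntegrable _ _
      have i2 : IntervalIntegrable (fun t => t * ω t) volume 0 T :=
        (continuous_id.mul hω).intervalIntegrable _ _
      have i3 : IntervalIntegrable (fun t => min t d * ω t) volume 0 T :=
        ((continuous_id.min continuous_const).mul hω).intervalIntegrable _ _
      rw [← intervalIntegral.integral_const_mul, ← intervalIntegral.integral_const_mul,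
        ← intervalIntegral.integral_const_mul, ← intervalIntegral.integral_add (i1.const_mul _)
        (i2.const_mul _), ← intervalIntegral.integral_add ((i1.const_mul _).add (i2.const_mul _))
        (i3.const_mul _)]
      refine intervalIntegral.integral_congr fun t ht => ?_
      rw [uIcc_of_le hT] at ht
      simp only [hBd, abs_of_nonneg ht.1]
    rw [e]
    have a1 := mul_le_mul_of_nonneg_left hθ1 (show 0 ≤ 2 * Sg by positivity)
    have a2 := mul_le_mul_of_nonneg_left hΩ (show 0 ≤ 2 * A by positivity)
    have a3 := mul_le_mul_of_nonneg_left hS (show 0 ≤ 2 * A' by positivity)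
    linarith
  have hBI0 : 0 ≤ ∫ t in (0:ℝ)..T, B t := intervalIntegral.integral_nonneg hT fun t _ => hB0 t
  have hfin : nr (fun r => w r + -c * rho r) R ≤ 57 * (Δ + ∫ t in (0:ℝ)..T, B t) := by
    refine (abs_le_of_sq_le_sq' ?_ (by positivity)).2
    rw [nr_sq]
    simp only [neg_mul, ← sub_eq_add_neg]
    refine hc.trans ?_
    nlinarith [mul_nonneg hΔ hBI0, sq_nonneg Δ, sq_nonneg (∫ t in (0:ℝ)..T, B t)]
  have hK1 : 1 ≤ K := Real.one_le_exp (by linarith)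
  refine hfin.trans ?_
  have hKΩ : 1 ≤ (1 + Ω) * K := by nlinarith
  calc 57 * (Δ + ∫ t in (0:ℝ)..T, B t) ≤ 57 * (Δ + (2 * Sg + 2 * A * Ω + 2 * A' * S)) := by gcongr
    _ = 57 * Δ + 114 * Sg + 114 * Ω * K * (N + Sg) + 114 * K * (S * (N' + Sg)) := by
      simp only [A, A']; ring
    _ ≤ 114 * (1 + Ω) * K * (Δ + Sg + N + S * (N' + Sg)) := by
      have q := mul_nonneg hS0 (add_nonneg hN'0 hSg)
      have a1 : Δ ≤ (1 + Ω) * K * Δ := le_mul_of_one_le_left hΔ hKΩ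
      have a2 : Sg ≤ K * Sg := le_mul_of_one_le_left hSg hK1
      have a3 := mul_nonneg hK0.le hN0
      have a4 : 0 ≤ Ω * K * (S * (N' + Sg)) := by positivity
      nlinarith

end

/-- The bracket `(1 + (r/l)²/24)⁻¹`. -/
def bk (l r : ℝ) : ℝ := (1 + (r / l) ^ 2 / 24)⁻¹

/-- The radial profile of the potential at scale `l`. -/
def Vp (l r : ℝ) : ℝ := -(2 * (l ^ 2)⁻¹ * bk l r ^ 2)

/-- The conjugated radial profile of `ΛW` at scale `l`. -/
def phi (l r : ℝ) : ℝ := r ^ 2 * √r * ((l ^ 3)⁻¹ * (2 * (2 * bk l r - 1) * bk l r ^ 2))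

/-- The conjugated derivative of `phi`. -/
def psi (l r : ℝ) : ℝ := r * √r * ((l ^ 3)⁻¹ * (8 * (3 * bk l r - 2) * bk l r ^ 3))

theorem bk_pos (l r : ℝ) : 0 < bk l r := by unfold bk; positivity

theorem bk_le_one (l r : ℝ) : bk l r ≤ 1 :=
  inv_le_one_of_one_le₀ (by linarith [show 0 ≤ (r / l) ^ 2 / 24 by positivity])

theorem bk_rel {l : ℝ} (hl : 0 < l) (r : ℝ) : r ^ 2 * bk l r = 24 * l ^ 2 * (1 - bk l r) := by
  have h : 1 + (r / l) ^ 2 / 24 ≠ 0 := by positivity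
  unfold bk
  field_simp
  ring

theorem sq_mul_bk_le {l : ℝ} (hl : 0 < l) (r : ℝ) : r ^ 2 * bk l r ≤ 24 * l ^ 2 := by
  rw [bk_rel hl]
  nlinarith [mul_pos (pow_pos hl 2) (bk_pos l r)]

theorem bk_anti {l : ℝ} (hl : 0 < l) {a b : ℝ} (ha : 0 ≤ a) (hab : a ≤ b) : bk l b ≤ bk l a := by
  unfold bk
  gcongr

theorem bk_deriv {l : ℝ} (hl : 0 < l) (r : ℝ) :
    HasDerivAt (bk l) (-(r / (12 * l ^ 2) * bk l r ^ 2)) r := by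
  have h : 1 + (r / l) ^ 2 / 24 ≠ 0 := by positivity
  have h1 : HasDerivAt (fun x : ℝ => 1 + (x / l) ^ 2 / 24) (2 * (r / l) * (1 / l) / 24) r := by
    simpa using ((((hasDerivAt_id r).div_const l).pow 2).div_const 24).const_add 1
  refine (h1.inv h).congr_deriv ?_
  unfold bk
  field_simp
  ring

theorem bk_continuous (l : ℝ) : Continuous (bk l) := by
  unfold bk
  exact Continuous.inv₀ (by fun_prop) fun r => by positivity

theorem bk_tendsto {l : ℝ} (hl : 0 < l) : Tendsto (bk l) atTop (𝓝 0) := by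
  refine Tendsto.inv_tendsto_atTop ?_
  refine tendsto_atTop_add_const_left _ _ (Tendsto.atTop_div_const (by norm_num) ?_)
  exact (tendsto_pow_atTop two_ne_zero).comp (tendsto_id.atTop_div_const hl)

theorem Vp_continuous (l : ℝ) : Continuous (Vp l) := by
  have := bk_continuous l
  unfold Vp
  fun_prop

theorem phi_continuous (l : ℝ) : Continuous (phi l) := by
  have := bk_continuous l
  unfold phi
  fun_prop

theorem psi_continuous (l : ℝ) : Continuous (psi l) := by
  have := bk_continuous l
  unfold psi
  fun_prop

theorem phi_deriv {l r : ℝ} (hl : 0 < l) (hr : 0 < r) :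
    HasDerivAt (phi l) (psi l r - 3 / 2 * phi l r / r) r := by
  have hb := bk_deriv hl r
  have h1 : HasDerivAt (fun x : ℝ => x ^ 2 * √x) (2 * r * √r + r ^ 2 * (1 / (2 * √r))) r := by
    refine (((hasDerivAt_id r).pow 2).mul (Real.hasDerivAt_sqrt hr.ne')).congr_deriv ?_
    simp
  have h2 := h1.mul ((((hb.const_mul 2).sub_const 1).const_mul 2).mul (hb.pow 2)
    |>.const_mul (l ^ 3)⁻¹)
  refine (h2.congr_deriv ?_)
  have rel := bk_rel hl r
  have hs : 0 < √r := Real.sqrt_pos.2 hr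
  have hs2 : √r * √r = r := Real.mul_self_sqrt hr.le
  simp only [Pi.mul_apply, Pi.pow_apply, phi, psi]
  set b := bk l r
  have e1 : r ^ 2 * (1 / (2 * √r)) = r * √r / 2 := by
    field_simp
    linear_combination (-1) * hs2
  have e2 : r / (12 * l ^ 2) * b ^ 2 = 2 * (1 - b) * b / r := by
    field_simp
    linear_combination b * rel
  rw [e1, e2]
  field_simp
  ring

theorem psi_deriv {l r : ℝ} (hl : 0 < l) (hr : 0 < r) :
    HasDerivAt (psi l) (Vp l r * phi l r + 3 / 2 * psi l r / r) r := by
  have hb := bk_deriv hl r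
  have h1 : HasDerivAt (fun x : ℝ => x * √x) (√r + r * (1 / (2 * √r))) r := by
    refine ((hasDerivAt_id r).mul (Real.hasDerivAt_sqrt hr.ne')).congr_deriv ?_
    simp
  have h2 := h1.mul ((((hb.const_mul 3).sub_const 2).const_mul 8).mul (hb.pow 3)
    |>.const_mul (l ^ 3)⁻¹)
  refine (h2.congr_deriv ?_)
  have rel := bk_rel hl r
  have hs : 0 < √r := Real.sqrt_pos.2 hr
  have hs2 : √r * √r = r := Real.mul_self_sqrt hr.le
  simp only [Pi.mul_apply, Pi.pow_apply, phi, psi, Vp]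
  set b := bk l r
  have e1 : r * (1 / (2 * √r)) = √r / 2 := by
    field_simp
    linear_combination (-1) * hs2
  rw [e1]
  push_cast
  field_simp
  ring

/-- The bracket decays: `∫ r bk^(n+2) = 12 l² bk^(n+1) / (n+1)`. -/
theorem bk_integral {l : ℝ} (hl : 0 < l) (n : ℕ) {a b : ℝ} :
    (∫ r in a..b, r * bk l r ^ (n + 2)) =
      12 * l ^ 2 / (n + 1) * (bk l a ^ (n + 1) - bk l b ^ (n + 1)) := by
  have hd : ∀ r ∈ uIcc a b, HasDerivAt (fun r => -(12 * l ^ 2 / (n + 1)) * bk l r ^ (n + 1))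
      (r * bk l r ^ (n + 2)) r := fun r _ => by
    refine (((bk_deriv hl r).pow (n + 1)).const_mul (-(12 * l ^ 2 / (n + 1)))).congr_deriv ?_
    have : (n:ℝ) + 1 ≠ 0 := by positivity
    simp only [Nat.add_sub_cancel]
    push_cast
    field_simp
    ring
  rw [intervalIntegral.integral_eq_sub_of_hasDerivAt hd]
  · ring
  · exact (continuous_id.mul ((bk_continuous l).pow _)).intervalIntegrable _ _

theorem bk_integral_le {l : ℝ} (hl : 0 < l) (n : ℕ) {a b : ℝ} :
    (∫ r in a..b, r * bk l r ^ (n + 2)) ≤ 12 * l ^ 2 / (n + 1) * bk l a ^ (n + 1) := by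
  rw [bk_integral hl]
  have : 0 ≤ bk l b ^ (n + 1) := (pow_pos (bk_pos l b) _).le
  gcongr
  linarith

theorem phi_sq_le {l : ℝ} (hl : 0 < l) {r : ℝ} (hr : 0 ≤ r) :
    phi l r ^ 2 ≤ 2304 * (l ^ 2)⁻¹ * (r * bk l r ^ 2) := by
  have rel := bk_rel hl r
  have b0 := bk_pos l r
  have b1 := bk_le_one l r
  unfold phi
  set b := bk l r
  have e : (r ^ 2 * √r * ((l ^ 3)⁻¹ * (2 * (2 * b - 1) * b ^ 2))) ^ 2 =
      2304 * (l ^ 2)⁻¹ * (r * b ^ 2) * ((1 - b) * (2 * b - 1)) ^ 2 := by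
    have e1 : (r ^ 2 * √r * ((l ^ 3)⁻¹ * (2 * (2 * b - 1) * b ^ 2))) ^ 2 =
      (r ^ 2 * b) ^ 2 * (√r) ^ 2 * ((l ^ 3)⁻¹) ^ 2 * 4 * (2 * b - 1) ^ 2 * b ^ 2 := by ring
    rw [e1, rel, Real.sq_sqrt hr]
    field_simp
    ring
  rw [e]
  refine mul_le_of_le_one_right (by positivity) ?_
  rw [sq_le_one_iff_abs_le_one, abs_mul, abs_of_nonneg (sub_nonneg.2 b1)]
  have : |2 * b - 1| ≤ 1 := abs_le.2 ⟨by linarith, by linarith⟩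
  nlinarith [abs_nonneg (2 * b - 1)]

theorem psi_sq_le {l : ℝ} (hl : 0 < l) {r : ℝ} (hr : 0 ≤ r) :
    psi l r ^ 2 ≤ 6144 * (l ^ 4)⁻¹ * (r * bk l r ^ 3) := by
  have rel := sq_mul_bk_le hl r
  have b0 := bk_pos l r
  have b1 := bk_le_one l r
  unfold psi
  set b := bk l r
  have e1 : (r * √r * ((l ^ 3)⁻¹ * (8 * (3 * b - 2) * b ^ 3))) ^ 2 =
      (r ^ 2 * b) * r * ((l ^ 3)⁻¹) ^ 2 * 64 * (3 * b - 2) ^ 2 * b ^ 5 := by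
    rw [show (r * √r * ((l ^ 3)⁻¹ * (8 * (3 * b - 2) * b ^ 3))) ^ 2 =
      (r ^ 2 * b) * (√r) ^ 2 * ((l ^ 3)⁻¹) ^ 2 * 64 * (3 * b - 2) ^ 2 * b ^ 5 by ring,
      Real.sq_sqrt hr]
  have h2 : (3 * b - 2) ^ 2 ≤ 4 := by nlinarith
  have h3 : b ^ 5 ≤ b ^ 3 := pow_le_pow_of_le_one b0.le b1 (by norm_num)
  rw [e1]
  calc _ ≤ (24 * l ^ 2) * r * ((l ^ 3)⁻¹) ^ 2 * 64 * 4 * b ^ 3 := by gcongr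
    _ = _ := by field_simp; ring

theorem phi_int_le {l : ℝ} (hl : 0 < l) {a b : ℝ} (ha : 0 ≤ a) (hab : a ≤ b) :
    (∫ r in a..b, phi l r ^ 2) ≤ 27648 * bk l a := by
  have h1 : (∫ r in a..b, phi l r ^ 2) ≤ ∫ r in a..b, 2304 * (l ^ 2)⁻¹ * (r * bk l r ^ 2) :=
    intervalIntegral.integral_mono_on hab (((phi_continuous l).pow 2).intervalIntegrable _ _)
      ((continuous_const.mul (continuous_id.mul ((bk_continuous l).pow _))).intervalIntegrable _ _)
      fun r hr => phi_sq_le hl (ha.trans hr.1)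
  rw [intervalIntegral.integral_const_mul] at h1
  refine h1.trans ?_
  have := mul_le_mul_of_nonneg_left (bk_integral_le hl 0 (a := a) (b := b))
    (show 0 ≤ 2304 * (l ^ 2)⁻¹ by positivity)
  refine this.trans_eq ?_
  field_simp
  norm_num
  
theorem psi_int_le {l : ℝ} (hl : 0 < l) {a b : ℝ} (ha : 0 ≤ a) (hab : a ≤ b) :
    a ^ 2 * (∫ r in a..b, psi l r ^ 2) ≤ 884736 * bk l a := by
  have h1 : (∫ r in a..b, psi l r ^ 2) ≤ ∫ r in a..b, 6144 * (l ^ 4)⁻¹ * (r * bk l r ^ 3) :=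
    intervalIntegral.integral_mono_on hab (((psi_continuous l).pow 2).intervalIntegrable _ _)
      ((continuous_const.mul (continuous_id.mul ((bk_continuous l).pow _))).intervalIntegrable _ _)
      fun r hr => psi_sq_le hl (ha.trans hr.1)
  rw [intervalIntegral.integral_const_mul] at h1
  have h2 := h1.trans (mul_le_mul_of_nonneg_left (bk_integral_le hl 1 (a := a) (b := b))
    (show 0 ≤ 6144 * (l ^ 4)⁻¹ by positivity))
  have h3 := sq_mul_bk_le hl a
  have b0 := bk_pos l a
  calc a ^ 2 * (∫ r in a..b, psi l r ^ 2) ≤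
        a ^ 2 * (6144 * (l ^ 4)⁻¹ * (12 * l ^ 2 / ((1:ℕ) + 1) * bk l a ^ (1 + 1))) := by gcongr
    _ = (a ^ 2 * bk l a) * (36864 * (l ^ 2)⁻¹ * bk l a) := by push_cast; field_simp; ring
    _ ≤ (24 * l ^ 2) * (36864 * (l ^ 2)⁻¹ * bk l a) := by gcongr
    _ = _ := by field_simp; ring

theorem int_bk_le {l : ℝ} (hl : 0 < l) {T : ℝ} (hT : 0 ≤ T) : (∫ t in (0:ℝ)..T, bk l t) ≤ 8 * l := by
  have h5 : (√24) ^ 2 = (24:ℝ) := Real.sq_sqrt (by norm_num)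
  have h50 : 0 < √(24:ℝ) := by positivity
  have hd : ∀ r ∈ uIcc 0 T, HasDerivAt (fun r => l * √24 * Real.arctan (r / (l * √24)))
      (bk l r) r := fun r _ => by
    refine (((hasDerivAt_id r).div_const (l * √24)).arctan.const_mul (l * √24)).congr_deriv ?_
    simp only [id, bk]
    have : 1 + (r / (l * √24)) ^ 2 = 1 + (r / l) ^ 2 / 24 := by
      rw [div_pow, div_pow, mul_pow, h5]
      field_simp
    rw [this]
    field_simp
  rw [intervalIntegral.integral_eq_sub_of_hasDerivAt hd ((bk_continuous l).intervalIntegrable _ _)]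
  have ha := Real.arctan_lt_pi_div_two (T / (l * √24))
  have hpi := Real.pi_lt_d2
  have h24 : √24 ≤ (5:ℝ) := Real.sqrt_le_iff.2 ⟨by norm_num, by norm_num⟩
  have ha0 : 0 ≤ Real.arctan (T / (l * √24)) := Real.arctan_nonneg.2 (by positivity)
  simp only [zero_div, Real.arctan_zero, mul_zero, sub_zero]
  calc l * √24 * Real.arctan (T / (l * √24)) ≤ l * 5 * 1.575 := by gcongr; linarith
    _ ≤ 8 * l := by linarith

theorem abs_Vp (l r : ℝ) : |Vp l r| = 2 * (l ^ 2)⁻¹ * bk l r ^ 2 := by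
  rw [Vp, abs_neg, abs_of_nonneg]
  have := bk_pos l r
  positivity

/-- The integrals of the potential along the light cone. -/
theorem omega_int {l R d T : ℝ} (hl : 0 < l) (hR : 0 < R) (hd : 0 ≤ d) (hT : 0 ≤ T) :
    (∫ t in (0:ℝ)..T, t * (2 * (l ^ 2)⁻¹ * bk l (R + |t|) ^ 2)) ≤ 24 * bk l R ∧
    (∫ t in (0:ℝ)..T, min t d * (2 * (l ^ 2)⁻¹ * bk l (R + |t|) ^ 2)) ≤ 16 * d / l ∧
    (∫ t in (0:ℝ)..T, min t d * (2 * (l ^ 2)⁻¹ * bk l (R + |t|) ^ 2)) ≤ 48 * d / R ∧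
    (∫ t in (0:ℝ)..T, min t d * (2 * (l ^ 2)⁻¹ * bk l (R + |t|) ^ 2)) ≤ 24 * bk l R := by
  have hbc := bk_continuous l
  have c1 : Continuous fun t : ℝ => 2 * (l ^ 2)⁻¹ * bk l (R + |t|) ^ 2 := by fun_prop
  have o0 : ∀ t : ℝ, 0 ≤ 2 * (l ^ 2)⁻¹ * bk l (R + |t|) ^ 2 := fun t => by
    have := bk_pos l (R + |t|)
    positivity
  have h1 : (∫ t in (0:ℝ)..T, t * (2 * (l ^ 2)⁻¹ * bk l (R + |t|) ^ 2)) ≤ 24 * bk l R := by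
    calc (∫ t in (0:ℝ)..T, t * (2 * (l ^ 2)⁻¹ * bk l (R + |t|) ^ 2)) ≤
          ∫ t in (0:ℝ)..T, 2 * (l ^ 2)⁻¹ * ((t + R) * bk l (t + R) ^ 2) := by
          refine intervalIntegral.integral_mono_on hT
            ((continuous_id.mul c1).intervalIntegrable _ _)
            (Continuous.intervalIntegrable (by fun_prop) _ _) fun t ht => ?_
          rw [abs_of_nonneg ht.1, add_comm R t]
          have := bk_pos l (t + R)
          rw [mul_left_comm]
          gcongr
          linarith
      _ = 2 * (l ^ 2)⁻¹ * ∫ r in (0 + R)..(T + R), r * bk l r ^ 2 := by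
          rw [intervalIntegral.integral_const_mul,
            intervalIntegral.integral_comp_add_right (fun r => r * bk l r ^ 2)]
      _ ≤ 2 * (l ^ 2)⁻¹ * (12 * l ^ 2 / ((0:ℕ) + 1) * bk l (0 + R) ^ (0 + 1)) := by
          gcongr
          exact bk_integral_le hl 0
      _ = 24 * bk l R := by
          simp only [zero_add, pow_one, Nat.cast_zero, div_one]
          field_simp
          ring
  have mono : ∀ f : ℝ → ℝ, Continuous f → (∀ t ∈ Icc 0 T, min t d ≤ f t) →
      (∫ t in (0:ℝ)..T, min t d * (2 * (l ^ 2)⁻¹ * bk l (R + |t|) ^ 2)) ≤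
      ∫ t in (0:ℝ)..T, f t * (2 * (l ^ 2)⁻¹ * bk l (R + |t|) ^ 2) := fun f hf hfd =>
    intervalIntegral.integral_mono_on hT
      (((continuous_id.min continuous_const).mul c1).intervalIntegrable _ _)
      ((hf.mul c1).intervalIntegrable _ _) fun t ht =>
        mul_le_mul_of_nonneg_right (hfd t ht) (o0 t)
  have hdc := mono (fun _ => d) continuous_const fun t _ => min_le_right _ _
  refine ⟨h1, ?_, ?_, (mono (fun t => t) continuous_id fun t _ => min_le_left _ _).trans h1⟩
  · refine hdc.trans ?_
    rw [intervalIntegral.integral_const_mul]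
    have : (∫ t in (0:ℝ)..T, 2 * (l ^ 2)⁻¹ * bk l (R + |t|) ^ 2) ≤
        ∫ t in (0:ℝ)..T, 2 * (l ^ 2)⁻¹ * bk l t :=
      intervalIntegral.integral_mono_on hT (c1.intervalIntegrable _ _)
        ((continuous_const.mul hbc).intervalIntegrable _ _) fun t ht => by
          have e1 := bk_anti hl ht.1 (show t ≤ R + |t| by rw [abs_of_nonneg ht.1]; linarith)
          have e2 := bk_le_one l (R + |t|)
          have e3 := bk_pos l (R + |t|)
          gcongr
          nlinarith
    rw [intervalIntegral.integral_const_mul (2 * (l ^ 2)⁻¹) (bk l)] at this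
    have h3 := int_bk_le hl hT
    calc _ ≤ d * (2 * (l ^ 2)⁻¹ * (8 * l)) := by gcongr; exact this.trans (by gcongr)
      _ = _ := by field_simp; ring
  · refine hdc.trans ?_
    rw [intervalIntegral.integral_const_mul]
    have hdv : ∀ t ∈ uIcc 0 T, HasDerivAt (fun t => -(48 * (t + R)⁻¹)) (48 * ((t + R) ^ 2)⁻¹) t := by
      intro t ht
      rw [uIcc_of_le hT] at ht
      have : t + R ≠ 0 := by linarith [ht.1]
      refine ((((hasDerivAt_id t).add_const R).inv this).const_mul 48).neg.congr_deriv ?_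
      simp only [id]
      field_simp
    have hci : ContinuousOn (fun t : ℝ => 48 * ((t + R) ^ 2)⁻¹) (Icc 0 T) :=
      ContinuousOn.mul continuousOn_const (ContinuousOn.inv₀ (by fun_prop) fun t ht => by
        have : 0 < t + R := by linarith [ht.1]
        positivity)
    have hii := hci.intervalIntegrable_of_Icc (μ := volume) hT
    have : (∫ t in (0:ℝ)..T, 2 * (l ^ 2)⁻¹ * bk l (R + |t|) ^ 2) ≤
        ∫ t in (0:ℝ)..T, 48 * ((t + R) ^ 2)⁻¹ :=
      intervalIntegral.integral_mono_on hT (c1.intervalIntegrable _ _) hii fun t ht => by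
          rw [abs_of_nonneg ht.1, add_comm R t]
          have hp : 0 < t + R := by linarith [ht.1]
          have e1 := sq_mul_bk_le hl (t + R)
          have e2 := bk_le_one l (t + R)
          have e3 := bk_pos l (t + R)
          rw [← div_eq_mul_inv 48, le_div_iff₀ (by positivity)]
          calc 2 * (l ^ 2)⁻¹ * bk l (t + R) ^ 2 * (t + R) ^ 2 =
              2 * (l ^ 2)⁻¹ * (((t + R) ^ 2 * bk l (t + R)) * bk l (t + R)) := by ring
            _ ≤ 2 * (l ^ 2)⁻¹ * (24 * l ^ 2 * 1) := by gcongr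
            _ = 48 := by field_simp; ring
    rw [intervalIntegral.integral_eq_sub_of_hasDerivAt hdv hii] at this
    have h4 : 0 ≤ 48 * (T + R)⁻¹ := by positivity
    simp only [zero_add] at this
    calc _ ≤ d * (48 * R⁻¹) := by gcongr; linarith
      _ = _ := by ring

/-- Interaction of the profile at scale `m` with the potential at a different scale `l`. -/
theorem interaction {l m g : ℝ} (hl : 0 < l) (hm : 0 < m) (hg : l ≤ g * m ∨ m ≤ g * l) {t a b : ℝ}
    (ht : 0 ≤ t) (hta : t ≤ a) (hab : a ≤ b) :
    (∫ r in a..b, (t * (Vp l r * phi m r)) ^ 2) ≤ (2000 * g * (l⁻¹ * bk l t)) ^ 2 := by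
  have bc := bk_continuous l
  have b0 := bk_pos l t
  have b1 := bk_le_one l t
  have hci : IntervalIntegrable (fun r => (t * (Vp l r * phi m r)) ^ 2) volume a b := by
    have := Vp_continuous l
    have := phi_continuous m
    exact Continuous.intervalIntegrable (by fun_prop) _ _
  have hVsq : ∀ r, Vp l r ^ 2 = 4 * (l ^ 4)⁻¹ * bk l r ^ 4 := fun r => by
    rw [Vp]
    field_simp
    ring
  rcases hg with hg | hg
  · have h1 : (∫ r in a..b, (t * (Vp l r * phi m r)) ^ 2) ≤
        ∫ r in a..b, t ^ 2 * (4 * (l ^ 4)⁻¹ * (2304 * (m ^ 2)⁻¹)) * (r * bk l r ^ 4) := by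
      refine intervalIntegral.integral_mono_on hab hci
        (Continuous.intervalIntegrable (by fun_prop) _ _) fun r hr => ?_
      have hr0 : 0 ≤ r := ht.trans (hta.trans hr.1)
      have p1 := phi_sq_le hm hr0
      have p2 : bk m r ^ 2 ≤ 1 := pow_le_one₀ (bk_pos m r).le (bk_le_one m r)
      have p3 := bk_pos l r
      rw [mul_pow, mul_pow, hVsq]
      calc _ ≤ t ^ 2 * (4 * (l ^ 4)⁻¹ * bk l r ^ 4 * (2304 * (m ^ 2)⁻¹ * (r * 1))) := by
            gcongr
            exact p1.trans (by gcongr)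
        _ = _ := by ring
    rw [intervalIntegral.integral_const_mul] at h1
    refine h1.trans ?_
    have h2 := bk_integral_le hl 2 (a := a) (b := b)
    have h3 : bk l a ^ 3 ≤ bk l t ^ 3 := by
      have := bk_anti hl ht hta
      have := bk_pos l a
      gcongr
    have h4 := sq_mul_bk_le hl t
    have h5 : (m ^ 2)⁻¹ ≤ g ^ 2 * (l ^ 2)⁻¹ := by
      rw [← div_eq_mul_inv, le_div_iff₀ (by positivity), inv_mul_le_iff₀ (by positivity)]
      calc l ^ 2 ≤ (g * m) ^ 2 := by gcongr
        _ = _ := by ring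
    calc _ ≤ t ^ 2 * (4 * (l ^ 4)⁻¹ * (2304 * (m ^ 2)⁻¹)) *
          (12 * l ^ 2 / ((2:ℕ) + 1) * bk l t ^ 3) := by
          gcongr
          exact h2.trans (by gcongr)
      _ = (t ^ 2 * bk l t) * (36864 * (l ^ 2)⁻¹ * bk l t ^ 2) * (m ^ 2)⁻¹ := by
          push_cast; field_simp; ring
      _ ≤ (24 * l ^ 2) * (36864 * (l ^ 2)⁻¹ * bk l t ^ 2) * (g ^ 2 * (l ^ 2)⁻¹) := by gcongr
      _ = 884736 * (g ^ 2 * (l⁻¹ * bk l t) ^ 2) := by field_simp; ring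
      _ ≤ _ := by
          have : 0 ≤ g ^ 2 * (l⁻¹ * bk l t) ^ 2 := by positivity
          nlinarith
  · have h1 : (∫ r in a..b, (t * (Vp l r * phi m r)) ^ 2) ≤
        ∫ r in a..b, t ^ 2 * (4 * (l ^ 4)⁻¹ * bk l t ^ 4) * phi m r ^ 2 := by
      refine intervalIntegral.integral_mono_on hab hci
        ((continuous_const.mul ((phi_continuous m).pow 2)).intervalIntegrable _ _) fun r hr => ?_
      rw [mul_pow, mul_pow, hVsq, ← mul_assoc]
      have := bk_anti hl ht (hta.trans hr.1)
      have := bk_pos l r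
      gcongr
    rw [intervalIntegral.integral_const_mul] at h1
    refine h1.trans ?_
    have h2 := phi_int_le hm (ht.trans hta) hab
    have h3 := bk_anti hm ht hta
    have h4 := sq_mul_bk_le hm t
    have h5 : bk l t ^ 4 ≤ bk l t ^ 2 := pow_le_pow_of_le_one b0.le b1 (by norm_num)
    calc _ ≤ t ^ 2 * (4 * (l ^ 4)⁻¹ * bk l t ^ 2) * (27648 * bk m t) := by
          exact mul_le_mul (by gcongr) (h2.trans (by gcongr))
            (intervalIntegral.integral_nonneg hab fun r _ => sq_nonneg _) (by positivity)
      _ = (t ^ 2 * bk m t) * (110592 * (l ^ 4)⁻¹ * bk l t ^ 2) := by ring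
      _ ≤ (24 * m ^ 2) * (110592 * (l ^ 4)⁻¹ * bk l t ^ 2) := by gcongr
      _ ≤ (24 * (g * l) ^ 2) * (110592 * (l ^ 4)⁻¹ * bk l t ^ 2) := by gcongr
      _ = 2654208 * (g ^ 2 * (l⁻¹ * bk l t) ^ 2) := by field_simp; ring
      _ ≤ _ := by
          have : 0 ≤ g ^ 2 * (l⁻¹ * bk l t) ^ 2 := by positivity
          nlinarith

section

variable {κ : ℝ} {V : ℝ → ℝ} {v z U : ℝ × ℝ → ℝ}

/-- Subtracting a solution linear in time, at the price of a source. -/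
theorem Wave.sub_linear (h : Wave (-(3 / 2)) V (fun _ => 0) v z U) {Φ Ψ F : ℝ → ℝ}
    (hΦ : ∀ r, 0 < r → HasDerivAt Φ (Ψ r - 3 / 2 * Φ r / r) r)
    (hΨ : ∀ r, 0 < r → HasDerivAt Ψ (F r + 3 / 2 * Ψ r / r) r) (hF : ContinuousOn F (Ioi 0)) :
    Wave (-(3 / 2)) V (fun p => p.1 * (F p.2 - V p.2 * Φ p.2)) (fun p => v p - p.1 * Φ p.2)
      (fun p => z p - Φ p.2) (fun p => U p - p.1 * Ψ p.2) := by
  have cΦ : ContinuousOn Φ (Ioi 0) := fun r hr => (hΦ r hr).continuousAt.continuousWithinAt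
  have hm : MapsTo (Prod.snd : ℝ × ℝ → ℝ) {p : ℝ × ℝ | 0 < p.2} (Ioi 0) := fun p hp => hp
  have cΦ2 := cΦ.comp continuousOn_snd hm
  have cF2 := hF.comp continuousOn_snd hm
  have cV2 := h.hV.comp continuousOn_snd hm
  refine ⟨h.hV, continuousOn_fst.mul (cF2.sub (cV2.mul cΦ2)), h.hv.sub (continuousOn_fst.mul cΦ2),
    fun r hr => by simp [h.hv0 r hr], fun t r hr => ?_, fun t r hr => ?_⟩
  · refine ((h.hvt t r hr).sub ((hasDerivAt_id t).mul_const (Φ r))).congr_deriv ?_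
    simp
  · obtain ⟨A, B, hA, hB, e1, e2⟩ := h.hD t r hr
    have d1 : HasFDerivAt (fun p : ℝ × ℝ => Φ p.2) _ (t, r) :=
      (hΦ r hr).comp_hasFDerivAt (t, r) (hasFDerivAt_snd (𝕜 := ℝ) (E := ℝ) (F := ℝ))
    have d2 : HasFDerivAt (fun p : ℝ × ℝ => Ψ p.2) _ (t, r) :=
      (hΨ r hr).comp_hasFDerivAt (t, r) (hasFDerivAt_snd (𝕜 := ℝ) (E := ℝ) (F := ℝ))
    refine ⟨_, _, hA.sub d1, hB.sub ((hasFDerivAt_fst (𝕜 := ℝ) (E := ℝ) (F := ℝ)).mul d2), ?_, ?_⟩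
    · simp only [sub_apply, add_apply,
        smul_apply, ContinuousLinearMap.coe_fst',
        ContinuousLinearMap.coe_snd', smul_eq_mul]
      rw [e1]
      field_simp
      ring
    · simp only [sub_apply, add_apply,
        smul_apply, ContinuousLinearMap.coe_fst',
        ContinuousLinearMap.coe_snd', smul_eq_mul]
      rw [e2]
      field_simp
      ring

end

/-- The radial multisoliton potential. -/
def VJ {J : ℕ} (lam : Fin J → ℝ) (r : ℝ) : ℝ := ∑ k, Vp (lam k) r

/-- Linear combinations of the profiles. -/
def PhiJ {J : ℕ} (lam c : Fin J → ℝ) (r : ℝ) : ℝ := ∑ j, c j * phi (lam j) r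

/-- Linear combinations of the conjugated derivatives. -/
def PsiJ {J : ℕ} (lam c : Fin J → ℝ) (r : ℝ) : ℝ := ∑ j, c j * psi (lam j) r

/-- The interaction terms of a linear combination of profiles with the potential. -/
def crossTerm {J : ℕ} (lam c : Fin J → ℝ) (p : Fin J × Fin J) (t r : ℝ) : ℝ :=
  if p.2 = p.1 then 0 else c p.1 * (t * (Vp (lam p.2) r * phi (lam p.1) r))

section

variable {J : ℕ} {lam c : Fin J → ℝ}

theorem cross_sum (t r : ℝ) :
    t * ((∑ j, c j * (Vp (lam j) r * phi (lam j) r)) - VJ lam r * PhiJ lam c r) =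
      -∑ p, crossTerm lam c p t r := by
  rw [Fintype.sum_prod_type, VJ, PhiJ, mul_sub, Finset.sum_mul_sum, Finset.sum_comm,
    Finset.mul_sum, Finset.mul_sum, ← Finset.sum_sub_distrib, ← Finset.sum_neg_distrib]
  refine Finset.sum_congr rfl fun j _ => ?_
  have : ∀ k, crossTerm lam c (j, k) t r = t * (Vp (lam k) r * (c j * phi (lam j) r)) -
      if k = j then t * (c j * (Vp (lam j) r * phi (lam j) r)) else 0 := fun k => by
    by_cases hk : k = j
    · simp only [crossTerm, hk, if_true]; ring
    · simp only [crossTerm, hk, if_false]; ring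
  simp only [this]
  rw [Finset.sum_sub_distrib, Finset.sum_ite_eq' Finset.univ j, if_pos (Finset.mem_univ _),
    ← Finset.mul_sum]
  ring

theorem VJ_continuous : Continuous (VJ lam) :=
  continuous_finsetSum _ fun _ _ => Vp_continuous _

theorem PhiJ_continuous : Continuous (PhiJ lam c) :=
  continuous_finsetSum _ fun _ _ => (phi_continuous _).const_mul _

theorem PsiJ_continuous : Continuous (PsiJ lam c) :=
  continuous_finsetSum _ fun _ _ => (psi_continuous _).const_mul _

theorem crossTerm_continuous (p : Fin J × Fin J) (t : ℝ) : Continuous (crossTerm lam c p t) := by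
  have := Vp_continuous (lam p.2)
  have := phi_continuous (lam p.1)
  unfold crossTerm
  split_ifs <;> fun_prop

theorem Wave.sub_PhiJ {v z U : ℝ × ℝ → ℝ} (h : Wave (-(3 / 2)) (VJ lam) (fun _ => 0) v z U)
    (hl : ∀ j, 0 < lam j) (c : Fin J → ℝ) :
    Wave (-(3 / 2)) (VJ lam) (fun p => -∑ q, crossTerm lam c q p.1 p.2)
      (fun p => v p - p.1 * PhiJ lam c p.2) (fun p => z p - PhiJ lam c p.2)
      (fun p => U p - p.1 * PsiJ lam c p.2) := by
  simp only [← cross_sum]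
  refine h.sub_linear (F := fun r => ∑ j, c j * (Vp (lam j) r * phi (lam j) r))
    (fun r hr => ?_) (fun r hr => ?_) ?_
  · refine (HasDerivAt.fun_sum fun j _ => ((phi_deriv (hl j) hr).const_mul (c j))).congr_deriv ?_
    simp only [PhiJ, PsiJ, Finset.mul_sum, Finset.sum_div, ← Finset.sum_sub_distrib]
    exact Finset.sum_congr rfl fun j _ => by ring
  · refine (HasDerivAt.fun_sum fun j _ => ((psi_deriv (hl j) hr).const_mul (c j))).congr_deriv ?_
    simp only [PsiJ, Finset.mul_sum, Finset.sum_div, ← Finset.sum_add_distrib]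
    exact Finset.sum_congr rfl fun j _ => by ring
  · exact (continuous_finsetSum _ fun k _ =>
      ((Vp_continuous _).mul (phi_continuous _)).const_mul _).continuousOn

/-- Bound of the source created by subtracting profiles. -/
theorem cross_int_le (hl : ∀ j, 0 < lam j) {g : ℝ}
    (hr : ∀ i j, i < j → lam j ≤ g * lam i)
    {A : ℝ} (hc : ∀ j, |c j| ≤ A) {t a b : ℝ} (ht : 0 ≤ t) (hta : t ≤ a) (hab : a ≤ b) :
    (∫ r in a..b, (-∑ p, crossTerm lam c p t r) ^ 2) ≤
      (2000 * J ^ 2 * (A * g) * ∑ k, (lam k)⁻¹ * bk (lam k) t) ^ 2 := by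
  have hci : ∀ p : Fin J × Fin J, IntervalIntegrable (fun r => crossTerm lam c p t r ^ 2)
    volume a b := fun p => ((crossTerm_continuous p t).pow 2).intervalIntegrable _ _
  have h1 : (∫ r in a..b, (-∑ p, crossTerm lam c p t r) ^ 2) ≤
      ∫ r in a..b, (J:ℝ) ^ 2 * ∑ p, crossTerm lam c p t r ^ 2 := by
    refine intervalIntegral.integral_mono_on hab ?_ ?_ fun r _ => ?_
    · exact (((continuous_finsetSum _ fun p _ => crossTerm_continuous p t).neg).pow 2
        |>.intervalIntegrable _ _)
    · exact (((continuous_finsetSum _ fun p _ => (crossTerm_continuous p t).pow 2).const_mul _)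
        |>.intervalIntegrable _ _)
    · rw [neg_sq]
      refine sq_sum_le_card_mul_sum_sq.trans_eq ?_
      simp [pow_two]
  rw [intervalIntegral.integral_const_mul, intervalIntegral.integral_finsetSum fun p _ => hci p]
    at h1
  set θ : Fin J → ℝ := fun k => (lam k)⁻¹ * bk (lam k) t with hθ
  have hθ0 : ∀ k, 0 ≤ θ k := fun k => by
    have := bk_pos (lam k) t
    have := hl k
    simp only [hθ]; positivity
  have h2 : ∀ p : Fin J × Fin J, (∫ r in a..b, crossTerm lam c p t r ^ 2) ≤
      (2000 * (A * g) * θ p.2) ^ 2 := fun p => by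
    rcases eq_or_ne p.2 p.1 with hp | hp
    · simp only [crossTerm, hp, if_true]
      norm_num
      positivity
    · simp only [crossTerm, hp, if_false]
      have hor : lam p.2 ≤ g * lam p.1 ∨ lam p.1 ≤ g * lam p.2 := by
        rcases lt_or_gt_of_ne hp with h | h
        · exact Or.inr (hr _ _ h)
        · exact Or.inl (hr _ _ h)
      have h3 := interaction (hl p.2) (hl p.1) hor ht hta hab
      simp only [mul_pow (c p.1)]
      rw [intervalIntegral.integral_const_mul]
      have h4 : c p.1 ^ 2 ≤ A ^ 2 := sq_le_sq' (by linarith [(abs_le.1 (hc p.1)).1])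
        (abs_le.1 (hc p.1)).2
      calc _ ≤ A ^ 2 * (2000 * g * ((lam p.2)⁻¹ * bk (lam p.2) t)) ^ 2 :=
            mul_le_mul h4 h3 (intervalIntegral.integral_nonneg hab fun r _ => sq_nonneg _)
              (sq_nonneg _)
        _ = _ := by simp only [hθ]; ring
  have hJ : ((J:ℝ)) ^ 3 ≤ (J:ℝ) ^ 4 := by
    rcases Nat.eq_zero_or_pos J with h | h
    · simp [h]
    · exact pow_le_pow_right₀ (by exact_mod_cast h) (by norm_num)
  have hsum : ∑ k, θ k ^ 2 ≤ (∑ k, θ k) ^ 2 := by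
    rw [pow_two, Finset.sum_mul]
    refine Finset.sum_le_sum fun k _ => ?_
    rw [pow_two]
    exact mul_le_mul_of_nonneg_left
      (Finset.single_le_sum (fun i _ => hθ0 i) (Finset.mem_univ k)) (hθ0 k)
  calc _ ≤ (J:ℝ) ^ 2 * ∑ p : Fin J × Fin J, (2000 * (A * g) * θ p.2) ^ 2 := by
        refine h1.trans ?_
        gcongr with p
        exact h2 p
    _ = (2000 * (A * g)) ^ 2 * ((J:ℝ) ^ 3 * ∑ k, θ k ^ 2) := by
        rw [Fintype.sum_prod_type]
        simp only [mul_pow (2000 * (A * g)), ← Finset.mul_sum, Finset.sum_const, Finset.card_univ,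
          Fintype.card_fin, nsmul_eq_mul]
        ring
    _ ≤ (2000 * (A * g)) ^ 2 * ((J:ℝ) ^ 4 * (∑ k, θ k) ^ 2) := by
        have := Finset.sum_nonneg (s := Finset.univ) fun k _ => sq_nonneg (θ k)
        gcongr
    _ = _ := by ring

end

theorem phi_L2 {l : ℝ} (hl : 0 < l) {R : ℝ} (hR : 0 ≤ R) : L2 (phi l) R := by
  refine ⟨(phi_continuous l).continuousOn, ?_⟩
  refine integrableOn_Ioi_of_intervalIntegral_norm_bounded (27648 * bk l R) R
    (fun b => ((phi_continuous l).pow 2).integrableOn_Ioc) tendsto_id ?_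
  filter_upwards [eventually_ge_atTop R] with b hb
  refine le_of_eq_of_le ?_ (phi_int_le hl hR hb)
  exact intervalIntegral.integral_congr fun r _ => by simp

theorem phi_nr_sq {l : ℝ} (hl : 0 < l) {R : ℝ} (hR : 0 ≤ R) :
    nr (phi l) R ^ 2 ≤ 27648 * bk l R := by
  rw [nr_sq]
  refine le_of_tendsto (intervalIntegral_tendsto_integral_Ioi R (phi_L2 hl hR).i tendsto_id) ?_
  filter_upwards [eventually_ge_atTop R] with b hb
  exact phi_int_le hl hR hb

theorem phi_nr_le {l : ℝ} (hl : 0 < l) {R : ℝ} (hR : 0 ≤ R) : nr (phi l) R ≤ 200 := by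
  refine abs_le_of_sq_le_sq' ((phi_nr_sq hl hR).trans ?_) (by norm_num) |>.2
  nlinarith [bk_le_one l R]

theorem phi_nr_le_div {l : ℝ} (hl : 0 < l) {R : ℝ} (hR : 0 < R) :
    nr (phi l) R ≤ 1000 * (l / R) := by
  refine abs_le_of_sq_le_sq' ((phi_nr_sq hl hR.le).trans ?_) (by positivity) |>.2
  have h := sq_mul_bk_le hl R
  rw [mul_pow, div_pow, mul_div_assoc', le_div_iff₀ (by positivity)]
  nlinarith [sq_nonneg l]

theorem PhiJ_L2 {J : ℕ} {lam : Fin J → ℝ} (hl : ∀ j, 0 < lam j) (c : Fin J → ℝ) {R : ℝ}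
    (hR : 0 ≤ R) : L2 (PhiJ lam c) R ∧ ∀ A, (∀ j, |c j| ≤ A) → nr (PhiJ lam c) R ≤ 200 * J * A := by
  suffices ∀ s : Finset (Fin J), L2 (fun r => ∑ j ∈ s, c j * phi (lam j) r) R ∧
      ∀ A, (∀ j, |c j| ≤ A) → nr (fun r => ∑ j ∈ s, c j * phi (lam j) r) R ≤ 200 * s.card * A by
    have := this Finset.univ
    rw [Finset.card_univ, Fintype.card_fin] at this
    exact this
  intro s
  induction s using Finset.induction_on with
  | empty =>
    refine ⟨⟨by simpa using continuousOn_const, by simp⟩, fun A _ => ?_⟩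
    have : nr (fun _ => (0:ℝ)) R = 0 := by simp [nr, ip]
    simp [this]
  | insert a s ha ih =>
    simp only [Finset.sum_insert ha]
    have e : (fun r => c a * phi (lam a) r + ∑ j ∈ s, c j * phi (lam j) r) =
        fun r => (∑ j ∈ s, c j * phi (lam j) r) + c a * phi (lam a) r := by ext r; ring
    rw [e]
    have hp := phi_L2 (hl a) hR
    refine ⟨ih.1.comb hp hR _, fun A hA => (ih.1.nr_comb_le hp hR _).trans ?_⟩
    have h1 := ih.2 A hA
    have h2 := mul_le_mul (hA a) (phi_nr_le (hl a) hR) (nr_nonneg _ _) ((abs_nonneg _).trans (hA a))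
    rw [Finset.card_insert_of_notMem ha]
    push_cast
    linarith

theorem sub_sum_sq_le {J : ℕ} (a : ℝ) (x : Fin J → ℝ) :
    (a - ∑ j, x j) ^ 2 ≤ 2 * a ^ 2 + 2 * J * ∑ j, x j ^ 2 := by
  have h : (∑ j, x j) ^ 2 ≤ J * ∑ j, x j ^ 2 := by
    simpa using sq_sum_le_card_mul_sum_sq (s := Finset.univ) (f := x)
  nlinarith [sq_nonneg (a + ∑ j, x j)]

/-- The data of an odd solution around a multisoliton on a finite time interval `[0, T]`, with all
the quantities that are negligible or carry the exterior energy bounded by `Δ`. -/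
structure Msol {J : ℕ} (lam : Fin J → ℝ) (v z U : ℝ × ℝ → ℝ) (g T Δ : ℝ) : Prop where
  pos : ∀ j, 0 < lam j
  ratio : ∀ i j, i < j → lam j ≤ g * lam i
  wave : Wave (-(3 / 2)) (VJ lam) (fun _ => 0) v z U
  U0 : ∀ r, 0 < r → U (0, r) = 0
  hw : L2 (fun r => z (0, r)) 0
  hT : 0 ≤ T
  hΔ : 0 < Δ
  hg : 0 ≤ g
  hgM : g * nr (fun r => z (0, r)) 0 ≤ Δ
  hTM : ∀ j, bk (lam j) T * nr (fun r => z (0, r)) 0 ^ 2 ≤ Δ ^ 2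
  top : ∀ a b, T ≤ a → 0 < a → a ≤ b → (∫ r in a..b, (z (T, r) ^ 2 + U (T, r) ^ 2)) ≤ Δ ^ 2

/-- The constant of the channel estimate. -/
def chanK (J : ℕ) : ℝ := 114 * (1 + 24 * J) * exp (24 * J + 1)

/-- The size of the errors created by subtracting profiles with coefficients of size `A`. -/
def errC (J : ℕ) (A : ℝ) : ℝ := 2 + 2000 * J * A + 2 * (16000 * J ^ 2 * (J + 1) * A)

namespace Msol

variable {J : ℕ} {lam : Fin J → ℝ} {v z U : ℝ × ℝ → ℝ} {g T Δ : ℝ}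

theorem top_sub (h : Msol lam v z U g T Δ) {c : Fin J → ℝ} {A : ℝ} (hA : 0 ≤ A)
    (hc : ∀ j, |c j| ≤ A * nr (fun r => z (0, r)) 0) {a b : ℝ} (hTa : T ≤ a) (ha : 0 < a)
    (hab : a ≤ b) :
    (∫ r in a..b, ((z (T, r) - PhiJ lam c r) ^ 2 + (U (T, r) - T * PsiJ lam c r) ^ 2)) ≤
      ((2 + 2000 * J * A) * Δ) ^ 2 := by
  set M := nr (fun r => z (0, r)) 0
  have cz := slice_cont h.wave.hz T ha (b := b)
  have cU := slice_cont h.wave.hY T ha (b := b)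
  have cφ : ∀ j, Continuous (phi (lam j)) := fun j => phi_continuous _
  have cψ : ∀ j, Continuous (psi (lam j)) := fun j => psi_continuous _
  have cΦ : Continuous (PhiJ lam c) := PhiJ_continuous
  have cΨ : Continuous (PsiJ lam c) := PsiJ_continuous
  have cj : ∀ j, Continuous fun r => c j ^ 2 * (phi (lam j) r ^ 2 + T ^ 2 * psi (lam j) r ^ 2) :=
    fun j => by fun_prop
  have i1 : IntervalIntegrable (fun r => 2 * (z (T, r) ^ 2 + U (T, r) ^ 2)) volume a b :=
    ((cz.pow 2).add (cU.pow 2)).const_smul (2:ℝ) |>.intervalIntegrable_of_Icc hab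
  have i2 : ∀ j, IntervalIntegrable
      (fun r => c j ^ 2 * (phi (lam j) r ^ 2 + T ^ 2 * psi (lam j) r ^ 2)) volume a b :=
    fun j => (cj j).intervalIntegrable _ _
  have i3 : IntervalIntegrable (fun r => 2 * (J:ℝ) *
      ∑ j, c j ^ 2 * (phi (lam j) r ^ 2 + T ^ 2 * psi (lam j) r ^ 2)) volume a b :=
    ((continuous_finsetSum _ fun j _ => cj j).const_mul _).intervalIntegrable _ _
  have h1 : (∫ r in a..b, ((z (T, r) - PhiJ lam c r) ^ 2 + (U (T, r) - T * PsiJ lam c r) ^ 2)) ≤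
      ∫ r in a..b, (2 * (z (T, r) ^ 2 + U (T, r) ^ 2) +
        2 * J * ∑ j, c j ^ 2 * (phi (lam j) r ^ 2 + T ^ 2 * psi (lam j) r ^ 2)) := by
    refine intervalIntegral.integral_mono_on hab ?_ (i1.add i3) fun r _ => ?_
    · exact ContinuousOn.intervalIntegrable_of_Icc hab (((cz.sub cΦ.continuousOn).pow 2).add
        ((cU.sub (cΨ.const_mul T).continuousOn).pow 2))
    · have e1 := sub_sum_sq_le (z (T, r)) fun j => c j * phi (lam j) r
      have e2 := sub_sum_sq_le (U (T, r)) fun j => T * (c j * psi (lam j) r)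
      rw [← Finset.mul_sum] at e2
      have e3 : ∑ j, c j ^ 2 * (phi (lam j) r ^ 2 + T ^ 2 * psi (lam j) r ^ 2) =
          ∑ j, (c j * phi (lam j) r) ^ 2 + ∑ j, (T * (c j * psi (lam j) r)) ^ 2 := by
        rw [← Finset.sum_add_distrib]
        exact Finset.sum_congr rfl fun j _ => by ring
      rw [e3]
      simp only [PhiJ, PsiJ]
      linarith
  rw [intervalIntegral.integral_add i1 i3, intervalIntegral.integral_const_mul,
    intervalIntegral.integral_const_mul, intervalIntegral.integral_finsetSum fun j _ => i2 j] at h1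
  have h2 : ∀ j, (∫ r in a..b, c j ^ 2 * (phi (lam j) r ^ 2 + T ^ 2 * psi (lam j) r ^ 2)) ≤
      A ^ 2 * 912384 * Δ ^ 2 := fun j => by
    have j1 : IntervalIntegrable (fun r => phi (lam j) r ^ 2) volume a b :=
      ((cφ j).pow 2).intervalIntegrable _ _
    have j2 : IntervalIntegrable (fun r => T ^ 2 * psi (lam j) r ^ 2) volume a b :=
      (((cψ j).pow 2).const_mul _).intervalIntegrable _ _
    rw [intervalIntegral.integral_const_mul, intervalIntegral.integral_add j1 j2,
      intervalIntegral.integral_const_mul]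
    have k1 := phi_int_le (h.pos j) ha.le hab
    have k2 := psi_int_le (h.pos j) ha.le hab
    have k3 := bk_anti (h.pos j) h.hT hTa
    have k4 : 0 ≤ ∫ r in a..b, psi (lam j) r ^ 2 :=
      intervalIntegral.integral_nonneg hab fun r _ => sq_nonneg _
    have k5 : T ^ 2 * (∫ r in a..b, psi (lam j) r ^ 2) ≤ a ^ 2 * ∫ r in a..b, psi (lam j) r ^ 2 := by
      have := h.hT
      gcongr
    have k6 : c j ^ 2 ≤ (A * M) ^ 2 := sq_le_sq' (by linarith [(abs_le.1 (hc j)).1])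
      (abs_le.1 (hc j)).2
    have k7 := bk_pos (lam j) T
    have k8 := h.hTM j
    have k9 : 0 ≤ ∫ r in a..b, phi (lam j) r ^ 2 :=
      intervalIntegral.integral_nonneg hab fun r _ => sq_nonneg _
    calc _ ≤ (A * M) ^ 2 * (912384 * bk (lam j) T) :=
          mul_le_mul k6 (by linarith) (by positivity) (sq_nonneg _)
      _ = A ^ 2 * 912384 * (bk (lam j) T * M ^ 2) := by ring
      _ ≤ _ := by gcongr
  have h3 := Finset.sum_le_sum fun j (_ : j ∈ Finset.univ) => h2 j
  rw [Finset.sum_const, Finset.card_univ, Fintype.card_fin, nsmul_eq_mul] at h3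
  have h4 := h.top a b hTa ha hab
  have hJ : (0:ℝ) ≤ J := Nat.cast_nonneg J
  calc _ ≤ 2 * Δ ^ 2 + 2 * J * (J * (A ^ 2 * 912384 * Δ ^ 2)) := by
        refine h1.trans ?_
        gcongr
    _ ≤ _ := by
      have : 0 ≤ J * A := by positivity
      nlinarith [mul_nonneg this (sq_nonneg Δ), mul_nonneg (sq_nonneg (J * A)) (sq_nonneg Δ)]

/-- The channel estimate after subtracting profiles. -/
theorem step (h : Msol lam v z U g T Δ) {c : Fin J → ℝ} {A : ℝ} (hA : 0 ≤ A)
    (hc : ∀ j, |c j| ≤ A * nr (fun r => z (0, r)) 0) {R d S : ℝ} (hR : 0 < R) (hd : 0 ≤ d)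
    (hS1 : S ≤ 1) {σ : Fin J → ℝ} (hσS : ∑ k, σ k ≤ S)
    (hσ : ∀ k, σ k = 16 * d / lam k ∨ σ k = 48 * d / R ∨ σ k = 24 * bk (lam k) R) :
    ∃ e, nr (fun r => z (0, r) - PhiJ lam c r + e * rho r) R ≤ chanK J *
      (errC J A * Δ + nr (fun r => z (0, r) - PhiJ lam c r) (R + d) +
        S * nr (fun r => z (0, r) - PhiJ lam c r) R) := by
  set M := nr (fun r => z (0, r)) 0 with hM
  have hM0 : 0 ≤ M := nr_nonneg _ _
  have hJ : (0:ℝ) ≤ J := Nat.cast_nonneg J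
  have hΔ := h.hΔ.le
  set ω : ℝ → ℝ := fun t => ∑ k, 2 * ((lam k) ^ 2)⁻¹ * bk (lam k) (R + |t|) ^ 2 with hω
  set θ : ℝ → ℝ := fun t => (∑ k, (lam k)⁻¹ * bk (lam k) t) / (8 * (J + 1)) with hθ
  have cω : ∀ k, Continuous fun t : ℝ => 2 * ((lam k) ^ 2)⁻¹ * bk (lam k) (R + |t|) ^ 2 := fun k => by
    have := bk_continuous (lam k)
    fun_prop
  have cωs : Continuous ω := continuous_finsetSum _ fun k _ => cω k
  have cθs : Continuous θ := (continuous_finsetSum _ fun k _ =>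
    (bk_continuous (lam k)).const_mul _).div_const _
  have hω0 : ∀ t, 0 ≤ ω t := fun t => Finset.sum_nonneg fun k _ => by positivity
  have hθ0 : ∀ t, 0 ≤ θ t := fun t => by
    have := Finset.sum_nonneg fun k (_ : k ∈ Finset.univ) =>
      (mul_pos (inv_pos.2 (h.pos k)) (bk_pos (lam k) t)).le
    simp only [hθ]
    positivity
  have hOI := fun k => omega_int (h.pos k) hR hd h.hT
  have hΩ : (∫ t in (0:ℝ)..T, t * ω t) ≤ 24 * J := by
    simp only [hω, Finset.mul_sum]
    have i : ∀ k, IntervalIntegrable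
        (fun t : ℝ => t * (2 * ((lam k) ^ 2)⁻¹ * bk (lam k) (R + |t|) ^ 2)) volume 0 T :=
      fun k => (continuous_id.mul (cω k)).intervalIntegrable _ _
    rw [intervalIntegral.integral_finsetSum fun k _ => i k]
    refine (Finset.sum_le_sum fun k _ => (hOI k).1.trans
      (show 24 * bk (lam k) R ≤ 24 by linarith [bk_le_one (lam k) R])).trans_eq ?_
    simp [mul_comm]
  have hSint : (∫ t in (0:ℝ)..T, min t d * ω t) ≤ S := by
    refine le_trans ?_ hσS
    simp only [hω, Finset.mul_sum]
    have i : ∀ k, IntervalIntegrable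
        (fun t : ℝ => min t d * (2 * ((lam k) ^ 2)⁻¹ * bk (lam k) (R + |t|) ^ 2)) volume 0 T :=
      fun k => ((continuous_id.min continuous_const).mul (cω k)).intervalIntegrable _ _
    rw [intervalIntegral.integral_finsetSum fun k _ => i k]
    refine Finset.sum_le_sum fun k _ => ?_
    obtain ⟨-, o1, o2, o3⟩ := hOI k
    rcases hσ k with e | e | e <;> rw [e] <;> assumption
  have hθ1 : (∫ t in (0:ℝ)..T, θ t) ≤ 1 := by
    simp only [hθ]
    rw [intervalIntegral.integral_div, intervalIntegral.integral_finsetSum fun k _ =>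
      ((bk_continuous (lam k)).const_mul _).intervalIntegrable _ _, div_le_one (by positivity)]
    calc _ ≤ ∑ k : Fin J, (8:ℝ) := Finset.sum_le_sum fun k _ => by
          rw [intervalIntegral.integral_const_mul, inv_mul_le_iff₀ (h.pos k)]
          linarith [int_bk_le (h.pos k) h.hT]
      _ ≤ _ := by simp; linarith
  have hw' : L2 (fun r => z (0, r) - PhiJ lam c r) R :=
    (h.hw.mono hR.le).sub (PhiJ_L2 h.pos c hR.le).1 hR.le
  have main := channel_step (h.wave.sub_PhiJ h.pos c) (fun r hr => by simp [h.U0 r hr]) hR hd h.hT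
    cωs cθs hω0 hθ0 (Sg := 16000 * J ^ 2 * (J + 1) * A * Δ) (by positivity)
    (Δ := (2 + 2000 * J * A) * Δ) (by positivity)
    (fun t ht r hr => ?_) (fun t ht b hb => ?_) hΩ hθ1 hSint hw'
    (fun b hb => h.top_sub hA hc (by linarith) (by linarith [h.hT]) hb)
  · obtain ⟨e, he⟩ := main
    refine ⟨e, he.trans ?_⟩
    unfold chanK errC
    have : S * (16000 * J ^ 2 * (J + 1) * A * Δ) ≤ 1 * (16000 * J ^ 2 * (J + 1) * A * Δ) := by
      gcongr
    refine mul_le_mul_of_nonneg_left ?_ (by positivity)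
    nlinarith [this]
  · refine (Finset.abs_sum_le_sum_abs _ _).trans (Finset.sum_le_sum fun k _ => ?_)
    have e1 := bk_anti (h.pos k) (by linarith [ht.1]) hr
    have e2 := bk_pos (lam k) r
    rw [abs_Vp, abs_of_nonneg ht.1]
    gcongr
  · refine (cross_int_le h.pos h.ratio hc ht.1 (show t ≤ R + t by linarith) hb).trans ?_
    have e0 : 0 ≤ ∑ k, (lam k)⁻¹ * bk (lam k) t := Finset.sum_nonneg fun k _ =>
      (mul_pos (inv_pos.2 (h.pos k)) (bk_pos (lam k) t)).le
    have e1 : A * M * g ≤ A * Δ := by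
      rw [mul_assoc, mul_comm M]
      exact mul_le_mul_of_nonneg_left h.hgM hA
    have hg := h.hg
    refine pow_le_pow_left₀ (by positivity) ?_ 2
    simp only [hθ]
    rw [mul_div_assoc', le_div_iff₀ (by positivity)]
    calc _ = 16000 * J ^ 2 * (J + 1) * (A * M * g) * ∑ k, (lam k)⁻¹ * bk (lam k) t := by ring
      _ ≤ 16000 * J ^ 2 * (J + 1) * (A * Δ) * ∑ k, (lam k)⁻¹ * bk (lam k) t := by gcongr
      _ = _ := by ring

end Msol

theorem phi_rho {l : ℝ} (hl : 0 < l) {R : ℝ} (hR : 0 < R) :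
    ip (phi l) rho R = -((l ^ 3)⁻¹ * (R ^ 2 * bk l R ^ 2)) := by
  have hd : ∀ r ∈ Ici R, HasDerivAt (fun r => (l ^ 3)⁻¹ * (r ^ 2 * bk l r ^ 2))
      (phi l r * rho r) r := fun r hr => by
    have hr0 : 0 < r := hR.trans_le hr
    have h1 := (((hasDerivAt_id r).pow 2).mul ((bk_deriv hl r).pow 2)).const_mul (l ^ 3)⁻¹
    refine h1.congr_deriv ?_
    have h2 := bk_rel hl r
    have h3 : √r ≠ 0 := (Real.sqrt_pos.2 hr0).ne'
    simp only [phi, rho, id, Nat.cast_ofNat, Pi.pow_apply]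
    have h4 : r ^ 2 * √r * ((l ^ 3)⁻¹ * (2 * (2 * bk l r - 1) * bk l r ^ 2)) * (r * √r)⁻¹ =
        (l ^ 3)⁻¹ * (r * (2 * (2 * bk l r - 1) * bk l r ^ 2)) := by
      field_simp
    rw [h4]
    congr 1
    have h5 : r ^ 2 * (2 * bk l r ^ (2 - 1) * -(r / (12 * l ^ 2) * bk l r ^ 2)) =
        -(r * bk l r ^ 2 * (r ^ 2 * bk l r) / (6 * l ^ 2)) := by
      field_simp
      ring
    rw [h5, h2]
    field_simp
    ring
  have ht : Tendsto (fun r => (l ^ 3)⁻¹ * (r ^ 2 * bk l r ^ 2)) atTop (𝓝 0) := by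
    have h1 : Tendsto (fun r => (l ^ 3)⁻¹ * (24 * l ^ 2 * bk l r)) atTop (𝓝 0) := by
      simpa using ((bk_tendsto hl).const_mul (24 * l ^ 2)).const_mul (l ^ 3)⁻¹
    refine squeeze_zero (fun r => by positivity) (fun r => ?_) h1
    have h2 := sq_mul_bk_le hl r
    have h3 := bk_pos l r
    refine mul_le_mul_of_nonneg_left ?_ (by positivity)
    nlinarith [mul_le_mul_of_nonneg_right h2 h3.le]
  unfold ip
  rw [integral_Ioi_of_hasDerivAt_of_tendsto' hd ((phi_L2 hl hR.le).mul_int (rho_L2 hR) hR.le) ht]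
  ring

section

variable {f : ℝ → ℝ} {R : ℝ}

theorem L2.nr_le_of_orth (hf : L2 f R) (hR : 0 < R) (h : ip f rho R = 0) (e : ℝ) :
    nr f R ≤ nr (fun r => f r + e * rho r) R := by
  have h1 := hf.nr_comb_sq (rho_L2 hR) hR.le e
  rw [h] at h1
  refine abs_le_of_sq_le_sq' ?_ (nr_nonneg _ _) |>.2
  nlinarith [sq_nonneg (e * nr rho R)]

theorem L2.nr_le_bounded (hf : L2 f R) (hR : 0 < R) {R' : ℝ} (h1 : R ≤ R') (h2 : R' ≤ 2 * R)
    (e : ℝ) : nr f R ≤ 3 * nr (fun r => f r + e * rho r) R + 2 * nr f R' := by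
  have hρ := rho_L2 hR
  have hx := hf.comb hρ hR.le e
  have k1 : nr f R ≤ nr (fun r => f r + e * rho r) R + |e| * nr rho R := by
    have := hx.nr_comb_le hρ hR.le (-e)
    simpa using this
  have k2 : |e| * nr rho R' ≤ nr (fun r => f r + e * rho r) R + nr f R' := by
    have h3 : nr (fun r => e * rho r) R' ≤
        nr (fun r => f r + e * rho r) R' + nr f R' := by
      have := (hx.mono h1).nr_sub_le (hf.mono h1) (hR.le.trans h1)
      simpa using this
    rw [nr_smul] at h3
    linarith [hx.nr_mono h1]
  have k3 : nr rho R ≤ 2 * nr rho R' := by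
    refine abs_le_of_sq_le_sq' ?_ (by linarith [nr_nonneg rho R']) |>.2
    rw [mul_pow, rho_nr_sq hR, rho_nr_sq (hR.trans_le h1), mul_one_div, div_le_div_iff₀
      (by positivity) (by have := hR.trans_le h1; positivity)]
    nlinarith
  nlinarith [mul_le_mul_of_nonneg_left k3 (abs_nonneg e)]

theorem L2.nr_sq_sub (hf : L2 f R) {R' : ℝ} (h : R ≤ R') :
    nr f R ^ 2 = (∫ r in R..R', f r ^ 2) + nr f R' ^ 2 := by
  rw [nr_sq, nr_sq, intervalIntegral.integral_interval_add_Ioi hf.i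
    (hf.i.mono_set (Ioi_subset_Ioi h))]

theorem L2.nr_le_small (hf : L2 f R) (hR : 0 < R) {H : ℝ} (hH : 0 ≤ H)
    (h : (∫ r in R..(2 * R), f r ^ 2) ≤ H ^ 2) (e : ℝ) :
    nr f R ≤ 3 * nr (fun r => f r + e * rho r) R + 2 * H := by
  have hρ := rho_L2 hR
  have hx := hf.comb hρ hR.le e
  have hb : R ≤ 2 * R := by linarith
  have k1 : nr f R ≤ nr (fun r => f r + e * rho r) R + |e| * nr rho R := by
    have := hx.nr_comb_le hρ hR.le (-e)
    simpa using this
  have i1 : IntervalIntegrable (fun r => f r ^ 2) volume R (2 * R) :=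
    (intervalIntegrable_iff_integrableOn_Ioc_of_le hb).2 (hf.i.mono_set Ioc_subset_Ioi_self)
  have i2 : IntervalIntegrable (fun r => (f r + e * rho r) ^ 2) volume R (2 * R) :=
    (intervalIntegrable_iff_integrableOn_Ioc_of_le hb).2 (hx.i.mono_set Ioc_subset_Ioi_self)
  have i3 : IntervalIntegrable (fun r => rho r ^ 2) volume R (2 * R) :=
    (intervalIntegrable_iff_integrableOn_Ioc_of_le hb).2 (hρ.i.mono_set Ioc_subset_Ioi_self)
  have k2 : e ^ 2 * (∫ r in R..(2 * R), rho r ^ 2) ≤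
      2 * (∫ r in R..(2 * R), (f r + e * rho r) ^ 2) + 2 * ∫ r in R..(2 * R), f r ^ 2 := by
    rw [← intervalIntegral.integral_const_mul, ← intervalIntegral.integral_const_mul,
      ← intervalIntegral.integral_const_mul,
      ← intervalIntegral.integral_add (i2.const_mul 2) (i1.const_mul 2)]
    refine intervalIntegral.integral_mono_on hb (i3.const_mul _)
      ((i2.const_mul 2).add (i1.const_mul 2)) fun r _ => ?_
    nlinarith [sq_nonneg (2 * f r + e * rho r)]
  have k3 := hρ.nr_sq_sub hb
  have k4 : nr rho (2 * R) ^ 2 = nr rho R ^ 2 / 4 := by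
    rw [rho_nr_sq hR, rho_nr_sq (by linarith)]
    field_simp
    norm_num
  have k5 := hx.interval_le hb
  have k6 : |e| * nr rho R ≤ 2 * (nr (fun r => f r + e * rho r) R + H) := by
    have := nr_nonneg (fun r => f r + e * rho r) R
    refine abs_le_of_sq_le_sq' ?_ (by linarith) |>.2
    have h5 : e ^ 2 * (∫ r in R..(2 * R), rho r ^ 2) = 3 / 4 * (|e| * nr rho R) ^ 2 := by
      rw [mul_pow, sq_abs]
      have : (∫ r in R..(2 * R), rho r ^ 2) = 3 / 4 * nr rho R ^ 2 := by linarith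
      rw [this]
      ring
    nlinarith [mul_nonneg this hH]
  linarith

theorem L2.exists_small (hf : L2 f 0) {Δ : ℝ} (hΔ : 0 < Δ) {b : ℝ} (hb : 0 < b) :
    ∃ R, 0 < R ∧ R ≤ b ∧ (∫ r in (0:ℝ)..(2 * R), f r ^ 2) ≤ Δ ^ 2 := by
  have h1 : ContinuousOn (fun x => ∫ t in Ioc 0 x, f t ^ 2) (Icc 0 1) :=
    intervalIntegral.continuousOn_primitive
      ((integrableOn_Icc_iff_integrableOn_Ioc (by finiteness)).2 (hf.i.mono_set Ioc_subset_Ioi_self))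
  have h2 := h1 0 (by simp)
  rw [ContinuousWithinAt, Ioc_self, setIntegral_empty] at h2
  have h3 := (h2.mono_left (nhdsWithin_mono 0 (Ioo_subset_Icc_self))).eventually
    (gt_mem_nhds (show (0:ℝ) < Δ ^ 2 by positivity))
  rw [nhdsWithin_Ioo_eq_nhdsGT zero_lt_one] at h3
  obtain ⟨x, hx, hx2⟩ := (h3.and (Ioo_mem_nhdsGT (show (0:ℝ) < 2 * b by linarith))).exists
  refine ⟨x / 2, by linarith [hx2.1], by linarith [hx2.2], ?_⟩
  rw [intervalIntegral.integral_of_le (by linarith [hx2.1]), mul_div_cancel₀ _ two_ne_zero]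
  exact hx.le

theorem L2.tendsto_nr (hf : L2 f 0) : Tendsto (nr f) atTop (𝓝 0) := by
  have h1 := intervalIntegral_tendsto_integral_Ioi 0 hf.i tendsto_id
  have h2 : Tendsto (fun R => √((∫ r in Ioi 0, f r ^ 2) - ∫ r in (0:ℝ)..R, f r ^ 2)) atTop
      (𝓝 0) := by
    have := (h1.const_sub (∫ r in Ioi 0, f r ^ 2)).sqrt
    simpa using this
  refine h2.congr' ?_
  filter_upwards [eventually_ge_atTop 0] with R hR
  have := hf.nr_sq_sub hR
  rw [← nr_sq, this, add_sub_cancel_left, Real.sqrt_sq (nr_nonneg _ _)]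

end

/-- The admissible size of a single potential increment in a channel step. -/
def chanS (J : ℕ) : ℝ := 1 / (6 * chanK J * (J + 1))

theorem chanK_ge (J : ℕ) : 1 ≤ chanK J := by
  unfold chanK
  have h1 : 1 ≤ exp (24 * (J:ℝ) + 1) := Real.one_le_exp (by positivity)
  have h2 : (1:ℝ) ≤ 114 * (1 + 24 * J) := by nlinarith [Nat.cast_nonneg (α := ℝ) J]
  nlinarith

theorem chanS_pos (J : ℕ) : 0 < chanS J := by
  have := chanK_ge J
  unfold chanS
  positivity

theorem chanS_le (J : ℕ) : chanS J ≤ 1 := by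
  have := chanK_ge J
  have hJ := Nat.cast_nonneg (α := ℝ) J
  unfold chanS
  rw [div_le_one (by positivity)]
  nlinarith

namespace Msol

variable {J : ℕ} {lam : Fin J → ℝ} {v z U : ℝ × ℝ → ℝ} {g T Δ : ℝ}

/-- The channel estimate with the potential increment absorbed. -/
theorem absorb (h : Msol lam v z U g T Δ) {c : Fin J → ℝ} {A : ℝ} (hA : 0 ≤ A)
    (hc : ∀ j, |c j| ≤ A * nr (fun r => z (0, r)) 0) {R d ε : ℝ} (hR : 0 < R) (hd : 0 ≤ d)
    (hσ : ∀ k, 16 * d / lam k ≤ chanS J ∨ 48 * d / R ≤ chanS J ∨ 24 * bk (lam k) R ≤ chanS J)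
    (hε : ∀ e, nr (fun r => z (0, r) - PhiJ lam c r) R ≤
      3 * nr (fun r => z (0, r) - PhiJ lam c r + e * rho r) R + 2 * ε) :
    nr (fun r => z (0, r) - PhiJ lam c r) R ≤ 6 * chanK J * (errC J A * Δ +
      nr (fun r => z (0, r) - PhiJ lam c r) (R + d)) + 4 * ε := by
  have hσ' : ∀ k, ∃ s, s ≤ chanS J ∧
      (s = 16 * d / lam k ∨ s = 48 * d / R ∨ s = 24 * bk (lam k) R) := fun k => by
    rcases hσ k with h1 | h1 | h1
    · exact ⟨_, h1, Or.inl rfl⟩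
    · exact ⟨_, h1, Or.inr (Or.inl rfl)⟩
    · exact ⟨_, h1, Or.inr (Or.inr rfl)⟩
  choose σ hσ1 hσ2 using hσ'
  have hK := chanK_ge J
  have hJ := Nat.cast_nonneg (α := ℝ) J
  have hs := chanS_pos J
  have hS : (J * chanS J) * (6 * chanK J) ≤ 1 := by
    have : chanS J * (6 * chanK J * (J + 1)) = 1 := by
      unfold chanS
      field_simp
    nlinarith [mul_pos hs (show 0 < 6 * chanK J by linarith)]
  have hS1 : J * chanS J ≤ 1 := by nlinarith [mul_nonneg hJ hs.le]
  obtain ⟨e, he⟩ := h.step hA hc hR hd hS1 (σ := σ)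
    ((Finset.sum_le_sum fun k _ => hσ1 k).trans_eq (by simp)) hσ2
  have h1 := hε e
  have h2 := nr_nonneg (fun r => z (0, r) - PhiJ lam c r) R
  nlinarith [mul_le_mul_of_nonneg_right hS h2]

end Msol

theorem PhiJ_add_single {J : ℕ} (lam c : Fin J → ℝ) (n : Fin J) (a r : ℝ) :
    PhiJ lam (c + Pi.single n a) r = PhiJ lam c r + a * phi (lam n) r := by
  simp [PhiJ, add_mul, Finset.sum_add_distrib, Pi.single_apply, ite_mul]

/-- The ratio radius / scale above which the potential of a soliton is negligible. -/
def outR (J : ℕ) : ℝ := 24 / chanS J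

theorem outR_pos (J : ℕ) : 0 < outR J := div_pos (by norm_num) (chanS_pos J)

theorem far_le {J : ℕ} {l R d : ℝ} (hl : 0 < l) (hd : d ≤ R) (h : R ≤ chanS J / 16 * l) :
    16 * d / l ≤ chanS J := by
  rw [div_le_iff₀ hl]
  linarith

theorem near_le {J : ℕ} {l R : ℝ} (hl : 0 < l) (h : outR J * l ≤ R) :
    24 * bk l R ≤ chanS J := by
  have hs := chanS_pos J
  have hs1 := chanS_le J
  have h1 := sq_mul_bk_le hl R
  have h2 : 24 * l ≤ R * chanS J := by
    unfold outR at h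
    rw [div_mul_eq_mul_div, div_le_iff₀ hs] at h
    exact h
  have hR : 0 < R := (mul_pos (outR_pos J) hl).trans_le h
  have h3 : (24 * l) ^ 2 ≤ (R * chanS J) ^ 2 := pow_le_pow_left₀ (by positivity) h2 2
  have h4 : R ^ 2 * (24 * bk l R) ≤ R ^ 2 * chanS J := by
    have : chanS J ^ 2 ≤ chanS J := by nlinarith
    nlinarith [mul_le_mul_of_nonneg_left this (sq_nonneg R)]
  exact le_of_mul_le_mul_left h4 (by positivity)

/-- The first `n` profile coefficients have been found, and the remainder is small outside a
radius lying between the scales `n - 1` and `n`. -/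
def Stage {J : ℕ} (lam : Fin J → ℝ) (z : ℝ × ℝ → ℝ) (Δ : ℝ) (n : ℕ) (C : ℝ) : Prop :=
  ∃ (c : Fin J → ℝ) (R : ℝ), 0 < R ∧ (∀ j, |c j| ≤ C * nr (fun r => z (0, r)) 0) ∧
    (∀ k : Fin J, (k : ℕ) < n → R ≤ chanS J / 16 * lam k) ∧
    (∀ k : Fin J, (k : ℕ) = n → lam k * nr (fun r => z (0, r)) 0 ≤ C * Δ * R ∧
      outR J * lam k ≤ R) ∧
    nr (fun r => z (0, r) - PhiJ lam c r) R ≤ C * Δ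

theorem stage_zero {J : ℕ} {lam : Fin J → ℝ} {v z U : ℝ × ℝ → ℝ} {g T Δ : ℝ}
    (h : Msol lam v z U g T Δ) : Stage lam z Δ 0 1 := by
  have hΔ := h.hΔ
  have h1 := h.hw.tendsto_nr.eventually (gt_mem_nhds hΔ)
  have h2 : ∀ᶠ R : ℝ in atTop, ∀ k : Fin J,
      lam k * nr (fun r => z (0, r)) 0 / Δ ≤ R ∧ outR J * lam k ≤ R :=
    eventually_all.2 fun k => (eventually_ge_atTop _).and (eventually_ge_atTop _)
  obtain ⟨R, hR1, hR2, hR3⟩ := (h1.and (h2.and (eventually_gt_atTop 0))).exists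
  refine ⟨0, R, hR3, fun j => by simpa using nr_nonneg _ _, fun k hk => by simp at hk,
    fun k _ => ⟨?_, (hR2 k).2⟩, ?_⟩
  · have := (hR2 k).1
    rw [div_le_iff₀ hΔ] at this
    linarith
  · have e : (fun r => z (0, r) - PhiJ lam 0 r) = fun r => z (0, r) := by
      ext r; simp [PhiJ]
    rw [e]
    linarith

/-- Adding the next profile brings the radius down to its scale. -/
theorem gap_step (J : ℕ) {C : ℝ} (hC : 0 ≤ C) : ∃ C', 0 ≤ C' ∧
    ∀ {lam : Fin J → ℝ} {v z U : ℝ × ℝ → ℝ} {g T Δ : ℝ}, Msol lam v z U g T Δ →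
    (∀ i j, i ≤ j → lam j ≤ lam i) → ∀ n : Fin J, Stage lam z Δ n C →
    ∃ c : Fin J → ℝ, (∀ j, |c j| ≤ C' * nr (fun r => z (0, r)) 0) ∧
      nr (fun r => z (0, r) - PhiJ lam c r) (outR J * lam n) ≤ C' * Δ := by
  set β := (1 + outR J ^ 2 / 24)⁻¹ with hβ
  have hβ0 : 0 < β := by positivity
  have hR0 := outR_pos J
  set B := 1 / (outR J ^ 3 * β ^ 2) with hB
  have hB0 : 0 < B := by positivity
  have hJ := Nat.cast_nonneg (α := ℝ) J
  set A₁ := B * (1 + 200 * J * C) with hA₁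
  have hA₁0 : 0 ≤ A₁ := by positivity
  have hK := chanK_ge J
  set C₁ := 6 * chanK J * (errC J (C + A₁) + (C + 1000 * A₁ * C)) with hC₁
  have hC₁0 : 0 ≤ C₁ := by unfold C₁ errC; positivity
  refine ⟨C + A₁ + C₁, by positivity, fun {lam v z U g T Δ} h hanti n hst => ?_⟩
  obtain ⟨c, R, hR, hcC, hfar, hn, hnr⟩ := hst
  obtain ⟨hn1, hn2⟩ := hn n rfl
  have hl := h.pos n
  have hΔ := h.hΔ
  set M := nr (fun r => z (0, r)) 0 with hM
  have hM0 : 0 ≤ M := nr_nonneg _ _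
  set R' := outR J * lam n with hR'
  have hR'0 : 0 < R' := by positivity
  have hf : L2 (fun r => z (0, r) - PhiJ lam c r) 0 := h.hw.sub (PhiJ_L2 h.pos c le_rfl).1 le_rfl
  have hφ := phi_L2 hl le_rfl
  set f := fun r => z (0, r) - PhiJ lam c r with hfd
  have hfM : nr f R' ≤ (1 + 200 * J * C) * M := by
    refine (hf.nr_mono hR'0.le).trans ((h.hw.nr_sub_le (PhiJ_L2 h.pos c le_rfl).1 le_rfl).trans ?_)
    have := (PhiJ_L2 h.pos c le_rfl).2 _ hcC
    nlinarith
  have hρ := rho_L2 hR'0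
  set a := ip f rho R' / ip (phi (lam n)) rho R' with ha
  have hip : ip (phi (lam n)) rho R' = -(outR J ^ 2 * β ^ 2 / lam n) := by
    rw [phi_rho hl hR'0]
    have : bk (lam n) R' = β := by
      unfold bk
      rw [hR', mul_div_assoc, div_self hl.ne', mul_one]
    rw [this, hR']
    field_simp
  have hip0 : ip (phi (lam n)) rho R' ≠ 0 := by
    rw [hip]
    exact neg_ne_zero.2 (by positivity)
  have haM : |a| ≤ A₁ * M := by
    have h1 := (hf.mono hR'0.le).ip_le hρ hR'0.le
    have h2 : nr rho R' ≤ 1 / R' := by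
      refine abs_le_of_sq_le_sq' ?_ (by positivity) |>.2
      rw [rho_nr_sq hR'0, div_pow, one_pow, div_le_div_iff₀ (by positivity) (by positivity)]
      nlinarith [sq_nonneg R']
    have h3 : |a| ≤ nr f R' * B := by
      rw [ha, abs_div, hip, abs_neg, abs_of_pos (a := outR J ^ 2 * β ^ 2 / lam n) (by positivity),
        div_le_iff₀ (by positivity)]
      refine h1.trans ((mul_le_mul_of_nonneg_left h2 (nr_nonneg _ _)).trans_eq ?_)
      rw [hB, hR']
      field_simp
    refine h3.trans ((mul_le_mul_of_nonneg_right hfM hB0.le).trans_eq ?_)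
    ring
  have hcA : ∀ j, |(c + Pi.single n a : Fin J → ℝ) j| ≤ (C + A₁) * M := fun j => by
    have h1 : |(Pi.single n a : Fin J → ℝ) j| ≤ A₁ * M := by
      by_cases hj : j = n
      · subst hj; simpa using haM
      · simp [hj]; positivity
    rw [Pi.add_apply]
    refine (abs_add_le _ _).trans ?_
    linarith [hcC j]
  have hfe : (fun r => z (0, r) - PhiJ lam (c + Pi.single n a) r) =
      fun r => f r + (-a) * phi (lam n) r := by
    ext r
    rw [PhiJ_add_single]
    simp only [hfd]
    ring
  have hf' := hf.comb hφ le_rfl (-a)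
  refine ⟨c + Pi.single n a, fun j => (hcA j).trans
    (mul_le_mul_of_nonneg_right (by linarith) hM0), ?_⟩
  have horth : ip (fun r => f r + (-a) * phi (lam n) r) rho R' = 0 := by
    rw [(hf.mono hR'0.le).ip_comb (hφ.mono hR'0.le) hρ hR'0.le, ha]
    field_simp
    ring
  have key := h.absorb (add_nonneg hC hA₁0) hcA hR'0 (d := R - R') (ε := 0) (by linarith)
    (fun k => ?_) (fun e => ?_)
  · rw [hfe, add_sub_cancel] at key
    rw [hfe]
    refine key.trans ?_
    have h1 := (hf.mono hR.le).nr_comb_le (hφ.mono hR.le) hR.le (-a)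
    have h2 := phi_nr_le_div hl hR
    have h3 : |a| * nr (phi (lam n)) R ≤ 1000 * A₁ * C * Δ := by
      calc _ ≤ A₁ * M * (1000 * (lam n / R)) := by gcongr; exact nr_nonneg _ _
        _ = 1000 * A₁ * (lam n * M / R) := by ring
        _ ≤ 1000 * A₁ * (C * Δ) := by
          gcongr
          rw [div_le_iff₀ hR]
          exact hn1
        _ = _ := by ring
    rw [abs_neg] at h1
    have h4 : nr (fun r => f r + -a * phi (lam n) r) R ≤ (C + 1000 * A₁ * C) * Δ := by linarith
    have h5 : 6 * chanK J * (errC J (C + A₁) * Δ + nr (fun r => f r + -a * phi (lam n) r) R) ≤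
        C₁ * Δ := by
      calc _ ≤ 6 * chanK J * (errC J (C + A₁) * Δ + (C + 1000 * A₁ * C) * Δ) := by gcongr
        _ = _ := by rw [hC₁]; ring
    nlinarith [mul_nonneg hC hΔ.le, mul_nonneg hA₁0 hΔ.le]
  · rcases lt_or_ge k n with hk | hk
    · exact Or.inl (far_le (h.pos k) (by linarith) (hfar k hk))
    · refine Or.inr (Or.inr (near_le (h.pos k) ?_))
      rw [hR']
      gcongr
      exact hanti _ _ hk
  · have hfe' : (fun r => z (0, r) - PhiJ lam (c + Pi.single n a) r + e * rho r) =
        fun r => f r + (-a) * phi (lam n) r + e * rho r := by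
      ext r
      rw [congrFun hfe r]
    rw [hfe, hfe']
    have := (hf'.mono hR'0.le).nr_le_of_orth hR'0 horth e
    linarith [nr_nonneg (fun r => f r + (-a) * phi (lam n) r + e * rho r) R']

/-- The ratio of consecutive radii when crossing the scale of a soliton. -/
def decR (J : ℕ) : ℝ := 1 - chanS J / 96

theorem decR_bounds (J : ℕ) : 1 / 2 ≤ decR J ∧ decR J < 1 := by
  have := chanS_pos J
  have := chanS_le J
  unfold decR
  constructor <;> linarith

/-- The radius can be brought through the scale of a soliton in finitely many steps. -/
theorem bounded_steps (J : ℕ) {C : ℝ} (hC : 0 ≤ C) (m : ℕ) : ∃ C', 0 ≤ C' ∧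
    ∀ {lam : Fin J → ℝ} {v z U : ℝ × ℝ → ℝ} {g T Δ : ℝ}, Msol lam v z U g T Δ →
    ∀ (c : Fin J → ℝ) (R : ℝ), 0 < R → (∀ j, |c j| ≤ C * nr (fun r => z (0, r)) 0) →
      nr (fun r => z (0, r) - PhiJ lam c r) R ≤ C * Δ →
      nr (fun r => z (0, r) - PhiJ lam c r) (decR J ^ m * R) ≤ C' * Δ := by
  have hK := chanK_ge J
  have hϱ := decR_bounds J
  have hϱ0 : 0 < decR J := by linarith [hϱ.1]
  have hs := chanS_pos J
  induction m with
  | zero => exact ⟨C, hC, fun {lam v z U g T Δ} h c R hR hc hn => by simpa using hn⟩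
  | succ m ih =>
    obtain ⟨C', hC', ih⟩ := ih
    refine ⟨6 * chanK J * (errC J C + C') + 4 * C', by unfold errC; positivity,
      fun {lam v z U g T Δ} h c R hR hc hn => ?_⟩
    have h1 := ih h c R hR hc hn
    set R₁ := decR J ^ m * R with hR₁
    have hR₁0 : 0 < R₁ := by positivity
    have e : decR J ^ (m + 1) * R = decR J * R₁ := by rw [hR₁]; ring
    have hR'0 : 0 < decR J * R₁ := by positivity
    have hle : decR J * R₁ ≤ R₁ := by nlinarith
    have hf : L2 (fun r => z (0, r) - PhiJ lam c r) (decR J * R₁) :=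
      (h.hw.mono hR'0.le).sub (PhiJ_L2 h.pos c hR'0.le).1 hR'0.le
    have key := h.absorb hC hc hR'0 (d := R₁ - decR J * R₁) (sub_nonneg.2 hle)
      (fun k => Or.inr (Or.inl ?_)) (fun e => hf.nr_le_bounded hR'0 hle (by nlinarith) e)
    · rw [add_sub_cancel] at key
      rw [e]
      refine key.trans ?_
      have hΔ := h.hΔ.le
      calc _ ≤ 6 * chanK J * (errC J C * Δ + C' * Δ) + 4 * (C' * Δ) := by gcongr
        _ = _ := by ring
    · rw [div_le_iff₀ hR'0]
      have h2 : 48 * (1 - decR J) ≤ chanS J * decR J := by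
        have : 1 - decR J = chanS J / 96 := by unfold decR; ring
        rw [this]
        nlinarith [hϱ.1]
      nlinarith [mul_le_mul_of_nonneg_right h2 hR₁0.le]

theorem exists_decR (J : ℕ) : ∃ m : ℕ, decR J ^ m * outR J ≤ chanS J / 16 := by
  have hϱ := decR_bounds J
  have := outR_pos J
  have hs := chanS_pos J
  obtain ⟨m, hm⟩ := exists_pow_lt_of_lt_one (show 0 < chanS J / 16 / outR J by positivity) hϱ.2
  exact ⟨m, ((lt_div_iff₀ this).1 hm).le⟩

theorem exists_stage (J m : ℕ) (hm : decR J ^ m * outR J ≤ chanS J / 16) (n : ℕ) (hn : n ≤ J) :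
    ∃ C, 0 ≤ C ∧ ∀ {lam : Fin J → ℝ} {v z U : ℝ × ℝ → ℝ} {g T Δ : ℝ}, Msol lam v z U g T Δ →
    (∀ i j, i ≤ j → lam j ≤ lam i) → g ≤ decR J ^ m → Stage lam z Δ n C := by
  have hϱ := decR_bounds J
  have hϱ0 : 0 < decR J := by linarith [hϱ.1]
  have hs := chanS_pos J
  have hR0 := outR_pos J
  induction n with
  | zero => exact ⟨1, zero_le_one, fun {lam v z U g T Δ} h _ _ => stage_zero h⟩
  | succ n ih =>
    obtain ⟨C, hC, ih⟩ := ih (by omega)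
    obtain ⟨C₁, hC₁, gap⟩ := gap_step J hC
    obtain ⟨C₂, hC₂, bdd⟩ := bounded_steps J hC₁ m
    refine ⟨C₁ + C₂ + 1 / (decR J ^ m * outR J), by positivity,
      fun {lam v z U g T Δ} h hanti hg => ?_⟩
    have hΔ := h.hΔ
    have hM0 : 0 ≤ nr (fun r => z (0, r)) 0 := nr_nonneg _ _
    obtain ⟨c, hc, hcn⟩ := gap h hanti ⟨n, hn⟩ (ih h hanti hg)
    set l := lam ⟨n, hn⟩
    have hl : 0 < l := h.pos _
    have hb := bdd h c (outR J * l) (by positivity) hc hcn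
    have hp : 0 < decR J ^ m * outR J := by positivity
    have hi : 0 < 1 / (decR J ^ m * outR J) := by positivity
    refine ⟨c, decR J ^ m * (outR J * l), by positivity,
      fun j => (hc j).trans (mul_le_mul_of_nonneg_right (by linarith) hM0), fun k hk => ?_,
      fun k hk => ⟨?_, ?_⟩, hb.trans (mul_le_mul_of_nonneg_right (by linarith) hΔ.le)⟩
    · have h1 : l ≤ lam k := hanti _ _ (Fin.le_def.2 (by simp only; omega))
      rw [← mul_assoc]
      exact mul_le_mul hm h1 hl.le (by positivity)
    · have h1 := h.ratio ⟨n, hn⟩ k (Fin.lt_def.2 (by simp only; omega))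
      have h2 : lam k * nr (fun r => z (0, r)) 0 ≤ l * Δ := by
        refine (mul_le_mul_of_nonneg_right h1 hM0).trans ?_
        nlinarith [mul_le_mul_of_nonneg_left h.hgM hl.le]
      have h3 : 1 / (decR J ^ m * outR J) * Δ * (decR J ^ m * (outR J * l)) = l * Δ := by
        field_simp
      have h4 : 0 ≤ (C₁ + C₂) * Δ * (decR J ^ m * (outR J * l)) := by positivity
      nlinarith
    · have h1 := h.ratio ⟨n, hn⟩ k (Fin.lt_def.2 (by simp only; omega))
      have h2 : lam k ≤ decR J ^ m * l := h1.trans (mul_le_mul_of_nonneg_right hg hl.le)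
      nlinarith [mul_le_mul_of_nonneg_left h2 hR0.le]

/-- The one-dimensional form of the channel estimate. -/
theorem channel_multisoliton (J : ℕ) : ∃ γ C : ℝ, 0 < γ ∧ 0 < C ∧
    ∀ {lam : Fin J → ℝ} {v z U : ℝ × ℝ → ℝ} {g T Δ : ℝ}, Msol lam v z U g T Δ →
    (∀ i j, i ≤ j → lam j ≤ lam i) → g ≤ γ →
    ∃ c : Fin J → ℝ, nr (fun r => z (0, r) - PhiJ lam c r) 0 ≤ C * Δ := by
  obtain ⟨m, hm⟩ := exists_decR J
  obtain ⟨C, hC, hst⟩ := exists_stage J m hm J le_rfl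
  have hϱ := decR_bounds J
  have hϱ0 : 0 < decR J := by linarith [hϱ.1]
  have hK := chanK_ge J
  refine ⟨decR J ^ m, 6 * chanK J * (errC J C + C) + 5, by positivity, by unfold errC; positivity,
    fun {lam v z U g T Δ} h hanti hg => ?_⟩
  obtain ⟨c, R, hR, hc, hfar, -, hn⟩ := hst h hanti hg
  have hΔ := h.hΔ
  have hf : L2 (fun r => z (0, r) - PhiJ lam c r) 0 := h.hw.sub (PhiJ_L2 h.pos c le_rfl).1 le_rfl
  obtain ⟨R', hR'0, hR'R, hsm⟩ := hf.exists_small hΔ hR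
  have i0 : IntervalIntegrable (fun r => (z (0, r) - PhiJ lam c r) ^ 2) volume 0 (2 * R') :=
    (intervalIntegrable_iff_integrableOn_Ioc_of_le (by linarith)).2
      (hf.i.mono_set Ioc_subset_Ioi_self)
  have hs1 : (∫ r in R'..(2 * R'), (z (0, r) - PhiJ lam c r) ^ 2) ≤ Δ ^ 2 :=
    (intervalIntegral.integral_mono_interval hR'0.le (by linarith) le_rfl
      (Eventually.of_forall fun r => sq_nonneg _) i0).trans hsm
  have hs2 : (∫ r in (0:ℝ)..R', (z (0, r) - PhiJ lam c r) ^ 2) ≤ Δ ^ 2 :=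
    (intervalIntegral.integral_mono_interval le_rfl hR'0.le (by linarith)
      (Eventually.of_forall fun r => sq_nonneg _) i0).trans hsm
  have key := h.absorb hC hc hR'0 (d := R - R') (sub_nonneg.2 hR'R)
    (fun k => Or.inl (far_le (h.pos k) (by linarith) (hfar k k.2)))
    (fun e => (hf.mono hR'0.le).nr_le_small hR'0 hΔ.le hs1 e)
  rw [add_sub_cancel] at key
  refine ⟨c, ?_⟩
  have h1 := hf.nr_sq_sub hR'0.le
  have h2 : nr (fun r => z (0, r) - PhiJ lam c r) 0 ≤
      nr (fun r => z (0, r) - PhiJ lam c r) R' + Δ := by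
    have := nr_nonneg (fun r => z (0, r) - PhiJ lam c r) R'
    refine abs_le_of_sq_le_sq' ?_ (by linarith) |>.2
    nlinarith
  refine h2.trans ?_
  calc _ ≤ 6 * chanK J * (errC J C * Δ + C * Δ) + 4 * Δ + Δ := by
        refine add_le_add_left (key.trans ?_) _
        gcongr
    _ = _ := by ring

/-- The differential of a function of `(t, r)` in terms of its partial derivatives. -/
def par (a b : ℝ) : ℝ × ℝ →L[ℝ] ℝ :=
  a • ContinuousLinearMap.fst ℝ ℝ ℝ + b • ContinuousLinearMap.snd ℝ ℝ ℝ

theorem par_apply (a b x y : ℝ) : par a b (x, y) = a * x + b * y := by simp [par]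

theorem eq_par (L : ℝ × ℝ →L[ℝ] ℝ) : L = par (L (1, 0)) (L (0, 1)) := by
  ext <;> simp [par]

/-- A radial solution of the wave equation in dimension six with its partial derivatives. -/
structure Rad (V : ℝ → ℝ) (F Ft Fr Ftt Ftr Frr : ℝ × ℝ → ℝ) : Prop where
  hF : ∀ p, HasFDerivAt F (par (Ft p) (Fr p)) p
  hFt : ∀ p, HasFDerivAt Ft (par (Ftt p) (Ftr p)) p
  hFr : ∀ p, HasFDerivAt Fr (par (Ftr p) (Frr p)) p
  pde : ∀ t r, 0 < r → Ftt (t, r) = Frr (t, r) + 5 / r * Fr (t, r) - V r * F (t, r)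

section

variable {V : ℝ → ℝ} {F Ft Fr Ftt Ftr Frr : ℝ × ℝ → ℝ}

theorem hasDerivAt_fst {f : ℝ × ℝ → ℝ} {a b t r : ℝ} (h : HasFDerivAt f (par a b) (t, r)) :
    HasDerivAt (fun τ => f (τ, r)) a t := by
  have h1 : HasDerivAt (fun τ : ℝ => (τ, r)) ((1 : ℝ), (0 : ℝ)) t :=
    (hasDerivAt_id t).prodMk (hasDerivAt_const t r)
  refine (h.comp_hasDerivAt t h1).congr_deriv ?_
  simp [par_apply]

theorem hasDerivAt_snd {f : ℝ × ℝ → ℝ} {a b t r : ℝ} (h : HasFDerivAt f (par a b) (t, r)) :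
    HasDerivAt (fun s => f (t, s)) b r := by
  have h1 : HasDerivAt (fun s : ℝ => (t, s)) ((0 : ℝ), (1 : ℝ)) r :=
    (hasDerivAt_const r t).prodMk (hasDerivAt_id r)
  refine (h.comp_hasDerivAt r h1).congr_deriv ?_
  simp [par_apply]

theorem exists_partials (hF : ContDiff ℝ 2 F) : ∃ Ft Fr Ftt Ftr Frr : ℝ × ℝ → ℝ,
    (∀ p, HasFDerivAt F (par (Ft p) (Fr p)) p) ∧ (∀ p, HasFDerivAt Ft (par (Ftt p) (Ftr p)) p) ∧
    ∀ p, HasFDerivAt Fr (par (Ftr p) (Frr p)) p := by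
  have h1 : Differentiable ℝ (fderiv ℝ F) :=
    (hF.fderiv_right (m := 1) (by norm_num)).differentiable one_ne_zero
  have h2 : ∀ p (w : ℝ × ℝ), HasFDerivAt (fun q => fderiv ℝ F q w)
      ((ContinuousLinearMap.apply ℝ ℝ w).comp (fderiv ℝ (fderiv ℝ F) p)) p := fun p w =>
    (ContinuousLinearMap.apply ℝ ℝ w).hasFDerivAt.comp p (h1 p).hasFDerivAt
  refine ⟨fun p => fderiv ℝ F p (1, 0), fun p => fderiv ℝ F p (0, 1),
    fun p => fderiv ℝ (fderiv ℝ F) p (1, 0) (1, 0), fun p => fderiv ℝ (fderiv ℝ F) p (0, 1) (1, 0),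
    fun p => fderiv ℝ (fderiv ℝ F) p (0, 1) (0, 1), fun p => ?_, fun p => ?_, fun p => ?_⟩
  · rw [← eq_par]
    exact (hF.differentiable two_ne_zero p).hasFDerivAt
  · exact (h2 p (1, 0)).congr_fderiv (eq_par _)
  · have h3 := hF.contDiffAt.isSymmSndFDerivAt (x := p) (by simp) (1, 0) (0, 1)
    refine (h2 p (0, 1)).congr_fderiv ((eq_par _).trans ?_)
    simp [h3]

theorem Rad.reflect (h : Rad V F Ft Fr Ftt Ftr Frr) :
    Rad V (fun p => F (-p.1, p.2)) (fun p => -Ft (-p.1, p.2)) (fun p => Fr (-p.1, p.2))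
      (fun p => Ftt (-p.1, p.2)) (fun p => -Ftr (-p.1, p.2)) (fun p => Frr (-p.1, p.2)) := by
  have hσ : ∀ p : ℝ × ℝ, HasFDerivAt (fun p : ℝ × ℝ => (-p.1, p.2))
      ((-ContinuousLinearMap.fst ℝ ℝ ℝ).prod (ContinuousLinearMap.snd ℝ ℝ ℝ)) p := fun p =>
    hasFDerivAt_fst.neg.prodMk hasFDerivAt_snd
  have key : ∀ {f : ℝ × ℝ → ℝ} {a b : ℝ} {p : ℝ × ℝ}, HasFDerivAt f (par a b) (-p.1, p.2) →
      HasFDerivAt (fun p => f (-p.1, p.2)) (par (-a) b) p := fun {f a b p} hf => by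
    refine (hf.comp p (hσ p)).congr_fderiv ?_
    ext <;> simp [par]
  refine ⟨fun p => key (h.hF _), fun p => ?_, fun p => key (h.hFr _), fun t r hr => h.pde (-t) r hr⟩
  refine (key (h.hFt _)).fun_neg.congr_fderiv ?_
  ext <;> simp [par]

theorem Rad.half_sub {G Gt Gr Gtt Gtr Grr : ℝ × ℝ → ℝ} (h : Rad V F Ft Fr Ftt Ftr Frr)
    (k : Rad V G Gt Gr Gtt Gtr Grr) :
    Rad V (fun p => (F p - G p) / 2) (fun p => (Ft p - Gt p) / 2) (fun p => (Fr p - Gr p) / 2)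
      (fun p => (Ftt p - Gtt p) / 2) (fun p => (Ftr p - Gtr p) / 2)
      (fun p => (Frr p - Grr p) / 2) := by
  have key : ∀ {f g : ℝ × ℝ → ℝ} {a b c d : ℝ} {p : ℝ × ℝ}, HasFDerivAt f (par a b) p →
      HasFDerivAt g (par c d) p →
      HasFDerivAt (fun p => (f p - g p) / 2) (par ((a - c) / 2) ((b - d) / 2)) p :=
    fun {f g a b c d p} hf hg => by
      refine ((hf.fun_sub hg).mul_const (2⁻¹ : ℝ)).congr_fderiv ?_
      ext <;> simp [par] <;> ring
  refine ⟨fun p => key (h.hF p) (k.hF p), fun p => key (h.hFt p) (k.hFt p),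
    fun p => key (h.hFr p) (k.hFr p), fun t r hr => ?_⟩
  simp only [h.pde t r hr, k.pde t r hr]
  ring

/-- The conjugation weight `r^{5/2}`. -/
def qw (r : ℝ) : ℝ := r ^ 2 * √r

theorem qw_continuous : Continuous qw := by unfold qw; fun_prop

theorem qw_sq {r : ℝ} (hr : 0 ≤ r) : qw r ^ 2 = r ^ 5 := by
  unfold qw
  rw [mul_pow, Real.sq_sqrt hr]
  ring

theorem qw_deriv {r : ℝ} (hr : 0 < r) : HasDerivAt qw (5 / 2 * (qw r / r)) r := by
  have h := ((hasDerivAt_id r).pow 2).mul (Real.hasDerivAt_sqrt hr.ne')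
  refine h.congr_deriv ?_
  have h1 := Real.sq_sqrt hr.le
  have h2 : √r ≠ 0 := (Real.sqrt_pos.2 hr).ne'
  simp only [qw, id, Pi.pow_apply, Nat.cast_ofNat]
  field_simp
  rw [h1]
  ring

theorem qw_mul {f : ℝ × ℝ → ℝ} {a b t r : ℝ} (hr : 0 < r) (h : HasFDerivAt f (par a b) (t, r)) :
    HasFDerivAt (fun p => qw p.2 * f p)
      (par (qw r * a) (qw r * b + 5 / 2 * (qw r / r) * f (t, r))) (t, r) := by
  have h1 : HasFDerivAt (fun p : ℝ × ℝ => qw p.2)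
      ((5 / 2 * (qw r / r)) • ContinuousLinearMap.snd ℝ ℝ ℝ) (t, r) :=
    HasDerivAt.comp_hasFDerivAt (h₂ := qw) (f := Prod.snd) (t, r) (qw_deriv hr)
      (hasFDerivAt_snd (p := (t, r)))
  refine (h1.fun_mul h).congr_fderiv ?_
  ext <;> simp [par]
  ring

theorem Rad.cont (h : Rad V F Ft Fr Ftt Ftr Frr) :
    Continuous F ∧ Continuous Ft ∧ Continuous Fr :=
  ⟨continuous_iff_continuousAt.2 fun p => (h.hF p).continuousAt,
    continuous_iff_continuousAt.2 fun p => (h.hFt p).continuousAt,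
    continuous_iff_continuousAt.2 fun p => (h.hFr p).continuousAt⟩

theorem Rad.wave (h : Rad V F Ft Fr Ftt Ftr Frr) (hV : Continuous V) :
    Wave (5 / 2) V (fun p => -(V p.2 * (qw p.2 * F (0, p.2))))
      (fun p => qw p.2 * (F p - F (0, p.2))) (fun p => qw p.2 * Ft p)
      (fun p => qw p.2 * Fr p) := by
  obtain ⟨c0, c1, c2⟩ := h.cont
  have cq := qw_continuous
  refine ⟨hV.continuousOn, by fun_prop, by fun_prop, fun r _ => by simp, fun t r hr => ?_,
    fun t r hr => ⟨_, _, qw_mul hr (h.hFt (t, r)), qw_mul hr (h.hFr (t, r)), ?_, ?_⟩⟩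
  · exact ((hasDerivAt_fst (h.hF (t, r))).sub_const (F (0, r))).const_mul (qw r)
  · simp only [par_apply, h.pde t r hr]
    ring
  · simp only [par_apply]
    ring

theorem Rad.wave_odd (h : Rad V F Ft Fr Ftt Ftr Frr) (hV : Continuous V)
    (h0 : ∀ r, F (0, r) = 0) :
    Wave (-(3 / 2)) V (fun _ => 0) (fun p => qw p.2 * F p) (fun p => qw p.2 * Ft p)
      (fun p => qw p.2 * (Fr p + 4 * (F p / p.2))) := by
  obtain ⟨c0, c1, c2⟩ := h.cont
  have cq := qw_continuous
  have hU : ∀ t r, 0 < r → HasFDerivAt (fun p : ℝ × ℝ => Fr p + 4 * (F p / p.2))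
      (par (Ftr (t, r) + 4 * (Ft (t, r) / r))
        (Frr (t, r) + 4 * (Fr (t, r) / r - F (t, r) / r ^ 2))) (t, r) := fun t r hr => by
    have h1 : HasFDerivAt (fun p : ℝ × ℝ => (p.2)⁻¹)
        ((-(r ^ 2)⁻¹) • ContinuousLinearMap.snd ℝ ℝ ℝ) (t, r) :=
      (hasDerivAt_inv hr.ne').comp_hasFDerivAt (t, r) hasFDerivAt_snd
    simp only [div_eq_mul_inv]
    refine ((h.hFr (t, r)).fun_add (((h.hF (t, r)).fun_mul h1).const_mul 4)).congr_fderiv ?_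
    ext
    · simp [par]; ring
    · simp [par]; ring
  refine ⟨hV.continuousOn, by fun_prop, by fun_prop, fun r _ => by simp [h0], fun t r hr => ?_,
    fun t r hr => ⟨_, _, qw_mul hr (h.hFt (t, r)), qw_mul hr (hU t r hr), ?_, ?_⟩⟩
  · exact (hasDerivAt_fst (h.hF (t, r))).const_mul (qw r)
  · simp only [par_apply, h.pde t r hr]
    field_simp
    ring
  · simp only [par_apply]
    field_simp
    ring

end

theorem rescH_V6 {l : ℝ} (hl : 0 < l) (x : E6) : rescH l V6 x = Vp l ‖x‖ := by
  rw [rescH, V6, W6, Vp, bk, norm_smul, norm_inv, Real.norm_of_nonneg hl.le, inv_pow, div_eq_inv_mul ‖x‖]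
  ring

theorem Vmulti_eq {J : ℕ} {lam : Fin J → ℝ} (hl : ∀ j, 0 < lam j) (x : E6) :
    Vmulti lam x = VJ lam ‖x‖ :=
  Finset.sum_congr rfl fun j _ => rescH_V6 (hl j) x

theorem LW6_eq (x : E6) : LW6 x = 2 * (2 * bk 1 ‖x‖ - 1) * bk 1 ‖x‖ ^ 2 := by
  have hp : 1 + ‖x‖ ^ 2 / 24 ≠ 0 := by positivity
  have hg : HasDerivAt (fun y : ℝ => ((1 + y / 24) ^ 2)⁻¹)
      (-(2 * (1 + ‖x‖ ^ 2 / 24) * (1 / 24)) / ((1 + ‖x‖ ^ 2 / 24) ^ 2) ^ 2) (‖x‖ ^ 2) := by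
    have h0 : HasDerivAt (fun y : ℝ => 1 + y / 24) (1 / 24) (‖x‖ ^ 2) :=
      ((hasDerivAt_id _).div_const 24).const_add 1
    refine ((h0.fun_pow 2).fun_inv (pow_ne_zero 2 hp)).congr_deriv ?_
    simp
  have h := hg.comp_hasFDerivAt x (hasStrictFDerivAt_norm_sq x).hasFDerivAt
  have hW : fderiv ℝ W6 x = _ := HasFDerivAt.fderiv h
  rw [LW6, hW, W6, bk]
  simp only [smul_apply, innerSL_apply_apply, real_inner_self_eq_norm_sq, smul_eq_mul,
    nsmul_eq_mul, div_one]
  field_simp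
  ring

/-- The radial profile of `ΛW` at scale `l`. -/
def lwr (l r : ℝ) : ℝ := (l ^ 3)⁻¹ * (2 * (2 * bk l r - 1) * bk l r ^ 2)

theorem rescL_LW6 {l : ℝ} (hl : 0 < l) (x : E6) : rescL l LW6 x = lwr l ‖x‖ := by
  have : bk 1 ‖l⁻¹ • x‖ = bk l ‖x‖ := by
    rw [bk, bk, norm_smul, norm_inv, Real.norm_of_nonneg hl.le]
    congr 4
    field_simp
  rw [lwr, rescL, LW6_eq, this]

theorem fderiv_fderiv_eq {f : E6 → ℝ} (hf : ContDiff ℝ 2 f) (x v : E6) {k : ℝ → ℝ} {a : ℝ}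
    (h1 : ∀ s, HasDerivAt (fun s : ℝ => f (x + s • v)) (k s) s) (h2 : HasDerivAt k a 0) :
    fderiv ℝ (fun y => fderiv ℝ f y v) x v = a := by
  have hl : ∀ s : ℝ, HasDerivAt (fun s : ℝ => x + s • v) v s := fun s => by
    simpa using ((hasDerivAt_id s).smul_const v).const_add x
  have h3 : ∀ s : ℝ, fderiv ℝ f (x + s • v) v = k s := fun s =>
    (((hf.differentiable two_ne_zero _).hasFDerivAt).comp_hasDerivAt s (hl s)).unique (h1 s)
  have h4 : Differentiable ℝ (fderiv ℝ f) :=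
    (hf.fderiv_right (m := 1) (by norm_num)).differentiable one_ne_zero
  have h5 : Differentiable ℝ (fun y => fderiv ℝ f y v) := fun y => (h4 y).clm_apply (by fun_prop)
  have h6 := ((h5 (x + (0 : ℝ) • v)).hasFDerivAt).comp_hasDerivAt 0 (hl 0)
  have h7 : ((fun y => fderiv ℝ f y v) ∘ fun s : ℝ => x + s • v) = k := by
    ext s
    exact h3 s
  rw [h7] at h6
  simpa using h6.unique h2

/-- The first basis vector. -/
def e0 : E6 := EuclideanSpace.single 0 1

theorem norm_e0 : ‖e0‖ = 1 := by simp [e0]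

theorem norm_smul_e0_add {r s : ℝ} {i : Fin 6} (hi : i ≠ 0) :
    ‖r • e0 + s • (EuclideanSpace.single i 1 : E6)‖ = √(r ^ 2 + s ^ 2) := by
  have h : inner ℝ (r • e0) (s • (EuclideanSpace.single i 1 : E6)) = 0 := by
    rw [inner_smul_left, inner_smul_right, e0, EuclideanSpace.inner_single_left]
    simp [hi.symm]
  rw [norm_add_eq_sqrt_iff_real_inner_eq_zero.2 h, norm_smul, norm_smul, norm_e0]
  simp [pow_two]

theorem lap6_radial {f : E6 → ℝ} (hf : ContDiff ℝ 2 f) {k k' : ℝ → ℝ} {k'' : ℝ}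
    (hfe : ∀ s : ℝ, f (s • e0) = k s) (hfr : ∀ x, f x = k ‖x‖)
    (h1 : ∀ s, HasDerivAt k (k' s) s) {r : ℝ} (hr : 0 < r) (h2 : HasDerivAt k' k'' r)  :
    lap6 f (r • e0) = k'' + 5 / r * k' r := by
  have hd0 : fderiv ℝ (fun y => fderiv ℝ f y (EuclideanSpace.single 0 1)) (r • e0)
      (EuclideanSpace.single 0 1) = k'' := by
    refine fderiv_fderiv_eq hf _ _ (k := fun s => k' (r + s)) (fun s => ?_) ?_
    · have : (fun s : ℝ => f (r • e0 + s • (EuclideanSpace.single 0 1 : E6))) = fun s => k (r + s) := by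
        ext s
        rw [← hfe, add_smul, e0]
      rw [this]
      exact (h1 (r + s)).comp_const_add r s
    · exact HasDerivAt.comp_const_add r 0 (by simpa using h2)
  have hdi : ∀ i : Fin 6, i ≠ 0 → fderiv ℝ (fun y => fderiv ℝ f y (EuclideanSpace.single i 1))
      (r • e0) (EuclideanSpace.single i 1) = k' r / r := fun i hi => by
    have hq : ∀ s : ℝ, HasDerivAt (fun s => √(r ^ 2 + s ^ 2)) (s / √(r ^ 2 + s ^ 2)) s := fun s => by
      have h3 : HasDerivAt (fun s : ℝ => r ^ 2 + s ^ 2) (2 * s) s := by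
        simpa using ((hasDerivAt_id s).pow 2).const_add (r ^ 2)
      refine (h3.sqrt (by positivity)).congr_deriv ?_
      field_simp
    have h0 : √(r ^ 2 + 0 ^ 2) = r := by simp [Real.sqrt_sq hr.le]
    refine fderiv_fderiv_eq hf _ _ (k := fun s => k' √(r ^ 2 + s ^ 2) / √(r ^ 2 + s ^ 2) * s)
      (fun s => ?_) ?_
    · have : (fun s : ℝ => f (r • e0 + s • (EuclideanSpace.single i 1 : E6))) =
          fun s => k √(r ^ 2 + s ^ 2) := by
        ext s
        rw [hfr, norm_smul_e0_add hi]
      rw [this]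
      refine ((h1 _).comp s (hq s)).congr_deriv ?_
      ring
    · have h3 : HasDerivAt (fun s => k' √(r ^ 2 + s ^ 2)) _ 0 :=
        HasDerivAt.comp (h₂ := k') 0 (by rw [h0]; exact h2) (hq 0)
      refine ((h3.fun_div (hq 0) (by rw [h0]; exact hr.ne')).fun_mul (hasDerivAt_id 0)).congr_deriv ?_
      simp [Real.sqrt_sq hr.le]
  rw [lap6, Fin.sum_univ_succ, hd0, Finset.sum_congr rfl fun i _ => hdi (Fin.succ i) (Fin.succ_ne_zero i)]
  simp
  ring

theorem norm_gradient_radial {f : E6 → ℝ} {k : ℝ → ℝ} (hfr : ∀ x, f x = k ‖x‖) {x : E6} (hx : x ≠ 0)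
    {a : ℝ} (h : HasDerivAt k a ‖x‖) : ‖gradient f x‖ = |a| := by
  have hn : DifferentiableAt ℝ (fun x : E6 => ‖x‖) x := differentiableAt_id.norm ℝ hx
  have h1 : HasFDerivAt f (a • fderiv ℝ (fun x : E6 => ‖x‖) x) x := by
    have := h.comp_hasFDerivAt x hn.hasFDerivAt
    rwa [show k ∘ (fun x : E6 => ‖x‖) = f from funext fun y => (hfr y).symm] at this
  rw [gradient, LinearIsometryEquiv.norm_map, h1.fderiv, norm_smul]
  have h2 := norm_fderiv_norm (E := E6) hn
  rw [h2, mul_one, Real.norm_eq_abs]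

theorem IsRadSolOf.exists_rad {J : ℕ} {lam : Fin J → ℝ} (hl : ∀ j, 0 < lam j) {u : ℝ → E6 → ℝ}
    (h : IsRadSolOf (Vmulti lam) u) : ∃ F Ft Fr Ftt Ftr Frr : ℝ × ℝ → ℝ,
      Rad (VJ lam) F Ft Fr Ftt Ftr Frr ∧ (∀ t x, dtu u t x = Ft (t, ‖x‖)) ∧
      ∀ t x, x ≠ 0 → eDensity u t x = Ft (t, ‖x‖) ^ 2 + Fr (t, ‖x‖) ^ 2 := by
  obtain ⟨hc, hrad, hpde, -⟩ := h
  have hF : ContDiff ℝ 2 (fun p : ℝ × ℝ => u p.1 (p.2 • e0)) :=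
    hc.comp (f := fun p : ℝ × ℝ => (p.1, p.2 • e0)) (by fun_prop)
  obtain ⟨Ft, Fr, Ftt, Ftr, Frr, h1, h2, h3⟩ := exists_partials hF
  have hu : ∀ t x, u t x = u t (‖x‖ • e0) := fun t x => hrad _ _ _ (by simp [norm_smul, norm_e0])
  have hdt : ∀ t x, dtu u t x = Ft (t, ‖x‖) := fun t x => by
    rw [dtu]
    simp only [hu _ x]
    exact (hasDerivAt_fst (h1 (t, ‖x‖))).deriv
  refine ⟨_, Ft, Fr, Ftt, Ftr, Frr, ⟨h1, h2, h3, fun t r hr => ?_⟩, hdt, fun t x hx => ?_⟩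
  · have hr' : ‖r • e0‖ = r := by rw [norm_smul, norm_e0, mul_one, Real.norm_of_nonneg hr.le]
    have h4 := hpde t (r • e0)
    have h5 : dttu u t (r • e0) = Ftt (t, r) := by
      rw [dttu]
      simp only [hdt, hr']
      exact (hasDerivAt_fst (h2 (t, r))).deriv
    have h6 := lap6_radial (f := u t) (hc.comp (f := fun x : E6 => (t, x)) (by fun_prop))
      (fun s => rfl) (hu t) (fun s => hasDerivAt_snd (h1 (t, s))) hr (hasDerivAt_snd (h3 (t, r)))
    rw [h5, h6, Vmulti_eq hl, hr'] at h4
    simp only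
    linarith
  · rw [eDensity, hdt, norm_gradient_radial (hu t) hx (hasDerivAt_snd (h1 (t, ‖x‖))), sq_abs]

theorem integral_inv_sq_le {b : ℝ} (hb : 1 ≤ b) : (∫ r in (1:ℝ)..b, (r ^ 2)⁻¹) ≤ 1 := by
  have h0 : ∀ r ∈ uIcc 1 b, r ≠ 0 := fun r hr => by
    rw [uIcc_of_le hb] at hr
    linarith [hr.1]
  have h : ∀ r ∈ uIcc 1 b, HasDerivAt (fun r : ℝ => -r⁻¹) ((r ^ 2)⁻¹) r := fun r hr => by
    simpa using (hasDerivAt_inv (h0 r hr)).fun_neg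
  rw [intervalIntegral.integral_eq_sub_of_hasDerivAt h]
  · have : 0 ≤ b⁻¹ := by positivity
    linarith
  · exact ContinuousOn.intervalIntegrable
      ((continuousOn_id.pow 2).inv₀ fun r hr => pow_ne_zero 2 (h0 r hr))

theorem interval_le_Ioi {f : ℝ → ℝ} {R a b : ℝ} (hf : IntegrableOn f (Ioi R)) (h0 : ∀ r, 0 ≤ f r)
    (hR : R ≤ a) (hab : a ≤ b) : (∫ r in a..b, f r) ≤ ∫ r in Ioi R, f r := by
  rw [intervalIntegral.integral_of_le hab]
  exact setIntegral_mono_set hf (Eventually.of_forall h0)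
    (Ioc_subset_Ioi_self.trans (Ioi_subset_Ioi hR)).eventuallyLE

section

variable {V : ℝ → ℝ} {F Ft Fr Ftt Ftr Frr : ℝ × ℝ → ℝ}

/-- The conjugated energy density. -/
def eden (Ft Fr : ℝ × ℝ → ℝ) (t r : ℝ) : ℝ := (qw r * Ft (t, r)) ^ 2 + (qw r * Fr (t, r)) ^ 2

theorem eden_nonneg (Ft Fr : ℝ × ℝ → ℝ) (t r : ℝ) : 0 ≤ eden Ft Fr t r := by
  unfold eden; positivity

theorem Rad.eden_continuous (h : Rad V F Ft Fr Ftt Ftr Frr) (t : ℝ) : Continuous (eden Ft Fr t) := by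
  obtain ⟨-, c1, c2⟩ := h.cont
  have := qw_continuous
  unfold eden
  fun_prop

/-- A radial function of finite energy is bounded away from the origin. -/
theorem Rad.bounded (h : Rad V F Ft Fr Ftt Ftr Frr) (hi : IntegrableOn (eden Ft Fr 0) (Ioi 0)) :
    ∃ A, ∀ r, 1 ≤ r → |F (0, r)| ≤ A := by
  obtain ⟨c0, c1, c2⟩ := h.cont
  refine ⟨|F (0, 1)| + ((∫ r in Ioi 0, eden Ft Fr 0 r) + 1), fun r hr => ?_⟩
  have h1 : (∫ s in (1:ℝ)..r, Fr (0, s)) = F (0, r) - F (0, 1) :=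
    intervalIntegral.integral_eq_sub_of_hasDerivAt (fun s _ => hasDerivAt_snd (h.hF (0, s)))
      (Continuous.intervalIntegrable (by fun_prop) _ _)
  have ci : ContinuousOn (fun s : ℝ => (s ^ 2)⁻¹) (uIcc 1 r) := by
    refine (continuousOn_id.pow 2).inv₀ fun s hs => ?_
    rw [uIcc_of_le hr] at hs
    exact pow_ne_zero 2 (show s ≠ 0 by linarith [hs.1])
  have h2 : |∫ s in (1:ℝ)..r, Fr (0, s)| ≤ ∫ s in (1:ℝ)..r, (eden Ft Fr 0 s + (s ^ 2)⁻¹) := by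
    refine (intervalIntegral.abs_integral_le_integral_abs hr).trans
      (intervalIntegral.integral_mono_on hr ?_ ?_ fun s hs => ?_)
    · exact Continuous.intervalIntegrable (by fun_prop) _ _
    · exact ((h.eden_continuous 0).continuousOn.add ci).intervalIntegrable
    · have hs1 : 1 ≤ s := hs.1
      have e1 : eden Ft Fr 0 s ≥ s ^ 5 * Fr (0, s) ^ 2 := by
        unfold eden
        rw [mul_pow, mul_pow, qw_sq (by linarith)]
        have : 0 ≤ s ^ 5 * Ft (0, s) ^ 2 := by positivity
        linarith
      have e2 : s ^ 2 * Fr (0, s) ^ 2 ≤ s ^ 5 * Fr (0, s) ^ 2 := by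
        gcongr
        norm_num
      have e3 : 0 ≤ (s * |Fr (0, s)| - s⁻¹) ^ 2 := sq_nonneg _
      have e4 : (s * |Fr (0, s)| - s⁻¹) ^ 2 = s ^ 2 * Fr (0, s) ^ 2 - 2 * |Fr (0, s)| + (s ^ 2)⁻¹ := by
        rw [← sq_abs (Fr (0, s))]
        field_simp
        ring
      have := abs_nonneg (Fr (0, s))
      linarith
  rw [intervalIntegral.integral_add ((h.eden_continuous 0).intervalIntegrable _ _)
    ci.intervalIntegrable, h1] at h2
  have h3 := interval_le_Ioi hi (eden_nonneg Ft Fr 0) zero_le_one hr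
  have h4 := integral_inv_sq_le hr
  have h5 := abs_sub_abs_le_abs_sub (F (0, r)) (F (0, 1))
  linarith

/-- The energy outside the light cone is finite. -/
theorem Rad.eden_int (h : Rad V F Ft Fr Ftt Ftr Frr) (hV : Continuous V) {B : ℝ}
    (hB : ∀ r, |V r| ≤ B) {c : ℝ} (hc : ∀ r, 1 ≤ r → |V r| * r ^ 4 ≤ c)
    (hi : IntegrableOn (eden Ft Fr 0) (Ioi 0)) {T : ℝ} (hT : 0 ≤ T) :
    IntegrableOn (eden Ft Fr T) (Ioi T) := by
  obtain ⟨A, hA⟩ := h.bounded hi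
  obtain ⟨c0, c1, c2⟩ := h.cont
  have cq := qw_continuous
  have hB0 : 0 ≤ B := (abs_nonneg _).trans (hB 0)
  have hs : ∀ M, 1 ≤ M → ∀ a, 1 ≤ a → a ≤ M →
      (∫ r in a..M, (-(V r * (qw r * F (0, r)))) ^ 2) ≤ c ^ 2 * A ^ 2 := fun M hM a ha haM => by
    have cs : Continuous fun r => (-(V r * (qw r * F (0, r)))) ^ 2 := by fun_prop
    have ci : ContinuousOn (fun s : ℝ => c ^ 2 * A ^ 2 * (s ^ 2)⁻¹) (uIcc 1 M) := by
      refine continuousOn_const.mul ((continuousOn_id.pow 2).inv₀ fun s hs => ?_)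
      rw [uIcc_of_le hM] at hs
      exact pow_ne_zero 2 (show s ≠ 0 by linarith [hs.1])
    calc (∫ r in a..M, (-(V r * (qw r * F (0, r)))) ^ 2)
        ≤ ∫ r in (1:ℝ)..M, (-(V r * (qw r * F (0, r)))) ^ 2 :=
          intervalIntegral.integral_mono_interval ha haM le_rfl
            (Eventually.of_forall fun r => sq_nonneg _) (cs.intervalIntegrable _ _)
      _ ≤ ∫ r in (1:ℝ)..M, c ^ 2 * A ^ 2 * (r ^ 2)⁻¹ := by
          refine intervalIntegral.integral_mono_on hM (cs.intervalIntegrable _ _)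
            ci.intervalIntegrable fun r hr => ?_
          have hr1 : 1 ≤ r := hr.1
          have hr0 : 0 < r := by linarith
          have e1 : |V r| * r ^ 4 * |F (0, r)| ≤ c * A :=
            mul_le_mul (hc r hr1) (hA r hr1) (abs_nonneg _) ((by positivity : (0:ℝ) ≤ _).trans (hc r hr1))
          have e2 : (V r * r ^ 4 * F (0, r)) ^ 2 ≤ c ^ 2 * A ^ 2 := by
            rw [← mul_pow]
            refine sq_le_sq' ?_ ?_ <;>
            · have := abs_le.1 (show |V r * r ^ 4 * F (0, r)| ≤ c * A by
                rw [abs_mul, abs_mul, abs_of_pos (pow_pos hr0 4)]; exact e1)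
              linarith [this.1, this.2]
          have e3 : (-(V r * (qw r * F (0, r)))) ^ 2 = (V r * r ^ 4 * F (0, r)) ^ 2 * (r ^ 3)⁻¹ := by
            rw [neg_sq, mul_pow, mul_pow, qw_sq hr0.le]
            field_simp
          rw [e3]
          gcongr
          norm_num
      _ ≤ c ^ 2 * A ^ 2 := by
          rw [intervalIntegral.integral_const_mul]
          exact mul_le_of_le_one_right (by positivity) (integral_inv_sq_le hM)
  have ce := h.eden_continuous T
  have hfar : IntegrableOn (eden Ft Fr T) (Ioi (1 + T)) := by
    refine integrableOn_Ioi_of_intervalIntegral_norm_bounded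
      (((∫ r in Ioi 0, eden Ft Fr 0 r) + c ^ 2 * A ^ 2 * (T + 1) ^ 2) *
        exp (2 * (∫ t in (0:ℝ)..T, t * B) + 1)) (1 + T) (fun b => ce.integrableOn_Ioc) tendsto_id ?_
    filter_upwards [eventually_ge_atTop (1 + T)] with b hb
    have hw := (h.wave hV).energy_bound (R := 1) (M := b + T) (T := T) one_pos hT
      (by linarith) (ω := fun _ => B) (θ := fun _ => (T + 1)⁻¹) (S2 := c ^ 2 * A ^ 2 * (T + 1) ^ 2)
      (N := ∫ r in Ioi 0, eden Ft Fr 0 r)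
      continuous_const continuous_const (fun _ => hB0) (fun _ => by positivity)
      (by positivity) (fun t _ r _ => hB r) (fun t ht => ?_) le_rfl ?_ ?_
    · have := hw.1 T ⟨hT, le_rfl⟩
      simp only [id, Real.norm_of_nonneg (eden_nonneg Ft Fr T _)]
      rwa [add_sub_cancel_right] at this
    · refine (hs (b + T - t) (by linarith [ht.2]) (1 + t) (by linarith [ht.1])
        (by linarith [ht.2])).trans (le_of_eq ?_)
      field_simp
    · rw [intervalIntegral.integral_const, smul_eq_mul, sub_zero, ← div_eq_mul_inv]
      exact (div_le_one (by linarith)).2 (by linarith)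
    · exact interval_le_Ioi hi (eden_nonneg Ft Fr 0) zero_le_one (by linarith)
  rw [← Ioc_union_Ioi_eq_Ioi (show T ≤ 1 + T by linarith)]
  exact ce.integrableOn_Ioc.union hfar

end

/-- Passing from `X = r^{5/2} ∂_r u` to `U = r^{-3/2} ∂_r (r⁴ u)` loses only a boundary term. -/
theorem hardy_boundary {f X : ℝ → ℝ} (hX : ContinuousOn X (Ioi 0))
    (hf : ∀ r, 0 < r → HasDerivAt f (X r + 5 / 2 * (f r / r)) r) {b₀ K : ℝ} (hb₀ : 0 < b₀)
    (hK : ∀ M, b₀ ≤ M → (∫ r in b₀..M, (X r ^ 2 + (X r + 4 * (f r / r)) ^ 2)) ≤ K) {a b ε : ℝ}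
    (ha : 0 < a) (hab : a ≤ b) (hε : 0 < ε) : ∃ M, b ≤ M ∧
      (∫ r in a..b, (X r + 4 * (f r / r)) ^ 2) ≤ (∫ r in a..M, X r ^ 2) + ε := by
  have cf : ContinuousOn f (Ioi 0) := fun r hr => (hf r hr).continuousAt.continuousWithinAt
  have cq : ContinuousOn (fun r => f r / r) (Ioi 0) :=
    cf.div continuousOn_id fun r hr => (mem_Ioi.1 hr).ne'
  have hsub : ∀ {a b : ℝ}, 0 < a → a ≤ b → uIcc a b ⊆ Ioi 0 := fun {a b} ha hab r hr => by
    rw [uIcc_of_le hab] at hr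
    exact lt_of_lt_of_le ha hr.1
  have cU : ContinuousOn (fun r => (X r + 4 * (f r / r)) ^ 2) (Ioi 0) := by fun_prop
  have cX : ContinuousOn (fun r => X r ^ 2) (Ioi 0) := by fun_prop
  obtain ⟨M, hbM, hM⟩ : ∃ M, b ≤ M ∧ 4 * (f M ^ 2 / M) ≤ ε := by
    by_contra! hcon
    set m := max b b₀
    have hm : 0 < m := lt_of_lt_of_le hb₀ (le_max_right _ _)
    obtain ⟨M, hM1, hM2⟩ : ∃ M, m ≤ M ∧ K < 2 * ε * Real.log (M / m) := by
      have h1 : Tendsto (fun M => 2 * ε * Real.log (M / m)) atTop atTop :=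
        (Real.tendsto_log_atTop.comp (tendsto_id.atTop_div_const hm)).const_mul_atTop (by positivity)
      exact ((eventually_ge_atTop m).and (h1.eventually_gt_atTop K)).exists
    have ci : ContinuousOn (fun r : ℝ => 2 * ε * r⁻¹) (uIcc m M) :=
      continuousOn_const.mul (continuousOn_id.inv₀ fun r hr => (hsub hm hM1 hr).ne')
    have h2 : (∫ r in m..M, 2 * ε * r⁻¹) ≤ ∫ r in m..M, (X r ^ 2 + (X r + 4 * (f r / r)) ^ 2) := by
      refine intervalIntegral.integral_mono_on hM1 ci.intervalIntegrable
        ((cX.add cU).mono (hsub hm hM1)).intervalIntegrable fun r hr => ?_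
      have hr0 : 0 < r := lt_of_lt_of_le hm hr.1
      have h3 := (hcon r ((le_max_left _ _).trans hr.1)).le
      have h4 : 16 * (f r / r) ^ 2 ≤ 2 * (X r ^ 2 + (X r + 4 * (f r / r)) ^ 2) := by
        nlinarith [sq_nonneg (2 * X r + 4 * (f r / r))]
      have h5 : 16 * (f r / r) ^ 2 = 4 * (4 * (f r ^ 2 / r)) * r⁻¹ := by
        field_simp
        ring
      have h6 : 4 * ε * r⁻¹ ≤ 4 * (4 * (f r ^ 2 / r)) * r⁻¹ := by gcongr
      linarith
    rw [intervalIntegral.integral_const_mul, integral_inv_of_pos hm (hm.trans_le hM1)] at h2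
    have h3 : (∫ r in m..M, (X r ^ 2 + (X r + 4 * (f r / r)) ^ 2)) ≤
        ∫ r in b₀..M, (X r ^ 2 + (X r + 4 * (f r / r)) ^ 2) :=
      intervalIntegral.integral_mono_interval (le_max_right _ _) hM1 le_rfl
        (Eventually.of_forall fun r => by positivity)
        ((cX.add cU).mono (hsub hb₀ ((le_max_right _ _).trans hM1))).intervalIntegrable
    linarith [hK M ((le_max_right _ _).trans hM1)]
  have haM := hab.trans hbM
  refine ⟨M, hbM, ?_⟩
  have hd : ∀ r ∈ uIcc a M, HasDerivAt (fun r => 4 * (f r ^ 2 / r))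
      ((X r + 4 * (f r / r)) ^ 2 - X r ^ 2) r := fun r hr => by
    have hr0 : r ≠ 0 := (hsub ha haM hr).ne'
    refine ((((hf r (hsub ha haM hr)).fun_pow 2).fun_div (hasDerivAt_id r) hr0).const_mul
      4).congr_deriv ?_
    simp only [id]
    field_simp
    ring
  have iU := (cU.mono (hsub ha haM)).intervalIntegrable (μ := volume)
  have iX := (cX.mono (hsub ha haM)).intervalIntegrable (μ := volume)
  have h1 := intervalIntegral.integral_eq_sub_of_hasDerivAt hd (iU.sub iX)
  rw [intervalIntegral.integral_sub iU iX] at h1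
  have h2 : (∫ r in a..b, (X r + 4 * (f r / r)) ^ 2) ≤ ∫ r in a..M, (X r + 4 * (f r / r)) ^ 2 :=
    intervalIntegral.integral_mono_interval le_rfl hab hbM
      (Eventually.of_forall fun r => sq_nonneg _) iU
  have h3 : 0 ≤ 4 * (f a ^ 2 / a) := by positivity
  linarith

theorem abs_VJ_le {J : ℕ} {lam : Fin J → ℝ} (r : ℝ) : |VJ lam r| ≤ ∑ k, 2 * (lam k ^ 2)⁻¹ := by
  refine (Finset.abs_sum_le_sum_abs _ _).trans (Finset.sum_le_sum fun k _ => ?_)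
  rw [abs_Vp]
  exact mul_le_of_le_one_right (by positivity) (pow_le_one₀ (bk_pos _ r).le (bk_le_one _ r))

theorem abs_VJ_mul_le {J : ℕ} {lam : Fin J → ℝ} (hl : ∀ j, 0 < lam j) (r : ℝ) :
    |VJ lam r| * r ^ 4 ≤ ∑ k, 2 * (lam k ^ 2)⁻¹ * (24 * lam k ^ 2) ^ 2 := by
  calc |VJ lam r| * r ^ 4 ≤ (∑ k, |Vp (lam k) r|) * r ^ 4 := by
        gcongr
        exact Finset.abs_sum_le_sum_abs _ _
    _ = ∑ k, 2 * (lam k ^ 2)⁻¹ * (r ^ 2 * bk (lam k) r) ^ 2 := by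
        rw [Finset.sum_mul]
        refine Finset.sum_congr rfl fun k _ => ?_
        rw [abs_Vp]
        ring
    _ ≤ _ := by
        refine Finset.sum_le_sum fun k _ => ?_
        have := bk_pos (lam k) r
        exact mul_le_mul_of_nonneg_left (pow_le_pow_left₀ (by positivity) (sq_mul_bk_le (hl k) r) 2)
          (by positivity)

section

variable {V : ℝ → ℝ} {F Ft Fr Ftt Ftr Frr : ℝ × ℝ → ℝ}

theorem Rad.L2_zero (h : Rad V F Ft Fr Ftt Ftr Frr) (hi : IntegrableOn (eden Ft Fr 0) (Ioi 0)) :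
    L2 (fun r => qw r * Ft (0, r)) 0 := by
  obtain ⟨-, c1, -⟩ := h.cont
  have := qw_continuous
  have c : Continuous (fun r => qw r * Ft (0, r)) := by fun_prop
  refine ⟨c.continuousOn, hi.mono' (c.pow 2).aestronglyMeasurable (Eventually.of_forall fun r => ?_)⟩
  rw [Real.norm_of_nonneg (sq_nonneg _), eden]
  linarith [sq_nonneg (qw r * Fr (0, r))]

/-- Control of the exterior energy in the odd formulation by the exterior energy. -/
theorem Rad.top (h : Rad V F Ft Fr Ftt Ftr Frr) (hV : Continuous V) {B : ℝ} (hB : ∀ r, |V r| ≤ B)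
    (h0 : ∀ r, F (0, r) = 0) (hw : L2 (fun r => qw r * Ft (0, r)) 0) {T : ℝ} (hT : 0 ≤ T)
    (hi : IntegrableOn (eden Ft Fr T) (Ioi T)) {a b : ℝ} (hTa : T ≤ a) (ha : 0 < a) (hab : a ≤ b) :
    (∫ r in a..b, ((qw r * Ft (T, r)) ^ 2 + (qw r * (Fr (T, r) + 4 * (F (T, r) / r))) ^ 2)) ≤
      ∫ r in Ioi T, eden Ft Fr T r := by
  obtain ⟨c0, c1, c2⟩ := h.cont
  have cq := qw_continuous
  have hFr0 : ∀ r, Fr (0, r) = 0 := fun r => by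
    have h1 := hasDerivAt_snd (h.hF (0, r))
    simp only [h0] at h1
    exact h1.unique (hasDerivAt_const r 0)
  have hsub : ∀ {a b : ℝ}, 0 < a → a ≤ b → uIcc a b ⊆ Ioi 0 := fun {a b} ha hab r hr => by
    rw [uIcc_of_le hab] at hr
    exact lt_of_lt_of_le ha hr.1
  set U : ℝ → ℝ := fun r => qw r * (Fr (T, r) + 4 * (F (T, r) / r)) with hU
  have hUe : ∀ r, qw r * Fr (T, r) + 4 * (qw r * F (T, r) / r) = U r := fun r => by
    simp only [hU]
    ring
  have cU : ContinuousOn U (Ioi 0) := by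
    have : ContinuousOn (fun r => F (T, r) / r) (Ioi 0) :=
      ContinuousOn.div (by fun_prop) continuousOn_id fun r hr => (mem_Ioi.1 hr).ne'
    fun_prop
  have cX : Continuous fun r => (qw r * Fr (T, r)) ^ 2 := by fun_prop
  have cz : Continuous fun r => (qw r * Ft (T, r)) ^ 2 := by fun_prop
  set N := nr (fun r => qw r * Ft (0, r)) 0 ^ 2
  have hb : ∀ M, 1 + T ≤ M → (∫ r in (1 + T)..M, ((qw r * Fr (T, r)) ^ 2 +
      (qw r * Fr (T, r) + 4 * (qw r * F (T, r) / r)) ^ 2)) ≤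
      (∫ r in Ioi T, eden Ft Fr T r) + (N + 0) * exp (2 * (∫ t in (0:ℝ)..T, t * B) + 1) :=
    fun M hM => by
      have hwo := (h.wave_odd hV h0).energy_bound (R := 1) (M := M + T) (T := T) one_pos hT
        (by linarith) (ω := fun _ => B) (θ := fun _ => 0) (S2 := 0) (N := N)
        continuous_const continuous_const (fun _ => (abs_nonneg _).trans (hB 0)) (fun _ => le_rfl)
        le_rfl (fun t _ r _ => hB r) (fun t ht => by simp) le_rfl (by simp) (by
          simp only [h0, hFr0]
          simpa using (hw.mono zero_le_one).interval_le (show 1 ≤ M + T by linarith) |>.trans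
            (pow_le_pow_left₀ (nr_nonneg _ _) (hw.nr_mono zero_le_one) 2))
      have h1 := hwo.1 T ⟨hT, le_rfl⟩
      rw [add_sub_cancel_right] at h1
      have h2 := interval_le_Ioi hi (eden_nonneg Ft Fr T) (show T ≤ 1 + T by linarith) hM
      have iX := cX.intervalIntegrable (μ := volume) (1 + T) M
      have iU : IntervalIntegrable (fun r => (qw r * Ft (T, r)) ^ 2 + U r ^ 2) volume (1 + T) M :=
        ((cz.continuousOn.add (cU.pow 2)).mono (hsub (by linarith) hM)).intervalIntegrable
      refine le_trans ?_ (add_le_add h2 h1)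
      rw [← intervalIntegral.integral_add ((h.eden_continuous T).intervalIntegrable _ _) iU]
      refine intervalIntegral.integral_mono_on hM ?_
        (((h.eden_continuous T).intervalIntegrable _ _).add iU) fun r _ => ?_
      · simp only [hUe]
        exact ((cX.continuousOn.add (cU.pow 2)).mono (hsub (by linarith) hM)).intervalIntegrable
      · rw [hUe, eden]
        have : 0 ≤ (qw r * Ft (T, r)) ^ 2 := sq_nonneg _
        linarith
  have hf : ∀ r, 0 < r → HasDerivAt (fun r => qw r * F (T, r))
      (qw r * Fr (T, r) + 5 / 2 * (qw r * F (T, r) / r)) r := fun r hr => by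
    refine ((qw_deriv hr).mul (hasDerivAt_snd (h.hF (T, r)))).congr_deriv ?_
    ring
  refine le_of_forall_pos_le_add fun ε hε => ?_
  obtain ⟨M, hbM, hM⟩ := hardy_boundary (f := fun r => qw r * F (T, r))
    (X := fun r => qw r * Fr (T, r)) (by fun_prop) hf (by linarith) hb ha hab hε
  simp only [hUe] at hM
  have iU : IntervalIntegrable (fun r => U r ^ 2) volume a b :=
    ((cU.pow 2).mono (hsub ha hab)).intervalIntegrable
  have h0 : (∫ r in a..b, ((qw r * Ft (T, r)) ^ 2 + U r ^ 2)) =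
      (∫ r in a..b, (qw r * Ft (T, r)) ^ 2) + ∫ r in a..b, U r ^ 2 :=
    intervalIntegral.integral_add (cz.intervalIntegrable _ _) iU
  have h1 := interval_le_Ioi hi (eden_nonneg Ft Fr T) hTa (hab.trans hbM)
  have h2 : (∫ r in a..M, eden Ft Fr T r) =
      (∫ r in a..M, (qw r * Ft (T, r)) ^ 2) + ∫ r in a..M, (qw r * Fr (T, r)) ^ 2 :=
    intervalIntegral.integral_add (cz.intervalIntegrable _ _) (cX.intervalIntegrable _ _)
  have h3 : (∫ r in a..b, (qw r * Ft (T, r)) ^ 2) ≤ ∫ r in a..M, (qw r * Ft (T, r)) ^ 2 :=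
    intervalIntegral.integral_mono_interval le_rfl hab hbM
      (Eventually.of_forall fun r => sq_nonneg _) (cz.intervalIntegrable _ _)
  linarith

end

theorem eden_reflect (Ft Fr : ℝ × ℝ → ℝ) (t : ℝ) :
    eden (fun p => -Ft (-p.1, p.2)) (fun p => Fr (-p.1, p.2)) t = eden Ft Fr (-t) := by
  ext r
  simp [eden]

theorem eden_half_sub_le {Ft Fr Gt Gr : ℝ × ℝ → ℝ} (t r : ℝ) :
    eden (fun p => (Ft p - Gt p) / 2) (fun p => (Fr p - Gr p) / 2) t r ≤
      (eden Ft Fr t r + eden Gt Gr t r) / 2 := by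
  unfold eden
  nlinarith [sq_nonneg (qw r * (Ft (t, r) + Gt (t, r))), sq_nonneg (qw r * (Fr (t, r) + Gr (t, r)))]

/-- The channel estimate for radial solutions, in terms of the radial variable. -/
theorem channel_radial (J : ℕ) : ∃ γ C : ℝ, 0 < γ ∧ 0 < C ∧ ∀ {lam : Fin J → ℝ} {g : ℝ}
    {F Ft Fr Ftt Ftr Frr : ℝ × ℝ → ℝ} {Ep Em : ℝ}, (∀ j, 0 < lam j) →
    (∀ i j, i ≤ j → lam j ≤ lam i) → 0 ≤ g → (∀ i j, i < j → lam j ≤ g * lam i) → g ≤ γ →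
    Rad (VJ lam) F Ft Fr Ftt Ftr Frr → IntegrableOn (eden Ft Fr 0) (Ioi 0) →
    Tendsto (fun t => ∫ r in Ioi |t|, eden Ft Fr t r) atTop (𝓝 Ep) →
    Tendsto (fun t => ∫ r in Ioi |t|, eden Ft Fr t r) atBot (𝓝 Em) → ∀ η, 0 < η →
    ∃ c, nr (fun r => qw r * Ft (0, r) - PhiJ lam c r) 0 ^ 2 ≤
      C * ((Ep + Em) / 2 + g ^ 2 * nr (fun r => qw r * Ft (0, r)) 0 ^ 2 + η) := by
  obtain ⟨γ, C, hγ, hC, H⟩ := channel_multisoliton J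
  refine ⟨γ, C ^ 2, hγ, by positivity, ?_⟩
  intro lam g F Ft Fr Ftt Ftr Frr Ep Em hl hanti hg hrat hgγ h hi hEp hEm η hη
  have hV := VJ_continuous (lam := lam)
  have hB := abs_VJ_le (lam := lam)
  have hc : ∀ r : ℝ, 1 ≤ r → _ := fun r _ => abs_VJ_mul_le hl r
  have hw := h.L2_zero hi
  set N := nr (fun r => qw r * Ft (0, r)) 0 with hN
  have hN0 : 0 ≤ N := nr_nonneg _ _
  have hEp0 : 0 ≤ Ep := ge_of_tendsto' hEp fun t => integral_nonneg fun r => eden_nonneg _ _ _ _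
  have hEm0 : 0 ≤ Em := ge_of_tendsto' hEm fun t => integral_nonneg fun r => eden_nonneg _ _ _ _
  set D := (Ep + Em) / 2 + g ^ 2 * N ^ 2 + η with hD
  have hD0 : 0 < D := by positivity
  have hsum : Tendsto (fun t => ((∫ r in Ioi |t|, eden Ft Fr t r) +
      ∫ r in Ioi |(-t)|, eden Ft Fr (-t) r) / 2) atTop (𝓝 ((Ep + Em) / 2)) :=
    (hEp.add (hEm.comp tendsto_neg_atTop_atBot)).div_const 2
  have hbk : ∀ᶠ T in atTop, ∀ j, bk (lam j) T * N ^ 2 < η := by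
    refine eventually_all.2 fun j => ?_
    have h1 := (bk_tendsto (hl j)).mul_const (N ^ 2)
    rw [zero_mul] at h1
    exact h1.eventually_lt_const hη
  obtain ⟨T, ⟨hT, hTE⟩, hTb⟩ := (((eventually_ge_atTop (0:ℝ)).and
    (hsum.eventually_lt_const (show (Ep + Em) / 2 < (Ep + Em) / 2 + η by linarith))).and hbk).exists
  rw [abs_neg, abs_of_nonneg hT] at hTE
  have hk := h.reflect
  have ho := h.half_sub hk
  have hi1 := h.eden_int hV hB hc hi hT
  have hi2 := hk.eden_int hV hB hc (by rw [eden_reflect, neg_zero]; exact hi) hT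
  have hio : IntegrableOn (eden (fun p => (Ft p - -Ft (-p.1, p.2)) / 2)
      (fun p => (Fr p - Fr (-p.1, p.2)) / 2) T) (Ioi T) := by
    refine ((hi1.add hi2).div_const 2).mono' (ho.eden_continuous T).aestronglyMeasurable
      (Eventually.of_forall fun r => ?_)
    rw [Real.norm_of_nonneg (eden_nonneg _ _ _ _)]
    exact eden_half_sub_le T r
  have hle : (∫ r in Ioi T, eden (fun p => (Ft p - -Ft (-p.1, p.2)) / 2)
      (fun p => (Fr p - Fr (-p.1, p.2)) / 2) T r) ≤ D := by
    have h1 := integral_mono hio ((hi1.add hi2).div_const 2) fun r => eden_half_sub_le T r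
    have h2 : (∫ r in Ioi T, (eden Ft Fr T +
        eden (fun p => -Ft (-p.1, p.2)) (fun p => Fr (-p.1, p.2)) T) r / 2) =
        ((∫ r in Ioi T, eden Ft Fr T r) + ∫ r in Ioi T, eden Ft Fr (-T) r) / 2 := by
      rw [integral_div, integral_add' hi1 hi2, eden_reflect]
    rw [h2] at h1
    have : 0 ≤ g ^ 2 * N ^ 2 := by positivity
    linarith
  have h00 : ∀ r, (F (0, r) - F (-(0, r).1, (0, r).2)) / 2 = 0 := fun r => by simp
  have hz0 : (fun r => qw r * ((Ft (0, r) - -Ft (-(0, r).1, (0, r).2)) / 2)) =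
      fun r => qw r * Ft (0, r) := by
    ext r
    simp
  have hsq : √D ^ 2 = D := Real.sq_sqrt hD0.le
  have hM : Msol lam (fun p => qw p.2 * ((F p - F (-p.1, p.2)) / 2))
      (fun p => qw p.2 * ((Ft p - -Ft (-p.1, p.2)) / 2))
      (fun p => qw p.2 * ((Fr p - Fr (-p.1, p.2)) / 2 + 4 * ((F p - F (-p.1, p.2)) / 2 / p.2)))
      g T √D := by
    refine ⟨hl, hrat, ho.wave_odd hV h00, fun r _ => by simp, ?_, hT, Real.sqrt_pos.2 hD0, hg, ?_,
      fun j => ?_, fun a b hTa ha hab => ?_⟩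
    · rw [hz0]
      exact hw
    · rw [hz0]
      refine Real.le_sqrt_of_sq_le ?_
      rw [mul_pow]
      linarith
    · rw [hz0, hsq]
      have := hTb j
      have : 0 ≤ g ^ 2 * N ^ 2 := by positivity
      linarith
    · rw [hsq]
      exact (ho.top hV hB h00 (by rw [hz0]; exact hw) hT hio hTa ha hab).trans hle
  obtain ⟨c, hc⟩ := H hM hanti hgγ
  refine ⟨c, ?_⟩
  have hz0' : (fun r => qw r * ((Ft (0, r) - -Ft (-0, r)) / 2) - PhiJ lam c r) =
      fun r => qw r * Ft (0, r) - PhiJ lam c r := by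
    ext r
    simp
  simp only at hc
  rw [hz0'] at hc
  calc _ ≤ (C * √D) ^ 2 := pow_le_pow_left₀ (nr_nonneg _ _) hc 2
    _ = C ^ 2 * D := by rw [mul_pow, hsq]

/-- The area of the unit sphere of `ℝ⁶`. -/
def c6 : ℝ := 6 * (volume : Measure E6).real (Metric.ball 0 1)

theorem c6_pos : 0 < c6 := by
  have : 0 < (volume : Measure E6).real (Metric.ball 0 1) :=
    ENNReal.toReal_pos (Metric.measure_ball_pos _ _ one_pos).ne' measure_ball_lt_top.ne
  unfold c6
  positivity

theorem radial_integral (f : ℝ → ℝ) : (∫ x : E6, f ‖x‖) = c6 * ∫ r in Ioi 0, r ^ 5 * f r := by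
  rw [integral_fun_norm_addHaar]
  simp [c6, mul_assoc]

theorem radial_integral_mul (f g : ℝ → ℝ) : (∫ x : E6, f ‖x‖ * g ‖x‖) =
    c6 * ip (fun r => qw r * f r) (fun r => qw r * g r) 0 := by
  rw [radial_integral (fun r => f r * g r), ip]
  congr 1
  refine setIntegral_congr_fun measurableSet_Ioi fun r hr => ?_
  simp only [← qw_sq (mem_Ioi.1 hr).le]
  ring

theorem radial_integral_sq (f : ℝ → ℝ) : (∫ x : E6, f ‖x‖ ^ 2) =
    c6 * nr (fun r => qw r * f r) 0 ^ 2 := by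
  have := radial_integral_mul f f
  simp only [← pow_two] at this
  rw [this, nr_sq, ip_self]

theorem ae_ne_zero : ∀ᵐ x : E6, x ≠ 0 := by
  simp [ae_iff]

theorem qw_sq_mul (Ft Fr : ℝ × ℝ → ℝ) {t r : ℝ} (hr : 0 ≤ r) :
    r ^ 5 * (Ft (t, r) ^ 2 + Fr (t, r) ^ 2) = eden Ft Fr t r := by
  rw [eden, mul_pow, mul_pow, qw_sq hr]
  ring

theorem eden_integrable {u : ℝ → E6 → ℝ} {Ft Fr : ℝ × ℝ → ℝ} {t : ℝ}
    (he : ∀ x, x ≠ 0 → eDensity u t x = Ft (t, ‖x‖) ^ 2 + Fr (t, ‖x‖) ^ 2)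
    (h : Integrable (fun x => eDensity u t x)) : IntegrableOn (eden Ft Fr t) (Ioi 0) := by
  have h1 : Integrable (fun x : E6 => (fun r => Ft (t, r) ^ 2 + Fr (t, r) ^ 2) ‖x‖) :=
    h.congr (ae_ne_zero.mono fun x hx => he x hx)
  rw [integrable_fun_norm_addHaar volume (f := fun r => Ft (t, r) ^ 2 + Fr (t, r) ^ 2)] at h1
  refine h1.congr_fun (fun r hr => ?_) measurableSet_Ioi
  simp only [finrank_euclideanSpace, Fintype.card_fin, smul_eq_mul]
  exact qw_sq_mul Ft Fr (mem_Ioi.1 hr).le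

theorem exterior_energy {u : ℝ → E6 → ℝ} {Ft Fr : ℝ × ℝ → ℝ} {t : ℝ}
    (he : ∀ x, x ≠ 0 → eDensity u t x = Ft (t, ‖x‖) ^ 2 + Fr (t, ‖x‖) ^ 2) :
    (∫ x in {x : E6 | |t| ≤ ‖x‖}, eDensity u t x) = c6 * ∫ r in Ioi |t|, eden Ft Fr t r := by
  have hm : MeasurableSet {x : E6 | |t| ≤ ‖x‖} := measurableSet_le measurable_const measurable_norm
  rw [← integral_indicator hm]
  have h1 : (∫ x : E6, indicator {x : E6 | |t| ≤ ‖x‖} (fun x => eDensity u t x) x) =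
      ∫ x : E6, indicator (Ici |t|) (fun r => Ft (t, r) ^ 2 + Fr (t, r) ^ 2) ‖x‖ := by
    refine integral_congr_ae (ae_ne_zero.mono fun x hx => ?_)
    by_cases hx' : |t| ≤ ‖x‖ <;> simp [hx', he x hx]
  have h2 : ∀ r ∈ Ioi (0:ℝ), r ^ 5 * indicator (Ici |t|) (fun r => Ft (t, r) ^ 2 + Fr (t, r) ^ 2) r =
      indicator (Ici |t|) (eden Ft Fr t) r := fun r hr => by
    by_cases hr' : |t| ≤ r
    · simp [hr', qw_sq_mul Ft Fr (mem_Ioi.1 hr).le]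
    · simp [hr']
  rw [h1, radial_integral, setIntegral_congr_fun measurableSet_Ioi h2,
    setIntegral_indicator measurableSet_Ici]
  congr 1
  refine setIntegral_congr_set ?_
  rcases eq_or_lt_of_le (abs_nonneg t) with h0 | h0
  · rw [← h0, inter_eq_left.2 Ioi_subset_Ici_self]; rfl
  · rw [inter_eq_right.2 (Ici_subset_Ioi.2 h0)]
    exact Ioi_ae_eq_Ici.symm

theorem ip_PhiJ {J : ℕ} {lam : Fin J → ℝ} (hl : ∀ j, 0 < lam j) {f : ℝ → ℝ} (hf : L2 f 0)
    (c : Fin J → ℝ) : ip f (PhiJ lam c) 0 = ∑ j, c j * ip f (phi (lam j)) 0 := by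
  have hi : ∀ j ∈ Finset.univ, Integrable (fun r => c j * (f r * phi (lam j) r))
      (volume.restrict (Ioi 0)) := fun j _ => (hf.mul_int (phi_L2 (hl j) le_rfl) le_rfl).const_mul _
  calc ip f (PhiJ lam c) 0 = ∫ r in Ioi 0, ∑ j, c j * (f r * phi (lam j) r) := by
        simp only [ip, PhiJ, Finset.mul_sum]
        congr 1; ext r
        exact Finset.sum_congr rfl fun j _ => by ring
    _ = _ := by
        rw [integral_finsetSum _ hi]
        simp only [integral_const_mul, ip]

theorem nr_le_of_orthogonal {J : ℕ} {lam : Fin J → ℝ} (hl : ∀ j, 0 < lam j) {w : ℝ → ℝ}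
    (hw : L2 w 0) {a : Fin J → ℝ}
    (h : ∀ i, ip (fun r => w r - PhiJ lam a r) (phi (lam i)) 0 = 0) (c : Fin J → ℝ) :
    nr (fun r => w r - PhiJ lam a r) 0 ^ 2 ≤ nr (fun r => w r - PhiJ lam c r) 0 ^ 2 := by
  have hf : L2 (fun r => w r - PhiJ lam a r) 0 := hw.sub (PhiJ_L2 hl a le_rfl).1 le_rfl
  have hd := (PhiJ_L2 hl (fun j => a j - c j) le_rfl).1
  have h1 := hf.nr_comb_sq hd le_rfl 1
  have h2 : (fun r => w r - PhiJ lam a r + 1 * PhiJ lam (fun j => a j - c j) r) =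
      fun r => w r - PhiJ lam c r := by
    ext r
    simp only [PhiJ, sub_mul, Finset.sum_sub_distrib]
    ring
  rw [h2, ip_PhiJ hl hf, Finset.sum_eq_zero fun j _ => by rw [h j, mul_zero]] at h1
  have := sq_nonneg (nr (PhiJ lam fun j => a j - c j) 0)
  linarith

section

variable {J : ℕ} {lam : Fin J → ℝ}

theorem gam_nonneg (hl : ∀ j, 0 < lam j) : 0 ≤ gam lam := by
  refine Real.sSup_nonneg ?_
  rintro _ ⟨j, h, rfl⟩
  exact (div_pos (hl _) (hl _)).le

theorem le_gam_mul (hl : ∀ j, 0 < lam j) (hanti : StrictAnti lam) {i j : Fin J} (hij : i < j) :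
    lam j ≤ gam lam * lam i := by
  have hi : (i : ℕ) + 1 < J := lt_of_le_of_lt (Nat.succ_le_of_lt hij) j.2
  have h1 : lam ⟨(i : ℕ) + 1, hi⟩ / lam i ≤ gam lam := by
    refine le_csSup ⟨1, ?_⟩ ⟨i, hi, rfl⟩
    rintro _ ⟨k, hk, rfl⟩
    exact (div_le_one (hl k)).2 (hanti (Fin.lt_def.2 (Nat.lt_succ_self _))).le
  rw [div_le_iff₀ (hl i)] at h1
  exact (hanti.antitone (Fin.le_def.2 (Nat.succ_le_of_lt hij))).trans h1

end

/-- Channels for odd-in-time solutions around a multisoliton: here the orthogonal projection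
`Π⊥_{L²,λ} ∂ₜu(0) = ∂ₜu(0) - v` is characterized by `v` being the element of
`span((ΛW)_{[λ_j]})` with `∂ₜu(0) - v` orthogonal in `L²` to each `(ΛW)_{[λ_i]}`. -/
theorem stmt16 (J : ℕ) (hJ : 0 < J) :
    ∃ γs C : ℝ, 0 < γs ∧ 0 < C ∧
      ∀ lam : Fin J → ℝ, (∀ j, 0 < lam j) → StrictAnti lam → gam lam ≤ γs →
        ∀ (u : ℝ → E6 → ℝ) (Ep Em : ℝ), IsRadSolOf (Vmulti lam) u →
          Tendsto (fun t => ∫ x in {x : E6 | |t| ≤ ‖x‖}, eDensity u t x) atTop (𝓝 Ep) →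
          Tendsto (fun t => ∫ x in {x : E6 | |t| ≤ ‖x‖}, eDensity u t x) atBot (𝓝 Em) →
          ∀ v : E6 → ℝ, InSpanL lam v →
            (∀ i, ∫ x, (dtu u 0 x - v x) * rescL (lam i) LW6 x = 0) →
            (∫ x, (dtu u 0 x - v x) ^ 2) ≤
              C * ((Ep + Em) + gam lam ^ 2 * ∫ x, dtu u 0 x ^ 2) := by
  obtain ⟨γ, C, hγ, hC, H⟩ := channel_radial J
  refine ⟨γ, C, hγ, hC, ?_⟩
  rintro lam hl hanti hgγ u Ep Em hu hEp hEm v ⟨a, rfl⟩ horth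
  obtain ⟨F, Ft, Fr, Ftt, Ftr, Frr, hR, hdt, he⟩ := hu.exists_rad hl
  have hc := c6_pos
  have hi := eden_integrable (he 0) hu.2.2.2
  have hw := hR.L2_zero hi
  have hE : ∀ t, (∫ x in {x : E6 | |t| ≤ ‖x‖}, eDensity u t x) / c6 =
      ∫ r in Ioi |t|, eden Ft Fr t r := fun t => by
    rw [exterior_energy (he t), mul_div_cancel_left₀ _ hc.ne']
  have hEp' := hEp.div_const c6
  have hEm' := hEm.div_const c6
  simp only [hE] at hEp' hEm'
  have hphi : ∀ l, (fun r => qw r * lwr l r) = phi l := fun l => rfl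
  have hsub : (fun r => qw r * (Ft (0, r) - ∑ j, a j * lwr (lam j) r)) =
      fun r => qw r * Ft (0, r) - PhiJ lam a r := by
    ext r
    rw [mul_sub, Finset.mul_sum, PhiJ]
    congr 1
    exact Finset.sum_congr rfl fun j _ => by rw [← hphi]; ring
  have horth' : ∀ i, ip (fun r => qw r * Ft (0, r) - PhiJ lam a r) (phi (lam i)) 0 = 0 := fun i => by
    have h1 := horth i
    simp only [hdt, rescL_LW6 (hl _)] at h1
    rw [radial_integral_mul (fun r => Ft (0, r) - ∑ j, a j * lwr (lam j) r) (lwr (lam i)), hsub, hphi] at h1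
    exact (mul_eq_zero.1 h1).resolve_left hc.ne'
  simp only [hdt, rescL_LW6 (hl _)]
  rw [radial_integral_sq (fun r => Ft (0, r) - ∑ j, a j * lwr (lam j) r),
    radial_integral_sq (fun r => Ft (0, r)), hsub]
  have key : nr (fun r => qw r * Ft (0, r) - PhiJ lam a r) 0 ^ 2 ≤
      C * ((Ep / c6 + Em / c6) / 2 + gam lam ^ 2 * nr (fun r => qw r * Ft (0, r)) 0 ^ 2) := by
    refine le_of_forall_pos_le_add fun η hη => ?_
    obtain ⟨c, hc⟩ := H hl (fun i j h => hanti.antitone h) (gam_nonneg hl)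
      (fun i j h => le_gam_mul hl hanti h) hgγ hR hi hEp' hEm' (η / C) (by positivity)
    refine (nr_le_of_orthogonal hl hw horth' c).trans (hc.trans (le_of_eq ?_))
    field_simp
  have hEpm : 0 ≤ Ep + Em := by
    have h0 : ∀ t, 0 ≤ ∫ x in {x : E6 | |t| ≤ ‖x‖}, eDensity u t x := fun t =>
      integral_nonneg fun x => by unfold eDensity; positivity
    exact add_nonneg (ge_of_tendsto' hEp h0) (ge_of_tendsto' hEm h0)
  calc _ ≤ c6 * (C * ((Ep / c6 + Em / c6) / 2 +
        gam lam ^ 2 * nr (fun r => qw r * Ft (0, r)) 0 ^ 2)) := by gcongr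
    _ = C * ((Ep + Em) / 2 + gam lam ^ 2 * (c6 * nr (fun r => qw r * Ft (0, r)) 0 ^ 2)) := by
        field_simp
    _ ≤ _ := by
        gcongr
        linarith

end
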